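/- Let N_ℓ denote the closed orientable surface of genus ℓ ≥ 2 (connected sum of ℓ tori) embedded in S³. Then there is no 1-dimensional compact submanifold S of S³ (without boundary) and homotopy retract P : S³ \ S → N_ℓ; that is, there is no continuous map P : S³ \ S → N_ℓ restricting to the identity on N_ℓ and such that the inclusion composed with P is homotopic to the identity of S³ \ S. -/

import Mathlib

/-- The 3-sphere, realized as the unit sphere of `ℝ⁴`. -/
abbrev Sph3 : Set (EuclideanSpace ℝ (Fin 4)) := Metric.sphere 0 1

/-- The fundamental group of the closed orientable surface of genus `ℓ`:
`⟨a₁, b₁, …, a_ℓ, b_ℓ ∣ [a₁,b₁]⋯[a_ℓ,b_ℓ]⟩`. -/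
abbrev surfaceGroup (ℓ : ℕ) :=
  PresentedGroup
    ({(List.ofFn fun i : Fin ℓ =>
        FreeGroup.of (Sum.inl i) * FreeGroup.of (Sum.inr i) *
          (FreeGroup.of (Sum.inl i))⁻¹ * (FreeGroup.of (Sum.inr i))⁻¹).prod} :
      Set (FreeGroup (Fin ℓ ⊕ Fin ℓ)))

namespace SphereMaps

open Set Topology Metric unitInterval

/-- Euclidean three-space. -/
abbrev E3 : Type := EuclideanSpace ℝ (Fin 3)

/-- The unit sphere of Euclidean three-space. -/
abbrev S2 : Type := ↥(Metric.sphere (0 : E3) 1)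

noncomputable section

/-- Normalization of a nowhere vanishing map to `E3`. -/
def unit {M : Type*} [TopologicalSpace M] (f : C(M, E3)) (hf : ∀ x, f x ≠ 0) : C(M, S2) where
  toFun x := ⟨‖f x‖⁻¹ • f x, by
    have := norm_ne_zero_iff.2 (hf x)
    simp [norm_smul, this]⟩
  continuous_toFun := by
    refine Continuous.subtype_mk ?_ _
    exact (f.continuous.norm.inv₀ fun x => norm_ne_zero_iff.2 (hf x)).smul f.continuous

theorem unit_apply {M : Type*} [TopologicalSpace M] (f : C(M, E3)) (hf : ∀ x, f x ≠ 0) (x : M) :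
    (unit f hf x : E3) = ‖f x‖⁻¹ • f x := rfl

theorem norm_coe_S2 (x : S2) : ‖(x : E3)‖ = 1 := by simp

theorem coe_S2_ne_zero (x : S2) : (x : E3) ≠ 0 := by
  rw [← norm_ne_zero_iff, norm_coe_S2]; exact one_ne_zero

/-- The inclusion of the sphere, as a continuous map. -/
def incl : C(S2, E3) := ⟨Subtype.val, continuous_subtype_val⟩

theorem unit_eq_of_eq {M : Type*} [TopologicalSpace M] (f : C(M, E3)) (hf : ∀ x, f x ≠ 0) (x : M)
    (s : S2) (h : f x = s) : unit f hf x = s := by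
  apply Subtype.ext
  rw [unit_apply, h, norm_coe_S2, inv_one, one_smul]

/-- Two nowhere vanishing maps joined by a nowhere vanishing straight-line homotopy. -/
theorem unit_homotopic {M : Type*} [TopologicalSpace M] (K : C(I × M, E3)) (hK : ∀ p, K p ≠ 0)
    (f g : C(M, S2)) (hf : ∀ x, K (0, x) = f x) (hg : ∀ x, unit K hK (1, x) = g x) :
    f.Homotopic g :=
  ⟨{ toContinuousMap := unit K hK
     map_zero_left := fun x => unit_eq_of_eq _ _ _ _ (hf x)
     map_one_left := hg }⟩

/-- Borsuk's homotopy extension theorem for maps to the sphere. -/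
theorem exists_homotopic_extension {Y : Type*} [MetricSpace Y] {A : Set Y} (hA : IsClosed A)
    (f : C(Y, S2)) (g : C(A, S2)) (h : (f.restrict A).Homotopic g) :
    ∃ F : C(Y, S2), (∀ a : A, F a = g a) ∧ f.Homotopic F := by
  obtain ⟨H⟩ := h
  let e : I × A → I × Y := Prod.map id Subtype.val
  have he : IsClosedEmbedding e := IsClosedEmbedding.id.prodMap hA.isClosedEmbedding_subtypeVal
  obtain ⟨G, hG⟩ := ContinuousMap.exists_extension' he (incl.comp H.toContinuousMap)
  have hG' : ∀ (t : I) (a : A), G (t, (a : Y)) = (H (t, a) : E3) := fun t a => congrFun hG (t, a)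
  let K : C(I × Y, E3) :=
    ⟨fun p => G p + ((f p.2 : E3) - G (0, p.2)), by fun_prop⟩
  have hK0 : ∀ y, K (0, y) = f y := fun y => by simp [K]
  have hKA : ∀ (t : I) (a : A), K (t, (a : Y)) = (H (t, a) : E3) := fun t a => by
    have h0 : H (0, a) = f a := H.apply_zero a
    simp [K, hG', h0]
  let Z : Set Y := Prod.snd '' {p : I × Y | K p = 0}
  have hZ : IsClosed Z :=
    isClosedMap_snd_of_compactSpace _ (isClosed_eq K.continuous continuous_const)
  have hdisj : Disjoint Z A := by
    rw [Set.disjoint_left]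
    rintro _ ⟨⟨t, y⟩, hp, rfl⟩ hy
    exact coe_S2_ne_zero _ ((hKA t ⟨y, hy⟩).symm.trans hp)
  obtain ⟨φ, hφ0, hφ1, hφ⟩ := exists_continuous_zero_one_of_isClosed hZ hA hdisj
  let ψ : C(Y, I) := ⟨fun y => ⟨φ y, hφ y⟩, by fun_prop⟩
  let L : C(I × Y, E3) := ⟨fun p => K (p.1 * ψ p.2, p.2), by fun_prop⟩
  have hL : ∀ p, L p ≠ 0 := by
    rintro ⟨t, y⟩ hp
    have hy : y ∈ Z := ⟨_, hp, rfl⟩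
    have h0 : ψ y = 0 := Subtype.ext (hφ0 hy)
    have hp' : K (t * ψ y, y) = 0 := hp
    rw [h0, mul_zero, hK0] at hp'
    exact coe_S2_ne_zero _ hp'
  have hLK : ∀ t y, L (t, y) = K (t * ψ y, y) := fun t y => rfl
  let j : C(Y, I × Y) := ⟨fun y => (1, y), by fun_prop⟩
  refine ⟨(unit L hL).comp j, fun a => ?_, unit_homotopic L hL _ _ (fun x => ?_) fun x => rfl⟩
  · have h1 : ψ a = 1 := Subtype.ext (hφ1 a.2)
    have h2 : H (1, a) = g a := H.apply_one a
    have h3 : L (1, (a : Y)) = (g a : E3) := by rw [hLK, h1, mul_one, hKA, h2]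
    exact unit_eq_of_eq L hL (1, (a : Y)) (g a) h3
  · rw [hLK, zero_mul, hK0]

/-- Maps to the sphere that are nowhere antipodal are homotopic. -/
theorem homotopic_of_dist_lt {M : Type*} [TopologicalSpace M] (f : C(M, S2)) (g : C(M, E3))
    (hg : ∀ x, g x ≠ 0) (h : ∀ x, dist (g x) (f x) < 1) : (f.Homotopic (unit g hg)) := by
  let K : C(I × M, E3) :=
    ⟨fun p => (f p.2 : E3) + (p.1 : ℝ) • (g p.2 - (f p.2 : E3)), by fun_prop⟩
  have hK : ∀ p, K p ≠ 0 := by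
    rintro ⟨t, x⟩ hp
    have h1 : (f x : E3) = - ((t : ℝ) • (g x - (f x : E3))) := eq_neg_of_add_eq_zero_left hp
    have h2 : (1 : ℝ) = (t : ℝ) * dist (g x) (f x) := by
      have h2 := congrArg norm h1
      rwa [norm_coe_S2, norm_neg, norm_smul, ← dist_eq_norm, Real.norm_of_nonneg t.2.1] at h2
    have := h x
    have h3 : (t : ℝ) * dist (g x) (f x) ≤ 1 * dist (g x) (f x) :=
      mul_le_mul_of_nonneg_right t.2.2 dist_nonneg
    linarith
  refine unit_homotopic K hK _ _ (fun x => by simp [K]) fun x => Subtype.ext ?_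
  simp [unit_apply, K]

/-- A map from a closed subset of a closed set in the plane to the sphere extends to the plane. -/
theorem exists_extension_plane {V : Type*} [NormedAddCommGroup V] [NormedSpace ℝ V]
    [FiniteDimensional ℝ V] (hV : Module.finrank ℝ V < 3) {K : Set V} (hK : IsClosed K)
    (g : C(K, S2)) : ∃ G : C(V, S2), ∀ x : K, G x = g x := by
  obtain ⟨T, hT⟩ := ContinuousMap.exists_restrict_eq hK (incl.comp g)
  have hT' : ∀ x : K, T x = (g x : E3) := fun x => congrFun (congrArg DFunLike.coe hT) x
  obtain ⟨s, hs, hsT, -⟩ := T.continuous.exists_contDiff_approx (ε := fun _ => (1 / 3 : ℝ)) 1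
    continuous_const (fun _ => by norm_num)
  have hd : Dense (range s)ᶜ := hs.dense_compl_range_of_finrank_lt_finrank (by simpa using hV)
  obtain ⟨v, hv, hv0⟩ := hd.exists_dist_lt (0 : E3) (ε := 1 / 3) (by norm_num)
  let G : C(V, E3) := ⟨fun x => s x - v, hs.continuous.sub continuous_const⟩
  have hG : ∀ x, G x ≠ 0 := fun x hx => hv ⟨x, sub_eq_zero.1 hx⟩
  have hh : g.Homotopic ((unit G hG).restrict K) := by
    refine homotopic_of_dist_lt g (G.restrict K) (fun x => hG x) fun x => ?_
    have h1 := hsT x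
    rw [hT'] at h1
    have h2 : dist (G x) (s x) < 1 / 3 := by
      rw [dist_zero_left] at hv0
      simpa [G, dist_eq_norm] using hv0
    have := dist_triangle (G x) (s x) (g x : E3)
    change dist (G x) (g x : E3) < 1
    linarith
  obtain ⟨F, hF, -⟩ := exists_homotopic_extension hK (unit G hG) g hh.symm
  exact ⟨F, hF⟩

/-- If a map to the sphere is inessential off an open set which can be collapsed injectively to
the plane, then it is inessential. -/
theorem nullhomotopic_of_collapse {X : Type*} [MetricSpace X] [CompactSpace X] (f : C(X, S2))
    {A : Set X} (hA : IsClosed A) (hf : (f.restrict A).Nullhomotopic)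
    {V : Type*} [NormedAddCommGroup V] [NormedSpace ℝ V]
    [FiniteDimensional ℝ V] (hV : Module.finrank ℝ V < 3) (ι : C(X, V))
    (hι0 : ∀ x ∈ A, ι x = 0) (hι1 : ∀ x ∉ A, ι x ≠ 0) (hinj : InjOn ι Aᶜ) :
    f.Nullhomotopic := by
  obtain ⟨c, hc⟩ := hf
  obtain ⟨F, hF, hfF⟩ := exists_homotopic_extension hA f _ hc
  have hFA : ∀ x ∈ A, F x = c := fun x hx => hF ⟨x, hx⟩
  let ρ : C(X, range ι) := ⟨rangeFactorization ι, ι.continuous.rangeFactorization⟩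
  have hρ : IsQuotientMap ρ := by
    have hcl : IsClosedMap ρ := ρ.continuous.isClosedMap
    exact hcl.isQuotientMap ρ.continuous rangeFactorization_surjective
  have hfac : ∀ x y, ρ x = ρ y → F x = F y := by
    intro x y hxy
    have hxy' : ι x = ι y := congrArg Subtype.val hxy
    by_cases hx : x ∈ A <;> by_cases hy : y ∈ A
    · rw [hFA x hx, hFA y hy]
    · exact absurd (hxy'.symm.trans (hι0 x hx)) (hι1 y hy)
    · exact absurd (hxy'.trans (hι0 y hy)) (hι1 x hx)
    · rw [hinj hx hy hxy']
  let G : C(range ι, S2) := hρ.lift F fun x y => hfac x y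
  have hG : ∀ x, G (ρ x) = F x := fun x => congrFun (congrArg DFunLike.coe (hρ.lift_comp F fun x y => hfac x y)) x
  obtain ⟨E, hE⟩ := exists_extension_plane hV (isCompact_range ι.continuous).isClosed G
  have hFE : F = E.comp ι := by
    ext1 x
    rw [← hG x, ← hE]
    rfl
  have : E.Nullhomotopic := by
    have := (id_nullhomotopic V).comp_right E
    simpa using this
  have h2 := this.comp_left ι
  rw [← hFE] at h2
  obtain ⟨d, hd⟩ := h2
  exact ⟨d, hfF.trans hd⟩

end

end SphereMaps

namespace SphereMaps

open Set Topology Metric unitInterval MeasureTheory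

noncomputable section

theorem exists_det_expansion :
    ∃ c₁ c₂ c₃ : (E3 →L[ℝ] E3) → ℝ, Continuous c₁ ∧ Continuous c₂ ∧ Continuous c₃ ∧
      ∀ (A : E3 →L[ℝ] E3) (t : ℝ),
        (ContinuousLinearMap.id ℝ E3 + t • A).det = 1 + c₁ A * t + c₂ A * t ^ 2 + c₃ A * t ^ 3 := by
  let e : Fin 3 → E3 := fun i => EuclideanSpace.basisFun (Fin 3) ℝ i
  let m : Fin 3 → Fin 3 → (E3 →L[ℝ] E3) → ℝ := fun i j A => (A (e j)) i
  have hm : ∀ i j, Continuous (m i j) := fun i j => by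
    have h1 : Continuous fun A : E3 →L[ℝ] E3 => A (e j) := by fun_prop
    exact (EuclideanSpace.proj (𝕜 := ℝ) i).continuous.comp h1
  refine ⟨fun A => m 0 0 A + m 1 1 A + m 2 2 A,
    fun A => m 0 0 A * m 1 1 A - m 0 1 A * m 1 0 A + m 0 0 A * m 2 2 A - m 0 2 A * m 2 0 A
      + m 1 1 A * m 2 2 A - m 1 2 A * m 2 1 A,
    fun A => m 0 0 A * m 1 1 A * m 2 2 A - m 0 0 A * m 1 2 A * m 2 1 A
      - m 0 1 A * m 1 0 A * m 2 2 A + m 0 1 A * m 1 2 A * m 2 0 A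
      + m 0 2 A * m 1 0 A * m 2 1 A - m 0 2 A * m 1 1 A * m 2 0 A, by fun_prop, by fun_prop,
    by fun_prop, fun A t => ?_⟩
  rw [ContinuousLinearMap.det, ← LinearMap.det_toMatrix (EuclideanSpace.basisFun (Fin 3) ℝ).toBasis,
    Matrix.det_fin_three]
  have key : ∀ i j, LinearMap.toMatrix (EuclideanSpace.basisFun (Fin 3) ℝ).toBasis
      (EuclideanSpace.basisFun (Fin 3) ℝ).toBasis
      ((ContinuousLinearMap.id ℝ E3 + t • A : E3 →L[ℝ] E3) : E3 →ₗ[ℝ] E3) i j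
      = (if i = j then 1 else 0) + t * m i j A := fun i j => by
    rw [LinearMap.toMatrix_apply]
    simp [m, e]
  simp only [key]
  simp
  ring

theorem det_eq_zero_of_norm_const {f : E3 → E3} {f' : E3 →L[ℝ] E3} {x : E3} {r : ℝ} (hr : r ≠ 0)
    (hf : HasFDerivAt f f' x) (hn : ∀ y, ‖f y‖ = r) : f'.det = 0 := by
  by_contra hd
  have h1 : HasFDerivAt (fun y => ‖f y‖ ^ 2) _ x := hf.norm_sq
  have h2 : HasFDerivAt (fun y => ‖f y‖ ^ 2) (0 : E3 →L[ℝ] ℝ) x := by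
    simp only [hn]; exact hasFDerivAt_const _ _
  have h3 := h1.unique h2
  have hu : IsUnit (LinearMap.det (f' : E3 →ₗ[ℝ] E3)) := isUnit_iff_ne_zero.2 hd
  obtain ⟨v, hv⟩ := (LinearMap.equivOfDetNeZero (f' : E3 →ₗ[ℝ] E3) hd).surjective (f x)
  have hv' : f' v = f x := hv
  have h4 := congrArg (fun L : E3 →L[ℝ] ℝ => L v) h3
  simp [hv'] at h4
  have := hn x
  rw [h4, norm_zero] at this
  exact hr this.symm

/-- A Lipschitz map on a ball which vanishes on the boundary sphere extends by zero. -/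
theorem lipschitz_extend_zero {k : E3 → E3} {ρ : ℝ} {C : NNReal}
    (hk : LipschitzOnWith C k (closedBall 0 ρ)) (h0 : ∀ x, ‖x‖ = ρ → k x = 0) :
    LipschitzWith C (fun x => if ‖x‖ ≤ ρ then k x else 0) := by
  have aux : ∀ x y : E3, ‖x‖ ≤ ρ → ¬ ‖y‖ ≤ ρ → dist (k x) 0 ≤ C * dist x y := by
    intro x y hx hy
    have hc : ContinuousOn (fun t : ℝ => ‖AffineMap.lineMap x y t‖) (Icc 0 1) :=
      (AffineMap.lineMap_continuous.norm).continuousOn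
    obtain ⟨t, ht, hz⟩ := intermediate_value_Icc zero_le_one hc
      (show ρ ∈ _ by simp [hx, le_of_not_ge hy])
    have h1 := hk.dist_le_mul x (by simpa using hx) (AffineMap.lineMap x y t)
      (by simpa using hz.le)
    rw [h0 _ hz] at h1
    refine h1.trans ?_
    gcongr
    rw [dist_left_lineMap, Real.norm_of_nonneg ht.1]
    nlinarith [ht.2, dist_nonneg (x := x) (y := y)]
  refine LipschitzWith.of_dist_le_mul fun x y => ?_
  by_cases hx : ‖x‖ ≤ ρ <;> by_cases hy : ‖y‖ ≤ ρ
  · simp only [hx, hy, if_true]; exact hk.dist_le_mul _ (by simpa using hx) _ (by simpa using hy)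
  · simp only [hx, hy, if_true, if_false]; exact aux x y hx hy
  · simp only [hx, hy, if_true, if_false]; rw [dist_comm, dist_comm x]; exact aux y x hy hx
  · simp only [hx, hy, if_false, dist_self]; positivity

/-- A `C¹` self-map of a ball fixing the boundary sphere pointwise cannot have constant norm. -/
theorem no_smooth_retraction {f : E3 → E3} (hf : ContDiff ℝ 1 f) {ρ : ℝ} (hρ : 0 < ρ)
    (hn : ∀ x, ‖f x‖ = ρ) (hb : ∀ x, ‖x‖ = ρ → f x = x) : False := by
  obtain ⟨c₁, c₂, c₃, hc₁, hc₂, hc₃, hdet⟩ := exists_det_expansion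
  let k : E3 → E3 := fun x => f x - x
  have hk : ContDiff ℝ 1 k := hf.sub contDiff_id
  have hcomp : IsCompact (closedBall (0 : E3) ρ) := isCompact_closedBall _ _
  obtain ⟨C, hC⟩ := (hk.contDiffOn (s := closedBall (0 : E3) ρ)).exists_lipschitzOnWith
    one_ne_zero (convex_closedBall _ _) hcomp
  have hlip := lipschitz_extend_zero hC (fun x hx => by simp [k, hb x hx])
  set k' : E3 → E3 := fun x => if ‖x‖ ≤ ρ then k x else 0 with hk'
  have hA : Continuous (fderiv ℝ k) := hk.continuous_fderiv one_ne_zero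
  let a₁ : E3 → ℝ := fun x => c₁ (fderiv ℝ k x)
  let a₂ : E3 → ℝ := fun x => c₂ (fderiv ℝ k x)
  let a₃ : E3 → ℝ := fun x => c₃ (fderiv ℝ k x)
  have ha₁ : Continuous a₁ := hc₁.comp hA
  have ha₂ : Continuous a₂ := hc₂.comp hA
  have ha₃ : Continuous a₃ := hc₃.comp hA
  obtain ⟨B₁, hB₁⟩ := hcomp.exists_bound_of_continuousOn ha₁.continuousOn
  obtain ⟨B₂, hB₂⟩ := hcomp.exists_bound_of_continuousOn ha₂.continuousOn
  obtain ⟨B₃, hB₃⟩ := hcomp.exists_bound_of_continuousOn ha₃.continuousOn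
  let B := closedBall (0 : E3) ρ
  have hBm : MeasurableSet B := hcomp.isClosed.measurableSet
  have i₀ : IntegrableOn (fun _ : E3 => (1 : ℝ)) B := continuousOn_const.integrableOn_compact hcomp
  have i₁ := ha₁.continuousOn.integrableOn_compact (μ := volume) hcomp
  have i₂ := ha₂.continuousOn.integrableOn_compact (μ := volume) hcomp
  have i₃ := ha₃.continuousOn.integrableOn_compact (μ := volume) hcomp
  have hV : ∀ t : ℝ, ∫ x in B, (ContinuousLinearMap.id ℝ E3 + t • fderiv ℝ k x).det =
      (∫ x in B, (1 : ℝ)) + (∫ x in B, a₁ x) * t + (∫ x in B, a₂ x) * t ^ 2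
        + (∫ x in B, a₃ x) * t ^ 3 := by
    intro t
    simp only [hdet]
    rw [integral_add, integral_add, integral_add, integral_mul_const, integral_mul_const,
      integral_mul_const]
    · exact i₀
    · exact i₁.mul_const _
    · exact i₀.add (i₁.mul_const _)
    · exact i₂.mul_const _
    · exact (i₀.add (i₁.mul_const _)).add (i₂.mul_const _)
    · exact i₃.mul_const _
  have hderiv : ∀ (t : ℝ) (x : E3), HasFDerivAt (fun y => y + t • k y)
      (ContinuousLinearMap.id ℝ E3 + t • fderiv ℝ k x) x := fun t x =>
    (hasFDerivAt_id x).add (((hk.differentiable one_ne_zero) x).hasFDerivAt.const_smul t)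
  have h0B : (0 : E3) ∈ B := by simp [B, hρ.le]
  have hpos₁ : 0 ≤ B₁ := (norm_nonneg _).trans (hB₁ 0 h0B)
  have hpos₂ : 0 ≤ B₂ := (norm_nonneg _).trans (hB₂ 0 h0B)
  have hpos₃ : 0 ≤ B₃ := (norm_nonneg _).trans (hB₃ 0 h0B)
  let δ : ℝ := 1 / (2 + C + B₁ + B₂ + B₃)
  have hDpos : (0 : ℝ) < 2 + C + B₁ + B₂ + B₃ := by positivity
  have hδ : 0 < δ := by positivity
  have hδ1 : δ * (2 + C + B₁ + B₂ + B₃) = 1 := by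
    simp only [δ]; field_simp
  have hsmall : ∀ t : ℝ, 0 < t → t ≤ δ →
      ∫ x in B, (ContinuousLinearMap.id ℝ E3 + t • fderiv ℝ k x).det = ∫ x in B, (1 : ℝ) := by
    intro t ht htδ
    have htD : t * (2 + C + B₁ + B₂ + B₃) ≤ 1 := by
      rw [← hδ1]; gcongr
    have ht1 : t ≤ 1 := by nlinarith [C.2, mul_nonneg ht.le C.2, mul_nonneg ht.le hpos₁, mul_nonneg ht.le hpos₂, mul_nonneg ht.le hpos₃]
    have htC : t * C < 1 := by
      nlinarith [mul_nonneg ht.le hpos₁, mul_nonneg ht.le hpos₂, mul_nonneg ht.le hpos₃]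
    have hdetpos : ∀ x ∈ B, 0 < (ContinuousLinearMap.id ℝ E3 + t • fderiv ℝ k x).det := by
      intro x hx
      rw [hdet]
      have e₁ := abs_le.1 (hB₁ x hx)
      have e₂ := abs_le.1 (hB₂ x hx)
      have e₃ := abs_le.1 (hB₃ x hx)
      have t2 : t ^ 2 ≤ t := by nlinarith
      have t3 : t ^ 3 ≤ t := by nlinarith [sq_nonneg t]
      have p2 : 0 ≤ t ^ 2 := by positivity
      have p3 : 0 ≤ t ^ 3 := by positivity
      have q₁ : -(B₁ * t) ≤ c₁ (fderiv ℝ k x) * t := by nlinarith [e₁.1]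
      have q₂ : -(B₂ * t) ≤ c₂ (fderiv ℝ k x) * t ^ 2 := by nlinarith [e₂.1]
      have q₃ : -(B₃ * t) ≤ c₃ (fderiv ℝ k x) * t ^ 3 := by nlinarith [e₃.1]
      nlinarith [mul_nonneg ht.le C.2]
    let Φ : E3 → E3 := fun x => x + t • k' x
    have hΦ : ApproximatesLinearOn Φ ((ContinuousLinearEquiv.refl ℝ E3 : E3 ≃L[ℝ] E3) : E3 →L[ℝ] E3)
        univ (Real.toNNReal t * C) := by
      rw [ApproximatesLinearOn]
      intro x _ y _
      have := hlip.dist_le_mul x y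
      rw [dist_eq_norm, dist_eq_norm] at this
      have e : Φ x - Φ y - (((ContinuousLinearEquiv.refl ℝ E3 : E3 ≃L[ℝ] E3) : E3 →L[ℝ] E3) (x - y))
          = t • (k' x - k' y) := by
        simp [Φ, smul_sub]; abel
      rw [e, norm_smul, Real.norm_of_nonneg ht.le, NNReal.coe_mul, Real.coe_toNNReal _ ht.le,
        mul_assoc]
      gcongr
    have hlt : Subsingleton E3 ∨ Real.toNNReal t * C <
        ‖((ContinuousLinearEquiv.refl ℝ E3 : E3 ≃L[ℝ] E3).symm : E3 →L[ℝ] E3)‖₊⁻¹ := by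
      right
      have : ‖((ContinuousLinearEquiv.refl ℝ E3 : E3 ≃L[ℝ] E3).symm : E3 →L[ℝ] E3)‖₊ = 1 := by
        have : ‖ContinuousLinearMap.id ℝ E3‖₊ = 1 := by
          apply NNReal.eq; exact ContinuousLinearMap.norm_id
        exact this
      rw [this, inv_one, ← NNReal.coe_lt_coe, NNReal.coe_mul, Real.coe_toNNReal _ ht.le]
      exact htC
    have hinj : Function.Injective Φ := injOn_univ.1 (hΦ.injOn hlt)
    have hsurj := hΦ.surjective hlt
    have hΦin : ∀ x, ‖x‖ ≤ ρ → Φ x = x + t • k x := fun x hx => by simp [Φ, hk', hx]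
    have hΦout : ∀ x, ¬ ‖x‖ ≤ ρ → Φ x = x := fun x hx => by simp [Φ, hk', hx]
    have himg : (fun x => x + t • k x) '' B = B := by
      ext y
      constructor
      · rintro ⟨x, hx, rfl⟩
        have hx' : ‖x‖ ≤ ρ := by simpa [B] using hx
        by_contra hy
        have hy' : ¬ ‖x + t • k x‖ ≤ ρ := by simpa [B] using hy
        have := hΦout _ hy'
        rw [← hΦin x hx'] at this
        have := hinj this
        rw [hΦin x hx'] at this
        rw [this] at hy'
        exact hy' hx'
      · intro hy
        have hy' : ‖y‖ ≤ ρ := by simpa [B] using hy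
        obtain ⟨x, rfl⟩ := hsurj y
        by_cases hx : ‖x‖ ≤ ρ
        · exact ⟨x, by simpa [B] using hx, (hΦin x hx).symm⟩
        · rw [hΦout x hx] at hy'; exact absurd hy' hx
    have hinjB : InjOn (fun x => x + t • k x) B := by
      intro x hx y hy hxy
      have hx' : ‖x‖ ≤ ρ := by simpa [B] using hx
      have hy' : ‖y‖ ≤ ρ := by simpa [B] using hy
      apply hinj
      rw [hΦin x hx', hΦin y hy']; exact hxy
    have hcov := integral_image_eq_integral_abs_det_fderiv_smul volume hBm
      (fun x _ => (hderiv t x).hasFDerivWithinAt) hinjB (fun _ => (1 : ℝ))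
    rw [himg] at hcov
    rw [hcov]
    refine setIntegral_congr_fun hBm fun x hx => ?_
    simp [abs_of_pos (hdetpos x hx)]
  have e1 := hsmall δ hδ le_rfl
  have e2 := hsmall (δ / 2) (by positivity) (by linarith)
  have e3 := hsmall (δ / 3) (by positivity) (by linarith)
  rw [hV] at e1 e2 e3
  set b₁ := ∫ x in B, a₁ x
  set b₂ := ∫ x in B, a₂ x
  set b₃ := ∫ x in B, a₃ x
  have z1 : b₁ + b₂ * δ + b₃ * δ ^ 2 = 0 :=
    (mul_eq_zero.1 (show δ * (b₁ + b₂ * δ + b₃ * δ ^ 2) = 0 by linarith)).resolve_left hδ.ne'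
  have z2 : b₁ + b₂ * δ / 2 + b₃ * δ ^ 2 / 4 = 0 :=
    (mul_eq_zero.1 (show δ * (b₁ + b₂ * δ / 2 + b₃ * δ ^ 2 / 4) = 0 by linarith)).resolve_left hδ.ne'
  have z3 : b₁ + b₂ * δ / 3 + b₃ * δ ^ 2 / 9 = 0 :=
    (mul_eq_zero.1 (show δ * (b₁ + b₂ * δ / 3 + b₃ * δ ^ 2 / 9) = 0 by linarith)).resolve_left hδ.ne'
  have y1 : b₁ = 0 := by linarith
  have y2 : b₂ = 0 := (mul_eq_zero.1 (show b₂ * δ = 0 by linarith)).resolve_right hδ.ne'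
  have y3 : b₃ = 0 :=
    (mul_eq_zero.1 (show b₃ * δ ^ 2 = 0 by linarith)).resolve_right (by positivity)
  have hV1 := hV 1
  rw [y1, y2, y3] at hV1
  have hz : ∀ x, (ContinuousLinearMap.id ℝ E3 + (1 : ℝ) • fderiv ℝ k x).det = 0 := fun x => by
    have := hderiv 1 x
    simp only [k, one_smul, add_sub_cancel] at this
    rw [one_smul]
    exact det_eq_zero_of_norm_const hρ.ne' this hn
  simp only [hz, integral_zero] at hV1
  have hvol : (∫ x in B, (1 : ℝ)) = volume.real B := by simp
  have : 0 < volume.real B := by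
    rw [Measure.real, ENNReal.toReal_pos_iff]
    exact ⟨measure_closedBall_pos _ _ hρ, measure_closedBall_lt_top⟩
  linarith

/-- There is no continuous map from space to the sphere which is radial near infinity. -/
theorem no_retraction (F : C(E3, S2)) (R : ℝ) (hF : ∀ x : E3, R ≤ ‖x‖ → (F x : E3) = ‖x‖⁻¹ • x) :
    False := by
  wlog hR : 1 ≤ R generalizing R with H
  · exact H 1 (fun x hx => hF x (by linarith)) le_rfl
  let G : E3 → E3 := fun x => (max ‖x‖ R) • (F x : E3)
  have hGc : Continuous G := by
    have : Continuous fun x => (F x : E3) := continuous_subtype_val.comp F.continuous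
    exact (continuous_norm.max continuous_const).smul this
  have hG1 : ∀ x, R ≤ ‖x‖ → G x = x := fun x hx => by
    have : ‖x‖ ≠ 0 := by linarith
    simp only [G, hF x hx, max_eq_left hx, smul_smul, mul_inv_cancel₀ this, one_smul]
  have hGn : ∀ x, R ≤ ‖G x‖ := fun x => by
    simp only [G, norm_smul, norm_coe_S2, mul_one, Real.norm_eq_abs]
    exact (le_max_right _ _).trans (le_abs_self _)
  have hGU : ContDiffOn ℝ (1 : ℕ∞) G {x | R < ‖x‖} :=
    contDiff_id.contDiffOn.congr fun x hx => hG1 x (le_of_lt hx)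
  obtain ⟨g, hg, hgd, hgS, -⟩ := hGc.exists_contDiff_approx_and_eqOn 1 (ε := fun _ => R / 2)
    continuous_const (fun _ => by linarith) (S := {x | R + 1 ≤ ‖x‖}) (U := {x | R < ‖x‖})
    (isClosed_le continuous_const continuous_norm)
    ((isOpen_lt continuous_const continuous_norm).mem_nhdsSet.2 fun x hx => by
      simp only [mem_ofPred_eq] at hx ⊢; linarith) hGU
  have hg0 : ∀ x, g x ≠ 0 := fun x h0 => by
    have h1 := hgd x
    rw [h0, dist_zero_left] at h1
    linarith [hGn x]
  have hg0' : ∀ x, ‖g x‖ ≠ 0 := fun x => norm_ne_zero_iff.2 (hg0 x)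
  refine no_smooth_retraction (f := fun x => (R + 2) • (‖g x‖⁻¹ • g x)) (ρ := R + 2) ?_
    (by linarith) ?_ ?_
  · exact ((hg.norm ℝ hg0).inv hg0' |>.smul hg).const_smul (R + 2)
  · intro x
    rw [norm_smul, norm_smul, norm_inv, norm_norm, inv_mul_cancel₀ (hg0' x), mul_one,
      Real.norm_of_nonneg (by linarith)]
  · intro x hx
    have : g x = x := (hgS (show R + 1 ≤ ‖x‖ by linarith)).trans (hG1 x (by linarith))
    rw [this, hx, smul_smul, mul_inv_cancel₀ (by linarith), one_smul]

end

end SphereMaps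

namespace SphereMaps

open Set Topology Metric unitInterval

noncomputable section

/-- The direction from `p` to `φ x`. -/
def radial {M : Type*} [TopologicalSpace M] (p : E3) (φ : C(M, E3)) (h : ∀ x, φ x ≠ p) : C(M, S2) :=
  unit (φ - ContinuousMap.const M p) fun x => by simpa [sub_eq_zero] using h x

theorem radial_apply {M : Type*} [TopologicalSpace M] (p : E3) (φ : C(M, E3)) (h : ∀ x, φ x ≠ p)
    (x : M) : (radial p φ h x : E3) = ‖φ x - p‖⁻¹ • (φ x - p) := rfl

theorem radial_comp {M L : Type*} [TopologicalSpace M] [TopologicalSpace L] (p : E3) (φ : C(M, E3))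
    (h : ∀ x, φ x ≠ p) (s : C(L, M)) :
    (radial p φ h).comp s = radial p (φ.comp s) (fun x => h (s x)) := rfl

theorem not_nullhomotopic_radial_frontier {U : Set E3} (hU : IsOpen U) (hb : Bornology.IsBounded U)
    {p : E3} (hp : p ∈ U) (φ : C(↥(frontier U), E3)) (hφ : ∀ x, φ x = x) (h : ∀ x, φ x ≠ p) :
    ¬ (radial p φ h).Nullhomotopic := by
  rintro ⟨c, hc⟩
  obtain ⟨F, hF, -⟩ := exists_homotopic_extension isClosed_frontier (ContinuousMap.const E3 c)
    (radial p φ h) hc.symm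
  classical
  let G : E3 → E3 := fun x => if x ∈ U then (F x : E3) else ‖x - p‖⁻¹ • (x - p)
  have hG : Continuous G := by
    refine continuous_if (fun a ha => ?_) (continuous_subtype_val.comp F.continuous).continuousOn ?_
    · have := hF ⟨a, ha⟩
      simp only at this
      rw [this, radial_apply, hφ]
    · have : closure {a | ¬ a ∈ U} = Uᶜ := hU.isClosed_compl.closure_eq
      rw [this]
      have a : ContinuousOn (fun x : E3 => ‖x - p‖⁻¹) Uᶜ :=
        ContinuousOn.inv₀ (by fun_prop) fun x hx h0 => by
          rw [norm_eq_zero, sub_eq_zero] at h0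
          exact hx (h0 ▸ hp)
      exact a.smul (by fun_prop)
  have hGn : ∀ x, ‖G x‖ = 1 := fun x => by
    by_cases hx : x ∈ U
    · simp only [G, if_pos hx, norm_coe_S2]
    · simp only [G, if_neg hx]
      have : ‖x - p‖ ≠ 0 := fun h0 => by
        rw [norm_eq_zero, sub_eq_zero] at h0
        exact hx (h0 ▸ hp)
      rw [norm_smul, norm_inv, norm_norm, inv_mul_cancel₀ this]
  obtain ⟨R, hR⟩ := hb.subset_ball p
  refine no_retraction ⟨fun x => ⟨G (x + p), by simp [hGn]⟩, by fun_prop⟩ R fun x hx => ?_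
  have : x + p ∉ U := fun h => by
    have := hR h
    rw [mem_ball, dist_eq_norm, add_sub_cancel_right] at this
    linarith
  simp [G, this]

theorem radial_nullhomotopic_of_joined {M : Type*} [TopologicalSpace M] (φ : C(M, E3)) (p : E3)
    (h : ∀ x, φ x ≠ p) (γ : C(I, E3)) (h0 : γ 0 = p) (hγ : ∀ t x, φ x ≠ γ t)
    (h1 : ∀ x, ‖φ x‖ < ‖γ 1‖) : (radial p φ h).Nullhomotopic := by
  have a : (radial p φ h).Homotopic (radial (γ 1) φ (hγ 1)) :=
    ⟨{ toContinuousMap := unit ⟨fun q : I × M => φ q.2 - γ q.1, by fun_prop⟩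
          (fun q => by simpa [sub_eq_zero] using hγ q.1 q.2)
       map_zero_left := fun x => by apply Subtype.ext; simp [radial_apply, unit_apply, h0]
       map_one_left := fun x => by apply Subtype.ext; simp [radial_apply, unit_apply] }⟩
  by_cases hM : Nonempty M
  · obtain ⟨x₀⟩ := hM
    have hpos : (0 : ℝ) < ‖γ 1‖ := (norm_nonneg _).trans_lt (h1 x₀)
    have hne : ∀ q : I × M, (1 - (q.1 : ℝ)) • φ q.2 - γ 1 ≠ 0 := fun q hq => by
      rw [sub_eq_zero] at hq
      have := congrArg norm hq
      rw [norm_smul, Real.norm_of_nonneg (by linarith [q.1.2.2])] at this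
      nlinarith [h1 q.2, q.1.2.1, q.1.2.2, norm_nonneg (φ q.2)]
    refine ⟨unit (ContinuousMap.const Unit (-γ 1)) (fun _ => by simpa using norm_pos_iff.1 hpos) (),
      a.trans ⟨{ toContinuousMap := unit ⟨fun q : I × M => (1 - (q.1 : ℝ)) • φ q.2 - γ 1,
                  by fun_prop⟩ hne
                 map_zero_left := fun x => by apply Subtype.ext; simp [radial_apply, unit_apply]
                 map_one_left := fun x => by apply Subtype.ext; simp [unit_apply] }⟩⟩
  · have : IsEmpty M := not_nonempty_iff.1 hM
    refine ⟨⟨EuclideanSpace.single 0 1, by simp⟩, ?_⟩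
    have : radial p φ h = ContinuousMap.const M ⟨EuclideanSpace.single 0 1, by simp⟩ := by
      ext x; exact this.elim x
    rw [this]

theorem isPreconnected_le_norm {R : ℝ} (hR : 0 < R) : IsPreconnected {x : E3 | R ≤ ‖x‖} := by
  have h1 : (1 : Cardinal) < Module.rank ℝ E3 := by
    rw [← Module.finrank_eq_rank]; simp
  have h2 := (isConnected_compl_singleton_of_one_lt_rank h1 (0 : E3)).isPreconnected
  have h3 := h2.image (fun x => (max ‖x‖ R * ‖x‖⁻¹) • x) (by
    have a : ContinuousOn (fun x : E3 => ‖x‖⁻¹) {0}ᶜ :=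
      ContinuousOn.inv₀ (by fun_prop) fun x hx => by simpa using hx
    have b : ContinuousOn (fun x : E3 => max ‖x‖ R) {0}ᶜ := by fun_prop
    exact (b.mul a).smul continuousOn_id)
  convert h3 using 1
  ext y
  constructor
  · intro hy
    have hy' : R ≤ ‖y‖ := hy
    have h0 : ‖y‖ ≠ 0 := by linarith
    refine ⟨y, by simpa using h0, ?_⟩
    simp [max_eq_left hy', h0]
  · rintro ⟨x, hx, rfl⟩
    have h0 : ‖x‖ ≠ 0 := by simpa using hx
    simp only [mem_ofPred_eq, norm_smul, norm_mul, norm_inv, norm_norm]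
    rw [mul_assoc, inv_mul_cancel₀ h0, mul_one]
    exact (le_max_right _ _).trans (le_abs_self _)

theorem frontier_connectedComponentIn_subset {M : Type*} [TopologicalSpace M]
    [LocallyConnectedSpace M] {X : Set M} (hX : IsClosed X) (p : M) :
    frontier (connectedComponentIn Xᶜ p) ⊆ X := by
  intro y hy
  by_contra hyX
  have ho : ∀ z, IsOpen (connectedComponentIn Xᶜ z) := fun z =>
    hX.isOpen_compl.connectedComponentIn
  have hyc : y ∈ connectedComponentIn Xᶜ y := mem_connectedComponentIn hyX
  obtain ⟨z, hz1, hz2⟩ := mem_closure_iff.1 (frontier_subset_closure hy) _ (ho y) hyc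
  have e1 := connectedComponentIn_eq hz1
  have e2 := connectedComponentIn_eq hz2
  rw [(ho p).frontier_eq] at hy
  apply hy.2
  rw [e2, ← e1]; exact hyc

/-- If the radial maps on a compact set are null-homotopic for a dense set of centres, the
complement is connected. -/
theorem isPreconnected_compl_of_radial {X : Set E3} (hX : IsCompact X) {D : Set E3} (hD : Dense D)
    (hrad : ∀ p ∈ D, ∀ (φ : C(↥X, E3)) (h : ∀ x, φ x ≠ p), (∀ x, φ x = x) →
      (radial p φ h).Nullhomotopic) : IsPreconnected Xᶜ := by
  obtain ⟨R, hR0, hR⟩ := hX.isBounded.subset_ball_lt 0 0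
  let O : Set E3 := {x | R ≤ ‖x‖}
  have hO : O ⊆ Xᶜ := fun x hx hxX => by
    have := hR hxX
    rw [mem_ball_zero_iff] at this
    have hx' : R ≤ ‖x‖ := hx
    linarith
  have key : ∀ p ∈ Xᶜ, (connectedComponentIn Xᶜ p ∩ O).Nonempty := by
    intro p₀ hp₀
    obtain ⟨p, hpD, hpc⟩ := hD.exists_mem_open
      (hX.isClosed.isOpen_compl.connectedComponentIn (x := p₀)) ⟨p₀, mem_connectedComponentIn hp₀⟩
    rw [connectedComponentIn_eq hpc]
    have hp : p ∈ Xᶜ := connectedComponentIn_subset _ _ hpc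
    by_contra hne
    have hb : Bornology.IsBounded (connectedComponentIn Xᶜ p) :=
      isBounded_ball.subset (t := ball (0 : E3) R) fun x hx => by
        rw [mem_ball_zero_iff]
        by_contra hx'
        exact hne ⟨x, hx, not_lt.1 hx'⟩
    have hfr := frontier_connectedComponentIn_subset hX.isClosed p
    let ψ : C(↥X, E3) := ⟨Subtype.val, continuous_subtype_val⟩
    have hψ : ∀ x, ψ x ≠ p := fun x hx => hp (hx ▸ x.2)
    have h1 := (hrad p hpD ψ hψ fun _ => rfl).comp_left ⟨inclusion hfr, continuous_inclusion hfr⟩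
    rw [radial_comp] at h1
    exact not_nullhomotopic_radial_frontier hX.isClosed.isOpen_compl.connectedComponentIn hb
      (mem_connectedComponentIn hp) _ (fun _ => rfl) _ h1
  refine isPreconnected_of_forall_pair fun x hx y hy => ?_
  refine ⟨(connectedComponentIn Xᶜ x ∪ O) ∪ connectedComponentIn Xᶜ y, ?_, ?_, ?_, ?_⟩
  · exact union_subset (union_subset (connectedComponentIn_subset _ _) hO)
      (connectedComponentIn_subset _ _)
  · exact Or.inl (Or.inl (mem_connectedComponentIn hx))
  · exact Or.inr (mem_connectedComponentIn hy)
  · obtain ⟨a, ha1, ha2⟩ := key x hx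
    obtain ⟨b, hb1, hb2⟩ := key y hy
    exact (isPreconnected_connectedComponentIn.union a ha1 ha2 (isPreconnected_le_norm hR0)).union b
      (Or.inr hb2) hb1 isPreconnected_connectedComponentIn

/-- A minimal closed set failing a property which is inherited by small neighbourhoods. -/
theorem exists_minimal_bad {X : Type*} [TopologicalSpace X] [CompactSpace X] (Good : Set X → Prop)
    (hnhd : ∀ A, IsClosed A → Good A → ∃ U, IsOpen U ∧ A ⊆ U ∧ ∀ B, IsClosed B → B ⊆ U → Good B)
    {A₀ : Set X} (hA₀ : IsClosed A₀) (hbad : ¬ Good A₀) :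
    ∃ A, A ⊆ A₀ ∧ IsClosed A ∧ ¬ Good A ∧ ∀ B, IsClosed B → B ⊆ A → B ≠ A → Good B := by
  obtain ⟨A, hA, hmin⟩ := zorn_superset_nonempty {A : Set X | IsClosed A ∧ ¬ Good A} (by
    intro c hc hchain hne
    refine ⟨⋂₀ c, ⟨isClosed_sInter fun s hs => (hc hs).1, fun hg => ?_⟩,
      fun s hs => sInter_subset_of_mem hs⟩
    obtain ⟨U, hU, hcU, hB⟩ := hnhd _ (isClosed_sInter fun s hs => (hc hs).1) hg
    have : Nonempty c := hne.to_subtype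
    obtain ⟨s, hs⟩ := exists_subset_nhds_of_compactSpace (V := fun s : c => (s : Set X))
      (U := U) (by
        intro s t
        rcases hchain.total s.2 t.2 with h | h
        · exact ⟨s, le_rfl, h⟩
        · exact ⟨t, h, le_rfl⟩)
      (fun s => (hc s.2).1) (fun x hx => hU.mem_nhds (hcU (by rwa [sInter_eq_iInter])))
    exact (hc s.2).2 (hB _ (hc s.2).1 hs)) A₀ ⟨hA₀, hbad⟩
  refine ⟨A, hA, hmin.prop.1, hmin.prop.2, fun B hB hBA hne => ?_⟩
  by_contra hb
  exact hne (hBA.antisymm (hmin.le_of_le ⟨hB, hb⟩ hBA))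

theorem nullhomotopic_restrict_nhds {X : Type*} [MetricSpace X] (f : C(X, S2)) {A : Set X}
    (hA : IsClosed A) (h : (f.restrict A).Nullhomotopic) :
    ∃ U, IsOpen U ∧ A ⊆ U ∧ ∀ B, IsClosed B → B ⊆ U → (f.restrict B).Nullhomotopic := by
  obtain ⟨c, hc⟩ := h
  obtain ⟨F, hF, hF2⟩ := exists_homotopic_extension hA (ContinuousMap.const X c)
    (f.restrict A) hc.symm
  refine ⟨{x | dist (f x) (F x) < 1}, isOpen_lt (by fun_prop) continuous_const, fun x hx => ?_,
    fun B hB hBU => ?_⟩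
  · have : F x = f x := hF ⟨x, hx⟩
    simp [this]
  · have h1 : (f.restrict B).Homotopic (F.restrict B) := by
      have h2 := homotopic_of_dist_lt (f.restrict B) (incl.comp (F.restrict B))
        (fun x => coe_S2_ne_zero _) fun x => by
          have : dist (f x) (F x) < 1 := hBU x.2
          rw [dist_comm] at this
          exact this
      convert h2 using 1
      ext1 x
      exact (unit_eq_of_eq _ _ _ _ rfl).symm
    have h3 : (F.restrict B).Homotopic (ContinuousMap.const B c) :=
      ContinuousMap.Homotopic.comp hF2.symm
        (ContinuousMap.Homotopic.refl ⟨Subtype.val, continuous_subtype_val⟩)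
    exact ⟨c, h1.trans h3⟩

end

end SphereMaps

namespace SphereMaps

open Set Topology Metric unitInterval

noncomputable section

theorem nullhomotopic_restrict_of_collapse {M : Type*} [MetricSpace M] [CompactSpace M]
    (f : C(M, S2)) {A O K : Set M} (hA : IsClosed A) (hO : IsOpen O) (hK : IsClosed K) (hOK : O ⊆ K)
    (hf : (f.restrict (A \ O)).Nullhomotopic) {V : Type*} [NormedAddCommGroup V] [NormedSpace ℝ V]
    [FiniteDimensional ℝ V] (hV : Module.finrank ℝ V < 3) (β : M → V) (hβ : ContinuousOn β (A ∩ K))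
    (hβ0 : ∀ x ∈ A ∩ (K \ O), β x = 0) (hβ1 : ∀ x ∈ A ∩ O, β x ≠ 0) (hinj : InjOn β (A ∩ O)) :
    (f.restrict A).Nullhomotopic := by
  classical
  have : CompactSpace A := isCompact_iff_compactSpace.1 hA.isCompact
  let ι : A → V := fun a => if (a : M) ∈ O then β a else 0
  have hι : Continuous ι := by
    rw [← continuousOn_univ]
    have hc1 : IsClosed {a : A | (a : M) ∈ K} := hK.preimage continuous_subtype_val
    have hc2 : IsClosed {a : A | (a : M) ∈ Oᶜ} := hO.isClosed_compl.preimage continuous_subtype_val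
    have : (univ : Set A) = {a : A | (a : M) ∈ K} ∪ {a : A | (a : M) ∈ Oᶜ} := by
      ext a
      by_cases h : (a : M) ∈ O
      · simp [hOK h]
      · simp [h]
    rw [this]
    refine ContinuousOn.union_of_isClosed ?_ ?_ hc1 hc2
    · have h1 : ContinuousOn (fun a : A => β a) {a : A | (a : M) ∈ K} :=
        hβ.comp continuous_subtype_val.continuousOn fun a ha => ⟨a.2, ha⟩
      refine h1.congr fun a ha => ?_
      by_cases h : (a : M) ∈ O
      · simp [ι, h]
      · simp [ι, h, hβ0 a ⟨a.2, ha, h⟩]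
    · refine (continuousOn_const (c := (0 : V))).congr fun a ha => ?_
      have : (a : M) ∉ O := ha
      simp [ι, this]
  refine nullhomotopic_of_collapse (f.restrict A) (A := {a : A | (a : M) ∈ Oᶜ})
    (hO.isClosed_compl.preimage continuous_subtype_val) ?_ hV ⟨ι, hι⟩ ?_ ?_ ?_
  · exact hf.comp_left (⟨fun a => ⟨a.1.1, a.1.2, a.2⟩, by fun_prop⟩ :
      C(↥{a : A | (a : M) ∈ Oᶜ}, ↥(A \ O)))
  · intro a ha
    have : (a : M) ∉ O := ha
    simp [ι, this]
  · intro a ha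
    have : (a : M) ∈ O := not_not.1 ha
    simpa [ι, this] using hβ1 a ⟨a.2, this⟩
  · intro a ha b hb hab
    have ha' : (a : M) ∈ O := not_not.1 ha
    have hb' : (b : M) ∈ O := not_not.1 hb
    simp only [ContinuousMap.coe_mk, ι, ha', hb', if_true] at hab
    exact Subtype.ext (hinj ⟨a.2, ha'⟩ ⟨b.2, hb'⟩ hab)

/-- The closed chart disc is closed. -/
theorem isClosed_chart_disc {M E : Type*} [TopologicalSpace M] [T2Space M] [NormedAddCommGroup E]
    [ProperSpace E] (e : OpenPartialHomeomorph M E) {c : E} {r : ℝ}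
    (h : closedBall c r ⊆ e.target) : IsClosed (e.symm '' closedBall c r) :=
  ((isCompact_closedBall c r).image_of_continuousOn (e.continuousOn_symm.mono h)).isClosed

theorem isOpen_chart_disc {M E : Type*} [TopologicalSpace M] [NormedAddCommGroup E]
    (e : OpenPartialHomeomorph M E) (c : E) (r : ℝ) :
    IsOpen (e.source ∩ e ⁻¹' ball c r) := e.isOpen_inter_preimage isOpen_ball

/-- Every map from a compact one-manifold to the sphere is null-homotopic. -/
theorem nullhomotopic_of_one_manifold {M : Type*} [MetricSpace M] [CompactSpace M]
    [ChartedSpace (EuclideanSpace ℝ (Fin 1)) M] (f : C(M, S2)) : f.Nullhomotopic := by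
  by_contra hf
  obtain ⟨A, -, hA, hbad, hmin⟩ := exists_minimal_bad (fun A => (f.restrict A).Nullhomotopic)
    (fun A hA h => nullhomotopic_restrict_nhds f hA h) (isClosed_univ (X := M)) (fun h => hf (by
      have := h.comp_left (⟨fun x => ⟨x, mem_univ x⟩, by fun_prop⟩ : C(M, ↥(univ : Set M)))
      exact this))
  have hne : A.Nonempty := by
    by_contra hne
    rw [not_nonempty_iff_eq_empty] at hne
    subst hne
    refine hbad ⟨⟨EuclideanSpace.single 0 1, by simp⟩, ?_⟩
    have : f.restrict (∅ : Set M) = ContinuousMap.const _ ⟨EuclideanSpace.single 0 1, by simp⟩ := by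
      ext x; exact x.2.elim
    rw [this]
  obtain ⟨x, hx⟩ := hne
  let e := chartAt (EuclideanSpace ℝ (Fin 1)) x
  have hxs : x ∈ e.source := mem_chart_source _ x
  obtain ⟨r, hr, hball⟩ := nhds_basis_closedBall.mem_iff.1
    (e.open_target.mem_nhds (e.map_source hxs))
  let O := e.source ∩ e ⁻¹' ball (e x) r
  have hO : IsOpen O := isOpen_chart_disc e _ _
  have hxO : x ∈ O := ⟨hxs, mem_ball_self hr⟩
  have hK := isClosed_chart_disc e hball
  have hKs : ∀ y ∈ e.symm '' closedBall (e x) r, y ∈ e.source ∧ e y ∈ closedBall (e x) r := by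
    rintro _ ⟨w, hw, rfl⟩
    exact ⟨e.map_target (hball hw), by rwa [e.right_inv (hball hw)]⟩
  have hdist : ∀ y, dist (e y) (e x) = |(e y - e x) 0| := fun y => by
    rw [dist_eq_norm, EuclideanSpace.norm_eq, Fin.sum_univ_one, Real.sqrt_sq (norm_nonneg _),
      Real.norm_eq_abs]
  refine hbad (nullhomotopic_restrict_of_collapse f hA hO hK ?_ (hmin (A \ O) (hA.sdiff hO)
    sdiff_subset fun h => ?_) (V := ℂ) (by simp)
    (fun y => Complex.exp ((Real.pi * ((e y - e x) 0 / r) : ℝ) * Complex.I) + 1) ?_ ?_ ?_ ?_)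
  · rintro y ⟨hy, hy'⟩
    exact ⟨e y, ball_subset_closedBall hy', e.left_inv hy⟩
  · rw [← h] at hx; exact hx.2 hxO
  · have h1 : ContinuousOn e (A ∩ e.symm '' closedBall (e x) r) :=
      e.continuousOn.mono fun y hy => (hKs y hy.2).1
    have h2 : ContinuousOn (fun y => (e y - e x) 0) (A ∩ e.symm '' closedBall (e x) r) :=
      (EuclideanSpace.proj (𝕜 := ℝ) (0 : Fin 1)).continuous.comp_continuousOn
        (h1.sub continuousOn_const)
    fun_prop
  · rintro y ⟨-, hyK, hyO⟩
    obtain ⟨hys, hyb⟩ := hKs y hyK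
    have h1 : ¬ dist (e y) (e x) < r := fun h => hyO ⟨hys, h⟩
    have h2 : |(e y - e x) 0| = r := by
      rw [← hdist]; exact le_antisymm hyb (not_lt.1 h1)
    have h3 : (e y - e x) 0 / r = 1 ∨ (e y - e x) 0 / r = -1 := by
      rcases abs_eq hr.le |>.1 h2 with h | h <;> rw [h]
      · left; exact div_self hr.ne'
      · right; rw [neg_div, div_self hr.ne']
    rcases h3 with h | h <;> rw [h]
    · simp
    · simp [Complex.exp_neg]
  · rintro y ⟨-, hys, hyb⟩ h0
    have h1 : |(e y - e x) 0| < r := by rw [← hdist]; exact hyb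
    have h2 := Complex.ext_iff.1 (eq_neg_of_add_eq_zero_left h0)
    rw [Complex.exp_ofReal_mul_I_re, Complex.exp_ofReal_mul_I_im] at h2
    simp only [Complex.neg_re, Complex.one_re] at h2
    have h3 : |(e y - e x) 0 / r| < 1 := by rw [abs_div, abs_of_pos hr]; exact (div_lt_one hr).2 h1
    rw [abs_lt] at h3
    have h4 : 0 < Real.cos (Real.pi * ((e y - e x) 0 / r) / 2) := Real.cos_pos_of_mem_Ioo
      ⟨by nlinarith [Real.pi_pos], by nlinarith [Real.pi_pos]⟩
    have h5 := Real.cos_sq (Real.pi * ((e y - e x) 0 / r) / 2)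
    rw [mul_div_cancel₀ _ (two_ne_zero' ℝ), h2.1] at h5
    nlinarith
  · rintro y ⟨-, hys, hyb⟩ z ⟨-, hzs, hzb⟩ h
    have h1 : |(e y - e x) 0| < r := by rw [← hdist]; exact hyb
    have h1' : |(e z - e x) 0| < r := by rw [← hdist]; exact hzb
    have h3 : |(e y - e x) 0 / r| < 1 := by rw [abs_div, abs_of_pos hr]; exact (div_lt_one hr).2 h1
    have h3' : |(e z - e x) 0 / r| < 1 := by
      rw [abs_div, abs_of_pos hr]; exact (div_lt_one hr).2 h1'
    rw [abs_lt] at h3 h3'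
    have h4 := congrArg Complex.arg (add_right_cancel h)
    rw [Complex.arg_exp_mul_I, Complex.arg_exp_mul_I,
      (toIocMod_eq_self Real.two_pi_pos).2 ⟨by nlinarith [Real.pi_pos], by nlinarith [Real.pi_pos]⟩,
      (toIocMod_eq_self Real.two_pi_pos).2 ⟨by nlinarith [Real.pi_pos], by nlinarith [Real.pi_pos]⟩]
      at h4
    have h5 := mul_left_cancel₀ Real.pi_ne_zero h4
    have h6 : (e y - e x) 0 = (e z - e x) 0 := by
      field_simp at h5; exact h5
    have h7 : e y = e z := by
      ext i
      fin_cases i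
      simpa using h6
    exact e.injOn hys hzs h7

/-- On a proper closed subset of a compact connected surface every map to the sphere is
null-homotopic. -/
theorem nullhomotopic_of_proper_surface {M : Type*} [MetricSpace M] [CompactSpace M]
    [PreconnectedSpace M] [ChartedSpace (EuclideanSpace ℝ (Fin 2)) M] (f : C(M, S2)) {A₀ : Set M}
    (hA₀ : IsClosed A₀) (hA₀' : A₀ ≠ univ) : (f.restrict A₀).Nullhomotopic := by
  by_contra hf
  obtain ⟨A, hAA, hA, hbad, hmin⟩ := exists_minimal_bad (fun A => (f.restrict A).Nullhomotopic)
    (fun A hA h => nullhomotopic_restrict_nhds f hA h) hA₀ hf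
  have hne : A.Nonempty := by
    by_contra hne
    rw [not_nonempty_iff_eq_empty] at hne
    subst hne
    refine hbad ⟨⟨EuclideanSpace.single 0 1, by simp⟩, ?_⟩
    have : f.restrict (∅ : Set M) = ContinuousMap.const _ ⟨EuclideanSpace.single 0 1, by simp⟩ := by
      ext x; exact x.2.elim
    rw [this]
  have hAuniv : A ≠ univ := fun h => hA₀' (eq_univ_of_univ_subset (h ▸ hAA))
  obtain ⟨x, hxf⟩ := nonempty_frontier_iff.2 ⟨hne, hAuniv⟩
  have hx : x ∈ A := hA.frontier_subset hxf
  have hxc : x ∈ closure Aᶜ := by rw [← frontier_compl] at hxf; exact frontier_subset_closure hxf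
  let e := chartAt (EuclideanSpace ℝ (Fin 2)) x
  have hxs : x ∈ e.source := mem_chart_source _ x
  obtain ⟨r, hr, hball⟩ := nhds_basis_closedBall.mem_iff.1
    (e.open_target.mem_nhds (e.map_source hxs))
  obtain ⟨z, ⟨hzs, hzb⟩, hzA⟩ := mem_closure_iff.1 hxc _ (isOpen_chart_disc e (e x) (r / 2))
    ⟨hxs, mem_ball_self (half_pos hr)⟩
  have hzx : dist (e x) (e z) < r / 2 := by rw [dist_comm]; exact hzb
  have hball' : closedBall (e z) (r / 2) ⊆ e.target := fun w hw => hball (by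
    rw [mem_closedBall] at hw ⊢
    linarith [dist_triangle w (e z) (e x), dist_comm (e x) (e z)])
  let O := e.source ∩ e ⁻¹' ball (e z) (r / 2)
  have hO : IsOpen O := isOpen_chart_disc e _ _
  have hxO : x ∈ O := ⟨hxs, hzx⟩
  have hK := isClosed_chart_disc e hball'
  have hKs : ∀ y ∈ e.symm '' closedBall (e z) (r / 2),
      y ∈ e.source ∧ e y ∈ closedBall (e z) (r / 2) := by
    rintro _ ⟨w, hw, rfl⟩
    exact ⟨e.map_target (hball' hw), by rwa [e.right_inv (hball' hw)]⟩
  have hez : ∀ y ∈ A, y ∈ e.source → ‖e y - e z‖ ≠ 0 := fun y hyA hys h0 => by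
    rw [norm_eq_zero, sub_eq_zero] at h0
    exact hzA (e.injOn hys hzs h0 ▸ hyA)
  refine hbad (nullhomotopic_restrict_of_collapse f hA hO hK ?_ (hmin (A \ O) (hA.sdiff hO)
    sdiff_subset fun h => ?_) (V := EuclideanSpace ℝ (Fin 2)) (by simp)
    (fun y => ((r / 2) * ‖e y - e z‖⁻¹ - 1) • (e y - e z)) ?_ ?_ ?_ ?_)
  · rintro y ⟨hy, hy'⟩
    exact ⟨e y, ball_subset_closedBall hy', e.left_inv hy⟩
  · rw [← h] at hx; exact hx.2 hxO
  · have h1 : ContinuousOn e (A ∩ e.symm '' closedBall (e z) (r / 2)) :=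
      e.continuousOn.mono fun y hy => (hKs y hy.2).1
    have h2 : ContinuousOn (fun y => ‖e y - e z‖⁻¹) (A ∩ e.symm '' closedBall (e z) (r / 2)) :=
      ContinuousOn.inv₀ (by fun_prop) fun y hy => hez y hy.1 (hKs y hy.2).1
    exact ((continuousOn_const.mul h2).sub continuousOn_const).smul (h1.sub continuousOn_const)
  · rintro y ⟨-, hyK, hyO⟩
    obtain ⟨hys, hyb⟩ := hKs y hyK
    have h1 : ¬ dist (e y) (e z) < r / 2 := fun h => hyO ⟨hys, h⟩
    have h2 : ‖e y - e z‖ = r / 2 := by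
      rw [← dist_eq_norm]; exact le_antisymm hyb (not_lt.1 h1)
    rw [h2, mul_inv_cancel₀ (by positivity), sub_self, zero_smul]
  · rintro y ⟨hyA, hys, hyb⟩ h0
    have h1 : ‖e y - e z‖ < r / 2 := by rw [← dist_eq_norm]; exact hyb
    have h2 := hez y hyA hys
    have h3 : 0 < ‖e y - e z‖ := lt_of_le_of_ne (norm_nonneg _) (Ne.symm h2)
    rcases smul_eq_zero.1 h0 with h | h
    · have : (r / 2) = ‖e y - e z‖ := by field_simp at h; linarith
      linarith
    · rw [h, norm_zero] at h2; exact h2 rfl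
  · rintro y ⟨hyA, hys, hyb⟩ w ⟨hwA, hws, hwb⟩ h
    have h1 : ‖e y - e z‖ < r / 2 := by rw [← dist_eq_norm]; exact hyb
    have h2 := hez y hyA hys
    have h3 : 0 < ‖e y - e z‖ := lt_of_le_of_ne (norm_nonneg _) (Ne.symm h2)
    have h1' : ‖e w - e z‖ < r / 2 := by rw [← dist_eq_norm]; exact hwb
    have h2' := hez w hwA hws
    have h3' : 0 < ‖e w - e z‖ := lt_of_le_of_ne (norm_nonneg _) (Ne.symm h2')
    simp only at h
    have hpos : ∀ t : ℝ, 0 < t → t < r / 2 → 0 < r / 2 * t⁻¹ - 1 := fun t ht ht' => by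
      have : 1 < r / 2 * t⁻¹ := by rw [← div_eq_mul_inv]; exact (one_lt_div ht).2 ht'
      linarith
    have hn := congrArg norm h
    rw [norm_smul, norm_smul, Real.norm_of_nonneg (hpos _ h3 h1).le,
      Real.norm_of_nonneg (hpos _ h3' h1').le, sub_mul, sub_mul, mul_assoc, mul_assoc,
      inv_mul_cancel₀ h2, inv_mul_cancel₀ h2'] at hn
    have hn' : ‖e y - e z‖ = ‖e w - e z‖ := by linarith
    rw [hn'] at h
    have h7 := smul_right_injective _ (hpos _ h3' h1').ne' h
    exact e.injOn hys hws (sub_left_injective h7)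

end

end SphereMaps

namespace SphereMaps

open Set Topology Metric unitInterval

noncomputable section

instance fact_finrank_four : Fact (Module.finrank ℝ (EuclideanSpace ℝ (Fin 4)) = 3 + 1) :=
  ⟨by simp⟩

/-- Stereographic projection of the three-sphere. -/
def st (q : ↥Sph3) : OpenPartialHomeomorph ↥Sph3 E3 := stereographic' 3 q

theorem st_source (q : ↥Sph3) : (st q).source = {q}ᶜ := stereographic'_source q

theorem st_target (q : ↥Sph3) : (st q).target = univ := stereographic'_target q

theorem continuous_st_symm (q : ↥Sph3) : Continuous (st q).symm := by
  rw [← continuousOn_univ, ← st_target q]; exact (st q).continuousOn_symm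

theorem st_symm_ne (q : ↥Sph3) (x : E3) : (st q).symm x ≠ q := by
  have := (st q).map_target (x := x) (by rw [st_target]; trivial)
  rw [st_source] at this
  exact this

theorem st_right_inv (q : ↥Sph3) (x : E3) : st q ((st q).symm x) = x :=
  (st q).right_inv (by rw [st_target]; trivial)

theorem st_left_inv {q x : ↥Sph3} (h : x ≠ q) : (st q).symm (st q x) = x :=
  (st q).left_inv (by rw [st_source]; exact h)

theorem continuousOn_st (q : ↥Sph3) : ContinuousOn (st q) {q}ᶜ := by
  rw [← st_source]; exact (st q).continuousOn

/-- A map to the three-sphere avoiding `q`, in the stereographic chart. -/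
def lift {M : Type*} [TopologicalSpace M] (q : ↥Sph3) (φ : C(M, ↥Sph3)) (h : ∀ x, φ x ≠ q) :
    C(M, E3) :=
  ⟨fun x => st q (φ x), (continuousOn_st q).comp_continuous φ.continuous h⟩

theorem lift_apply {M : Type*} [TopologicalSpace M] (q : ↥Sph3) (φ : C(M, ↥Sph3))
    (h : ∀ x, φ x ≠ q) (x : M) : lift q φ h x = st q (φ x) := rfl

theorem st_ne {q p x : ↥Sph3} (hx : x ≠ q) (hp : p ≠ q) (h : x ≠ p) : st q x ≠ st q p :=
  fun h' => h ((st q).injOn (by rw [st_source]; exact hx) (by rw [st_source]; exact hp) h')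

theorem isCompact_st_image {q : ↥Sph3} {X : Set ↥Sph3} (hX : IsCompact X) (hq : q ∉ X) :
    IsCompact (st q '' X) :=
  hX.image_of_continuousOn ((continuousOn_st q).mono fun x hx h => hq ((show x = q from h) ▸ hx))

theorem mem_st_image {q : ↥Sph3} {X : Set ↥Sph3} (hq : q ∉ X) (x : E3) :
    x ∈ st q '' X ↔ (st q).symm x ∈ X := by
  constructor
  · rintro ⟨y, hy, rfl⟩
    rwa [st_left_inv fun h : y = q => hq (h ▸ hy)]
  · exact fun h => ⟨_, h, st_right_inv q x⟩

instance connectedSpace_sph3 : ConnectedSpace ↥Sph3 := by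
  refine isConnected_iff_connectedSpace.1 (isConnected_sphere ?_ _ zero_le_one)
  rw [← Module.finrank_eq_rank]; simp

instance nontrivial_sph3 : Nontrivial ↥Sph3 := by
  refine ⟨⟨⟨EuclideanSpace.single 0 1, by simp⟩, ⟨-EuclideanSpace.single 0 1, by simp⟩, fun h => ?_⟩⟩
  have := congrArg (fun v : ↥Sph3 => (v : EuclideanSpace ℝ (Fin 4)) 0) h
  simp at this
  norm_num at this

/-- The stereographic image of the complement. -/
theorem isPreconnected_compl_of_st {q : ↥Sph3} {X : Set ↥Sph3} (hX : IsClosed X) (hq : q ∉ X)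
    (h : IsPreconnected (st q '' X)ᶜ) : IsPreconnected Xᶜ := by
  have h1 : IsPreconnected ((st q).symm '' (st q '' X)ᶜ) :=
    h.image _ (continuous_st_symm q).continuousOn
  have h2 : (st q).symm '' (st q '' X)ᶜ = Xᶜ \ {q} := by
    ext x
    constructor
    · rintro ⟨y, hy, rfl⟩
      exact ⟨fun h => hy ((mem_st_image hq y).2 h), st_symm_ne q y⟩
    · rintro ⟨hx, hxq⟩
      exact ⟨st q x, fun h => hx (by rwa [mem_st_image hq, st_left_inv hxq] at h),
        st_left_inv hxq⟩
  rw [h2] at h1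
  refine h1.subset_closure sdiff_subset fun x hx => ?_
  by_cases hxq : x = q
  · subst hxq
    have : (𝓝[≠] x).NeBot := inferInstance
    rw [_root_.mem_closure_iff]
    intro o ho hxo
    have : (o ∩ Xᶜ) ∩ {x}ᶜ ∈ 𝓝[≠] x :=
      Filter.inter_mem (mem_nhdsWithin_of_mem_nhds
        ((ho.inter hX.isOpen_compl).mem_nhds ⟨hxo, hx⟩)) self_mem_nhdsWithin
    obtain ⟨z, ⟨hz1, hz2⟩, hz3⟩ := Filter.nonempty_of_mem this
    exact ⟨z, hz1, hz2, hz3⟩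
  · exact subset_closure ⟨hx, hxq⟩

theorem isPreconnected_compl_one_manifold {S : Set ↥Sph3}
    [ChartedSpace (EuclideanSpace ℝ (Fin 1)) ↥S] [CompactSpace ↥S] {q : ↥Sph3} (hq : q ∉ S) :
    IsPreconnected Sᶜ := by
  have hS : IsCompact S := isCompact_iff_compactSpace.2 inferInstance
  refine isPreconnected_compl_of_st hS.isClosed hq
    (isPreconnected_compl_of_radial (isCompact_st_image hS hq) dense_univ fun p _ φ h _ => ?_)
  let u : C(S, ↥(st q '' S)) :=
    ⟨fun x => ⟨st q x, mem_image_of_mem _ x.2⟩,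
      ((continuousOn_st q).comp_continuous continuous_subtype_val
        fun x hx => hq (hx ▸ x.2)).subtype_mk _⟩
  let w : C(↥(st q '' S), S) :=
    ⟨fun x => ⟨(st q).symm x, (mem_st_image hq _).1 x.2⟩,
      ((continuous_st_symm q).comp continuous_subtype_val).subtype_mk _⟩
  have h1 := (nullhomotopic_of_one_manifold ((radial p φ h).comp u)).comp_left w
  convert h1 using 1
  ext1 x
  simp only [ContinuousMap.comp_apply]
  congr 1
  exact Subtype.ext (st_right_inv q x).symm

theorem interior_surface (N : Set ↥Sph3) [ChartedSpace (EuclideanSpace ℝ (Fin 2)) ↥N] :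
    interior N = ∅ := by
  by_contra hne
  obtain ⟨x, hx⟩ := nonempty_iff_ne_empty.2 hne
  have hxN := interior_subset hx
  let e := chartAt (EuclideanSpace ℝ (Fin 2)) (⟨x, hxN⟩ : N)
  obtain ⟨O', hO', hO's⟩ := isOpen_induced_iff.1 e.open_source
  have hxO' : x ∈ O' := by
    have h : (⟨x, hxN⟩ : N) ∈ Subtype.val ⁻¹' O' := hO's ▸ mem_chart_source _ _
    exact h
  obtain ⟨q, hq⟩ := exists_ne x
  have hV : IsOpen ((st q).symm ⁻¹' (O' ∩ interior N)) :=
    (hO'.inter isOpen_interior).preimage (continuous_st_symm q)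
  obtain ⟨r, hr, hball⟩ := nhds_basis_closedBall.mem_iff.1
    (hV.mem_nhds (show st q x ∈ _ by
      rw [mem_preimage, st_left_inv hq.symm]; exact ⟨hxO', hx⟩))
  have hfr : frontier (ball (st q x) r) ⊆ closedBall (st q x) r :=
    frontier_subset_closure.trans closure_ball_subset_closedBall
  have hN : ∀ y : ↥(frontier (ball (st q x) r)), (st q).symm y ∈ N :=
    fun y => interior_subset (hball (hfr y.2)).2
  have hsrc : ∀ y : ↥(frontier (ball (st q x) r)), (⟨(st q).symm y, hN y⟩ : N) ∈ e.source :=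
    fun y => by rw [← hO's]; exact (hball (hfr y.2)).1
  have : CompactSpace ↥(frontier (ball (st q x) r)) :=
    isCompact_iff_compactSpace.1
      ((isCompact_closedBall _ _).of_isClosed_subset isClosed_frontier hfr)
  let β : ↥(frontier (ball (st q x) r)) → EuclideanSpace ℝ (Fin 2) :=
    fun y => e ⟨(st q).symm y, hN y⟩
  have hβ : Continuous β := e.continuousOn.comp_continuous
    (((continuous_st_symm q).comp continuous_subtype_val).subtype_mk _) hsrc
  have hβi : Function.Injective β := fun y z hyz => by
    have h1 := congrArg Subtype.val (e.injOn (hsrc y) (hsrc z) hyz)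
    have h2 := congrArg (st q) h1
    simp only [st_right_inv] at h2
    exact Subtype.ext h2
  have hemb : IsClosedEmbedding β := hβ.isClosedEmbedding hβi
  let φ : C(↥(frontier (ball (st q x) r)), E3) := ⟨Subtype.val, continuous_subtype_val⟩
  have hφ : ∀ y, φ y ≠ st q x := fun y hy => by
    apply (isOpen_ball.frontier_eq.subset y.2).2
    have : (y : E3) = st q x := hy
    rw [this]; exact mem_ball_self hr
  let h := hemb.isEmbedding.toHomeomorph
  obtain ⟨G, hG⟩ := exists_extension_plane (by simp) hemb.isClosed_range
    ((radial (st q x) φ hφ).comp ⟨h.symm, h.symm.continuous⟩)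
  have hGn : G.Nullhomotopic := by
    obtain ⟨c, hc⟩ := id_nullhomotopic (EuclideanSpace ℝ (Fin 2))
    have := ContinuousMap.Nullhomotopic.comp_right (f := ContinuousMap.id _) ⟨c, hc⟩ G
    exact this
  refine not_nullhomotopic_radial_frontier isOpen_ball isBounded_ball (mem_ball_self hr) φ
    (fun _ => rfl) hφ ?_
  have h3 := hGn.comp_left ⟨β, hβ⟩
  convert h3 using 1
  ext1 y
  have := hG (h y)
  simp only [ContinuousMap.comp_apply, ContinuousMap.coe_mk, Homeomorph.symm_apply_apply] at this
  rw [← this]; rfl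

end

end SphereMaps

namespace SphereMaps

open Set Topology Metric unitInterval

noncomputable section

theorem dense_compl_st_surface {N : Set ↥Sph3} [ChartedSpace (EuclideanSpace ℝ (Fin 2)) ↥N]
    {q : ↥Sph3} (hq : q ∉ N) : Dense (st q '' N)ᶜ := by
  rw [← interior_eq_empty_iff_dense_compl]
  by_contra hne
  obtain ⟨x, hx⟩ := nonempty_iff_ne_empty.2 hne
  have h1 : (st q).source ∩ st q ⁻¹' interior (st q '' N) ⊆ interior N :=
    interior_maximal (fun y hy => by
      have := interior_subset hy.2
      have hyq : y ≠ q := by have := hy.1; rwa [st_source] at this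
      rwa [mem_st_image hq, st_left_inv hyq] at this)
      ((st q).isOpen_inter_preimage isOpen_interior)
  rw [interior_surface] at h1
  refine h1 (a := (st q).symm x) ⟨?_, ?_⟩
  · rw [st_source]; exact st_symm_ne q x
  · rw [mem_preimage, st_right_inv]; exact hx

/-- A proper closed part of a connected surface does not separate space. -/
theorem isPreconnected_compl_proper_surface {N : Set ↥Sph3}
    [ChartedSpace (EuclideanSpace ℝ (Fin 2)) ↥N] [CompactSpace ↥N] [PreconnectedSpace ↥N]
    {q : ↥Sph3} (hq : q ∉ N) {A : Set ↥Sph3} (hA : IsClosed A) (hAN : A ⊆ N) (hne : A ≠ N) :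
    IsPreconnected (st q '' A)ᶜ := by
  have hqA : q ∉ A := fun h => hq (hAN h)
  refine isPreconnected_compl_of_radial (isCompact_st_image hA.isCompact hqA)
    (dense_compl_st_surface hq) fun p hp φ h hφ => ?_
  let ψ : C(N, ↥Sph3) := ⟨Subtype.val, continuous_subtype_val⟩
  have hψ : ∀ x, ψ x ≠ q := fun x hx => hq (hx ▸ x.2)
  have hψp : ∀ x, lift q ψ hψ x ≠ p := fun x hx => hp ⟨x, x.2, hx⟩
  have h1 := nullhomotopic_of_proper_surface (radial p (lift q ψ hψ) hψp)
    (A₀ := Subtype.val ⁻¹' A) (hA.preimage continuous_subtype_val) fun h => hne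
      (hAN.antisymm fun x hx => by
        have : (⟨x, hx⟩ : N) ∈ Subtype.val ⁻¹' A := by rw [h]; trivial
        exact this)
  let w : C(↥(st q '' A), ↥((Subtype.val : N → ↥Sph3) ⁻¹' A)) :=
    ⟨fun x => ⟨⟨(st q).symm x, hAN ((mem_st_image hqA _).1 x.2)⟩, (mem_st_image hqA _).1 x.2⟩,
      (((continuous_st_symm q).comp continuous_subtype_val).subtype_mk _).subtype_mk _⟩
  have h2 := h1.comp_left w
  convert h2 using 1
  ext1 x
  apply Subtype.ext
  have : lift q ψ hψ (w x).1 = x := st_right_inv q x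
  simp only [ContinuousMap.comp_apply, ContinuousMap.restrict_apply, radial_apply, hφ, this]

/-- Separated points of `S` are separated by `N`. -/
theorem not_connected_of_separated {S N : Set ↥Sph3} [CompactSpace ↥N]
    (P : C(↥(Sᶜ), ↥N)) (j : C(↥N, ↥(Sᶜ)))
    (hj : ∀ y : ↥N, ((j y : ↥(Sᶜ)) : ↥Sph3) = (y : ↥Sph3))
    (hom : (j.comp P).Homotopic (ContinuousMap.id ↥(Sᶜ))) {Z : Set ↥Sph3} (hZ : IsClosed Z)
    (hZS : Z ⊆ S) (hSZ : IsClosed (S \ Z)) {p q : ↥Sph3} (hp : p ∈ Z) (hq : q ∈ S \ Z)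
    {C : Set ↥Sph3} (hC : IsPreconnected C) (hCN : C ⊆ Nᶜ) (hpC : p ∈ C) (hqC : q ∈ C) : False := by
  have hqN : q ∉ N := hCN hqC
  have hpq : p ≠ q := fun h => hq.2 (h ▸ hp)
  have hNc : IsCompact (st q '' N) :=
    isCompact_st_image (isCompact_iff_compactSpace.2 inferInstance) hqN
  have hpN : st q p ∈ (st q '' N)ᶜ := by
    rw [mem_compl_iff, mem_st_image hqN, st_left_inv hpq]; exact hCN hpC
  let U := connectedComponentIn (st q '' N)ᶜ (st q p)
  have hUo : IsOpen U := hNc.isClosed.isOpen_compl.connectedComponentIn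
  have hpU : st q p ∈ U := mem_connectedComponentIn hpN
  have hunb : ¬ Bornology.IsBounded U := by
    intro hb
    have hcl : IsCompact (closure U) := hb.isCompact_closure
    have ho1 : IsOpen ((st q).symm '' U) := by
      have : (st q).symm '' U = (st q).source ∩ st q ⁻¹' U := by
        rw [← (st q).symm_image_eq_source_inter_preimage]
        rw [st_target]; exact subset_univ _
      rw [this]; exact (st q).isOpen_inter_preimage hUo
    have ho2 : IsOpen ((st q).symm '' closure U)ᶜ :=
      (hcl.image (continuous_st_symm q)).isClosed.isOpen_compl
    obtain ⟨x, -, hx1, hx2⟩ := hC _ _ ho1 ho2 (fun x hx => by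
        by_cases hxq : x = q
        · right
          rintro ⟨y, -, hy⟩
          exact st_symm_ne q y (hy.trans hxq)
        · by_cases hxc : st q x ∈ closure U
          · left
            have : st q x ∈ U := by
              by_contra hxU
              have h1 : st q x ∈ frontier U := by rw [hUo.frontier_eq]; exact ⟨hxc, hxU⟩
              have h2 := frontier_connectedComponentIn_subset hNc.isClosed (st q p) h1
              rw [mem_st_image hqN, st_left_inv hxq] at h2
              exact hCN hx h2
            exact ⟨_, this, st_left_inv hxq⟩
          · right
            rintro ⟨y, hy, rfl⟩
            rw [st_right_inv] at hxc
            exact hxc hy)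
      ⟨p, hpC, _, hpU, st_left_inv hpq⟩
      ⟨q, hqC, fun ⟨y, _, hy⟩ => st_symm_ne q y hy⟩
    exact hx2 (image_mono subset_closure hx1)
  let ψ : C(N, ↥Sph3) := ⟨Subtype.val, continuous_subtype_val⟩
  have hψ : ∀ x, ψ x ≠ q := fun x hx => hqN (hx ▸ x.2)
  have hψp : ∀ x, lift q ψ hψ x ≠ st q p := fun x hx => hpN ⟨x, x.2, hx⟩
  have hnull : (radial (st q p) (lift q ψ hψ) hψp).Nullhomotopic := by
    obtain ⟨R, hR⟩ := hNc.isBounded.subset_ball 0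
    obtain ⟨z, hz, hzR⟩ : ∃ z ∈ U, R ≤ ‖z‖ := by
      by_contra hno
      push Not at hno
      exact hunb (isBounded_ball.subset fun z hz => mem_ball_zero_iff.2 (hno z hz))
    have hUc : IsPathConnected U := hUo.isConnected_iff_isPathConnected.1
      ⟨⟨_, hpU⟩, isPreconnected_connectedComponentIn⟩
    obtain ⟨γ, hγ⟩ := hUc.joinedIn _ hpU _ hz
    refine radial_nullhomotopic_of_joined _ _ _ γ.toContinuousMap (by simp) (fun t x h => ?_)
      (fun x => ?_)
    · exact connectedComponentIn_subset _ _ (hγ t) ⟨x, x.2, h⟩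
    · have : lift q ψ hψ x ∈ ball (0 : E3) R := hR ⟨x, x.2, rfl⟩
      rw [mem_ball_zero_iff] at this
      simp only [Path.coe_toContinuousMap, Path.target]
      linarith
  let χ : C(↥(Sᶜ), ↥Sph3) := ⟨Subtype.val, continuous_subtype_val⟩
  have hχ : ∀ x, χ x ≠ q := fun x hx => x.2 (by
    have h' : (x : ↥Sph3) = q := hx
    rw [h']; exact hq.1)
  have hχp : ∀ x, lift q χ hχ x ≠ st q p := fun x => st_ne (hχ x) hpq fun h => x.2 (by
    have h' : (x : ↥Sph3) = p := h
    rw [h']; exact hZS hp)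
  have hnull2 : (radial (st q p) (lift q χ hχ) hχp).Nullhomotopic := by
    obtain ⟨c, hc⟩ := hnull.comp_left P
    refine ⟨c, ContinuousMap.Homotopic.trans ?_ hc⟩
    have h1 := ContinuousMap.Homotopic.comp
      (ContinuousMap.Homotopic.refl (radial (st q p) (lift q χ hχ) hχp)) hom.symm
    have heq : (radial (st q p) (lift q ψ hψ) hψp).comp P =
        (radial (st q p) (lift q χ hχ) hχp).comp (j.comp P) := by
      ext1 x
      apply Subtype.ext
      have : (χ (j (P x)) : ↥Sph3) = ψ (P x) := hj (P x)
      simp only [ContinuousMap.comp_apply, radial_apply, lift_apply, this]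
    rw [heq]
    exact h1
  have hZc : IsCompact (st q '' Z) := isCompact_st_image hZ.isCompact hq.2
  have hTc : IsClosed ((st q).symm ⁻¹' (S \ Z)) := hSZ.preimage (continuous_st_symm q)
  have hd : Disjoint (st q '' Z) ((st q).symm ⁻¹' (S \ Z)) := by
    rw [disjoint_left]
    intro x hx hx'
    rw [mem_st_image hq.2] at hx
    exact hx'.2 hx
  obtain ⟨δ, hδ, hd2⟩ := hd.exists_cthickenings hZc hTc
  have hV : IsOpen (thickening δ (st q '' Z)) := isOpen_thickening
  have hfS : ∀ y ∈ frontier (thickening δ (st q '' Z)), (st q).symm y ∈ Sᶜ := by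
    intro y hy hyS
    rw [hV.frontier_eq] at hy
    by_cases hyZ : (st q).symm y ∈ Z
    · exact hy.2 (self_subset_thickening hδ _ ((mem_st_image hq.2 y).2 hyZ))
    · exact disjoint_left.1 hd2 (closure_thickening_subset_cthickening _ _ hy.1)
        (self_subset_cthickening _ ⟨hyS, hyZ⟩)
  let s : C(↥(frontier (thickening δ (st q '' Z))), ↥(Sᶜ)) :=
    ⟨fun y => ⟨(st q).symm y, hfS y y.2⟩,
      ((continuous_st_symm q).comp continuous_subtype_val).subtype_mk _⟩
  have hfin := hnull2.comp_left s
  rw [radial_comp] at hfin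
  exact not_nullhomotopic_radial_frontier hV hZc.isBounded.thickening
    (self_subset_thickening hδ _ (mem_image_of_mem _ hp)) _ (fun x => st_right_inv q x) _ hfin

end

end SphereMaps

namespace SphereMaps

open Set Topology Metric unitInterval

noncomputable section

/-- The circle-valued function `m` has a continuous logarithm on `F`. -/
def LogOn {X : Type*} [TopologicalSpace X] (F : Set X) (m : X → Circle) : Prop :=
  ∃ θ : X → ℝ, ContinuousOn θ F ∧ ∀ x ∈ F, m x = Circle.exp (θ x)

/-- Every continuous circle-valued function on `F` has a continuous logarithm. -/
def HasLogs {X : Type*} [TopologicalSpace X] (F : Set X) : Prop :=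
  ∀ m : X → Circle, ContinuousOn m F → LogOn F m

/-- The function `m`, given on `F₁ ∩ F₂`, is on `C` a product of functions on `F₁` and `F₂`. -/
def SplitsOn {X : Type*} [TopologicalSpace X] (m : X → Circle) (F₁ F₂ C : Set X) : Prop :=
  ∃ u v : X → Circle, ContinuousOn u (F₁ ∩ C) ∧ ContinuousOn v (F₂ ∩ C) ∧
    ∀ x ∈ F₁ ∩ F₂ ∩ C, m x = u x * v x

/-- Every function on the intersection of two closed sets covering `C` splits on `C`. -/
def HasSplittings {X : Type*} [TopologicalSpace X] (C : Set X) : Prop :=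
  ∀ F₁ F₂ : Set X, IsClosed F₁ → IsClosed F₂ → C ⊆ F₁ ∪ F₂ → ∀ m : X → Circle,
    ContinuousOn m (F₁ ∩ F₂ ∩ C) → SplitsOn m F₁ F₂ C

section

variable {X Y : Type*} [TopologicalSpace X] [TopologicalSpace Y]

theorem LogOn.mono {F F' : Set X} {m : X → Circle} (h : LogOn F m) (hF : F' ⊆ F) : LogOn F' m :=
  let ⟨θ, h1, h2⟩ := h
  ⟨θ, h1.mono hF, fun x hx => h2 x (hF hx)⟩

theorem LogOn.continuousOn {F : Set X} {m : X → Circle} (h : LogOn F m) : ContinuousOn m F :=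
  let ⟨_, h1, h2⟩ := h
  (Circle.exp.continuous.comp_continuousOn h1).congr h2

theorem LogOn.congr {F : Set X} {m m' : X → Circle} (h : LogOn F m) (hm : EqOn m' m F) :
    LogOn F m' :=
  let ⟨θ, h1, h2⟩ := h
  ⟨θ, h1, fun _ hx => (hm hx).trans (h2 _ hx)⟩

theorem LogOn.mul {F : Set X} {m m' : X → Circle} (h : LogOn F m) (h' : LogOn F m') :
    LogOn F (fun x => m x * m' x) :=
  let ⟨θ, h1, h2⟩ := h
  let ⟨θ', h1', h2'⟩ := h'
  ⟨fun x => θ x + θ' x, h1.add h1', fun x hx => by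
    simp only [Circle.exp_add, h2 x hx, h2' x hx]⟩

theorem LogOn.comp {F : Set X} {m : X → Circle} (h : LogOn F m) {g : Y → X} {G : Set Y}
    (hg : ContinuousOn g G) (hgF : MapsTo g G F) : LogOn G (m ∘ g) :=
  let ⟨θ, h1, h2⟩ := h
  ⟨θ ∘ g, h1.comp hg hgF, fun _ hx => h2 _ (hgF hx)⟩

theorem exp_sum {ι : Type*} (s : Finset ι) (f : ι → ℝ) :
    Circle.exp (∑ i ∈ s, f i) = ∏ i ∈ s, Circle.exp (f i) := by
  classical
  induction s using Finset.induction_on with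
  | empty => simp
  | insert a s ha ih => rw [Finset.sum_insert ha, Finset.prod_insert ha, Circle.exp_add, ih]

theorem exp_int_mul (k : ℤ) (x : ℝ) : Circle.exp (k * x) = Circle.exp x ^ k := by
  rw [← zsmul_eq_mul, Circle.exp_zsmul]

theorem LogOn.prod {ι : Type*} {F : Set X} (s : Finset ι) {m : ι → X → Circle} (v : ι → ℤ)
    (h : ∀ i ∈ s, LogOn F (m i)) : LogOn F (fun x => ∏ i ∈ s, m i x ^ v i) := by
  classical
  choose! θ h1 h2 using h
  refine ⟨fun x => ∑ i ∈ s, v i * θ i x, continuousOn_finsetSum _ fun i hi =>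
    continuousOn_const.mul (h1 i hi), fun x hx => ?_⟩
  rw [exp_sum]
  exact Finset.prod_congr rfl fun i hi => by rw [exp_int_mul, h2 i hi x hx]

theorem continuousOn_prod_zpow {ι : Type*} {F : Set X} (s : Finset ι) {m : ι → X → Circle}
    (v : ι → ℤ) (h : ∀ i ∈ s, ContinuousOn (m i) F) :
    ContinuousOn (fun x => ∏ i ∈ s, m i x ^ v i) F :=
  continuousOn_finsetProd _ fun i hi => (continuous_zpow (v i)).comp_continuousOn (h i hi)

theorem logOn_of_dist_lt {F : Set X} {m : X → Circle} (hm : ContinuousOn m F) (c : Circle)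
    (h : ∀ x ∈ F, dist (m x) c < 1) : LogOn F m := by
  refine ⟨fun x => Complex.arg ((m x / c : Circle) : ℂ) + Complex.arg c, ?_, fun x hx => ?_⟩
  · refine ContinuousOn.add (fun x hx => ?_) continuousOn_const
    refine (Complex.continuousAt_arg ?_).comp_continuousWithinAt
      (f := fun x => ((m x / c : Circle) : ℂ))
      ((continuous_subtype_val.comp_continuousOn (hm.div' continuousOn_const)) x hx)
    refine Or.inl ?_
    have h1 := h x hx
    have h2 : ‖((m x / c : Circle) : ℂ) - 1‖ < 1 := by
      have : ((m x / c : Circle) : ℂ) - 1 = (m x - c) / (c : ℂ) := by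
        rw [Circle.coe_div, sub_div, div_self c.coe_ne_zero]
      rw [this, norm_div, Circle.norm_coe, div_one, ← dist_eq_norm]
      exact h1
    have h3 := (Complex.abs_re_le_norm _).trans_lt h2
    rw [Complex.sub_re, Complex.one_re, abs_lt] at h3
    linarith
  · rw [Circle.exp_add, Circle.exp_arg, Circle.exp_arg, div_mul_cancel]

theorem exists_int_eq_of_exp_eq {F : Set X} (hF : IsPreconnected F) {θ θ' : X → ℝ}
    (h : ContinuousOn θ F) (h' : ContinuousOn θ' F)
    (heq : ∀ x ∈ F, Circle.exp (θ x) = Circle.exp (θ' x)) :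
    ∃ k : ℤ, ∀ x ∈ F, θ x = θ' x + k * (2 * Real.pi) := by
  rcases F.eq_empty_or_nonempty with rfl | ⟨x₀, hx₀⟩
  · exact ⟨0, fun x hx => hx.elim⟩
  obtain ⟨k, hk⟩ := Circle.exp_eq_exp.1 (heq x₀ hx₀)
  refine ⟨k, fun x hx => ?_⟩
  have hd : IsDiscrete (range ((↑) : ℤ → ℝ)) :=
    Int.isClosedEmbedding_coe_real.isEmbedding.isDiscrete_range
  have hc : ContinuousOn (fun x => (θ x - θ' x) / (2 * Real.pi)) F :=
    (h.sub h').div_const _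
  have hpi : (2 * Real.pi) ≠ 0 := by positivity
  have := hF.constant_of_mapsTo hd hc (fun y hy => by
    obtain ⟨l, hl⟩ := Circle.exp_eq_exp.1 (heq y hy)
    exact ⟨l, by simp only [hl, add_sub_cancel_left, mul_div_cancel_right₀ _ hpi]⟩) hx hx₀
  rw [div_left_inj' hpi, hk] at this
  linarith

/-- Two functions on closed sets which agree on the intersection. -/
theorem exists_glue {Z : Type*} [TopologicalSpace Z] {P Q : Set X} (hP : IsClosed P)
    (hQ : IsClosed Q) {f g : X → Z} (hf : ContinuousOn f P) (hg : ContinuousOn g Q)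
    (h : ∀ x ∈ P ∩ Q, f x = g x) :
    ∃ k : X → Z, ContinuousOn k (P ∪ Q) ∧ EqOn k f P ∧ EqOn k g Q := by
  classical
  have h1 : EqOn (P.piecewise f g) f P := fun x hx => piecewise_eq_of_mem _ _ _ hx
  have h2 : EqOn (P.piecewise f g) g Q := fun x hx => by
    by_cases hxP : x ∈ P
    · rw [h1 hxP, h x ⟨hxP, hx⟩]
    · exact piecewise_eq_of_notMem _ _ _ hxP
  exact ⟨P.piecewise f g, (hf.congr h1).union_of_isClosed (hg.congr h2) hP hQ, h1, h2⟩

theorem exists_extension_real [NormalSpace X] {F : Set X} (hF : IsClosed F) {θ : X → ℝ}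
    (h : ContinuousOn θ F) : ∃ θ' : C(X, ℝ), ∀ x ∈ F, θ' x = θ x := by
  obtain ⟨g, hg⟩ := ContinuousMap.exists_restrict_eq hF ⟨F.domRestrict θ, h.domRestrict⟩
  exact ⟨g, fun x hx => DFunLike.congr_fun hg ⟨x, hx⟩⟩

theorem hasLogs_union {P Q : Set X} (hP : IsClosed P) (hQ : IsClosed Q) (hP' : HasLogs P)
    (hQ' : HasLogs Q) (hPQ : IsPreconnected (P ∩ Q)) : HasLogs (P ∪ Q) := by
  intro m hm
  obtain ⟨θ, h1, h2⟩ := hP' m (hm.mono subset_union_left)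
  obtain ⟨θ', h1', h2'⟩ := hQ' m (hm.mono subset_union_right)
  obtain ⟨k, hk⟩ := exists_int_eq_of_exp_eq hPQ (h1.mono inter_subset_left)
    (h1'.mono inter_subset_right) fun x hx => by rw [← h2 x hx.1, h2' x hx.2]
  obtain ⟨f, hf, hf1, hf2⟩ := exists_glue hP hQ h1
    (h1'.add (continuousOn_const (c := k * (2 * Real.pi)))) hk
  refine ⟨f, hf, fun x hx => ?_⟩
  rcases hx with hx | hx
  · rw [hf1 hx, h2 x hx]
  · rw [hf2 hx, h2' x hx]
    exact Circle.exp_eq_exp.2 ⟨-k, by simp only [Pi.add_apply]; push_cast; ring⟩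

theorem SplitsOn.mono {m : X → Circle} {F₁ F₂ C C' : Set X} (h : SplitsOn m F₁ F₂ C)
    (hC : C' ⊆ C) : SplitsOn m F₁ F₂ C' :=
  let ⟨u, v, hu, hv, h⟩ := h
  ⟨u, v, hu.mono (inter_subset_inter_right _ hC), hv.mono (inter_subset_inter_right _ hC),
    fun x hx => h x ⟨hx.1, hC hx.2⟩⟩

/-- Glueing two splittings whose quotient has a logarithm. -/
theorem splitsOn_union_of_logOn [NormalSpace X] {m : X → Circle} {F₁ F₂ P Q : Set X}
    (hF₁ : IsClosed F₁) (hF₂ : IsClosed F₂) (hP : IsClosed P)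
    (hQ : IsClosed Q) {u v u' v' w : X → Circle} (hu : ContinuousOn u (F₁ ∩ P))
    (hv : ContinuousOn v (F₂ ∩ P)) (h : ∀ x ∈ F₁ ∩ F₂ ∩ P, m x = u x * v x)
    (hu' : ContinuousOn u' (F₁ ∩ Q)) (hv' : ContinuousOn v' (F₂ ∩ Q))
    (h' : ∀ x ∈ F₁ ∩ F₂ ∩ Q, m x = u' x * v' x)
    (hw₁ : ∀ x ∈ P ∩ Q, x ∈ F₁ → w x = u x / u' x)
    (hw₂ : ∀ x ∈ P ∩ Q, x ∈ F₂ → w x = v' x / v x) (hw : LogOn (P ∩ Q) w) :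
    SplitsOn m F₁ F₂ (P ∪ Q) := by
  obtain ⟨θ, hθ, hwθ⟩ := hw
  obtain ⟨η, hη⟩ := exists_extension_real (hP.inter hQ) hθ
  have hηc : Continuous fun x => Circle.exp (η x) := by fun_prop
  obtain ⟨U, hU, hU1, hU2⟩ := exists_glue (hF₁.inter hP) (hF₁.inter hQ) hu
    (hu'.mul hηc.continuousOn) (fun x hx => by
      have hx' : x ∈ P ∩ Q := ⟨hx.1.2, hx.2.2⟩
      rw [Pi.mul_apply, hη x hx', ← hwθ x hx', hw₁ x hx' hx.1.1, mul_div_cancel])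
  obtain ⟨V, hV, hV1, hV2⟩ := exists_glue (hF₂.inter hP) (hF₂.inter hQ) hv
    (hv'.div' hηc.continuousOn) (fun x hx => by
      have hx' : x ∈ P ∩ Q := ⟨hx.1.2, hx.2.2⟩
      rw [Pi.div_apply, hη x hx', ← hwθ x hx', hw₂ x hx' hx.1.1, div_div_cancel])
  refine ⟨U, V, by rwa [inter_union_distrib_left], by rwa [inter_union_distrib_left], ?_⟩
  rintro x ⟨⟨hx1, hx2⟩, hx | hx⟩
  · rw [hU1 ⟨hx1, hx⟩, hV1 ⟨hx2, hx⟩, h x ⟨⟨hx1, hx2⟩, hx⟩]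
  · rw [hU2 ⟨hx1, hx⟩, hV2 ⟨hx2, hx⟩, h' x ⟨⟨hx1, hx2⟩, hx⟩, Pi.mul_apply,
      Pi.div_apply, mul_mul_div_cancel]

/-- The quotient of two splittings. -/
theorem exists_quotient {m : X → Circle} {F₁ F₂ D : Set X}
    (hF₁ : IsClosed F₁) (hF₂ : IsClosed F₂) (hD : IsClosed D) (hcov : D ⊆ F₁ ∪ F₂)
    {u v u' v' : X → Circle} (hu : ContinuousOn u (F₁ ∩ D))
    (hv : ContinuousOn v (F₂ ∩ D)) (h : ∀ x ∈ F₁ ∩ F₂ ∩ D, m x = u x * v x)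
    (hu' : ContinuousOn u' (F₁ ∩ D)) (hv' : ContinuousOn v' (F₂ ∩ D))
    (h' : ∀ x ∈ F₁ ∩ F₂ ∩ D, m x = u' x * v' x) :
    ∃ w : X → Circle, ContinuousOn w D ∧ (∀ x ∈ D, x ∈ F₁ → w x = u x / u' x) ∧
      ∀ x ∈ D, x ∈ F₂ → w x = v' x / v x := by
  obtain ⟨w, hw, hw1, hw2⟩ := exists_glue (hF₁.inter hD) (hF₂.inter hD) (hu.div' hu')
    (hv'.div' hv) (fun x hx => by
      have h1 := h x ⟨⟨hx.1.1, hx.2.1⟩, hx.1.2⟩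
      have h2 := h' x ⟨⟨hx.1.1, hx.2.1⟩, hx.1.2⟩
      rw [Pi.div_apply, Pi.div_apply, div_eq_div_iff_mul_eq_mul, ← h1, mul_comm, ← h2])
  refine ⟨w, hw.mono fun x hx => ?_, fun x hx hx1 => hw1 ⟨hx1, hx⟩, fun x hx hx2 => hw2 ⟨hx2, hx⟩⟩
  exact (hcov hx).imp (fun h => ⟨h, hx⟩) fun h => ⟨h, hx⟩

theorem SplitsOn.union [NormalSpace X] {m : X → Circle} {F₁ F₂ P Q : Set X}
    (hF₁ : IsClosed F₁) (hF₂ : IsClosed F₂) (hcov : P ∩ Q ⊆ F₁ ∪ F₂) (hP : IsClosed P)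
    (hQ : IsClosed Q) (h : SplitsOn m F₁ F₂ P) (h' : SplitsOn m F₁ F₂ Q)
    (hlog : HasLogs (P ∩ Q)) : SplitsOn m F₁ F₂ (P ∪ Q) := by
  obtain ⟨u, v, hu, hv, h⟩ := h
  obtain ⟨u', v', hu', hv', h'⟩ := h'
  have i1 : ∀ F : Set X, F ∩ (P ∩ Q) ⊆ F ∩ P := fun F => inter_subset_inter_right _ inter_subset_left
  have i2 : ∀ F : Set X, F ∩ (P ∩ Q) ⊆ F ∩ Q :=
    fun F => inter_subset_inter_right _ inter_subset_right
  obtain ⟨w, hw, hw1, hw2⟩ := exists_quotient hF₁ hF₂ (hP.inter hQ) hcov (hu.mono (i1 _))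
    (hv.mono (i1 _)) (fun x hx => h x (i1 _ hx)) (hu'.mono (i2 _)) (hv'.mono (i2 _))
    (fun x hx => h' x (i2 _ hx))
  exact splitsOn_union_of_logOn hF₁ hF₂ hP hQ hu hv h hu' hv' h' hw1 hw2 (hlog w hw)

theorem HasLogs.of_retract {F : Set X} {F' : Set Y} (h : HasLogs F') {i : X → Y} {r : Y → X}
    (hi : ContinuousOn i F) (hiF : MapsTo i F F') (hr : ContinuousOn r F') (hrF : MapsTo r F' F)
    (hri : ∀ x ∈ F, r (i x) = x) : HasLogs F := fun m hm =>
  ((h (m ∘ r) (hm.comp hr hrF)).comp hi hiF).congr fun x hx => by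
    simp only [Function.comp_apply, hri x hx]

theorem HasSplittings.of_retract {F : Set X} {F' : Set Y} (hF' : IsClosed F')
    (h : HasSplittings F') {i : X → Y} {r : Y → X}
    (hi : ContinuousOn i F) (hiF : MapsTo i F F') (hr : ContinuousOn r F') (hrF : MapsTo r F' F)
    (hri : ∀ x ∈ F, r (i x) = x) : HasSplittings F := by
  intro F₁ F₂ hF₁ hF₂ hcov m hm
  obtain ⟨u, v, hu, hv, huv⟩ := h (F' ∩ r ⁻¹' F₁) (F' ∩ r ⁻¹' F₂)
    (hr.preimage_isClosed_of_isClosed hF' hF₁) (hr.preimage_isClosed_of_isClosed hF' hF₂)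
    (fun y hy => (hcov (hrF hy)).imp (fun h => ⟨hy, h⟩) fun h => ⟨hy, h⟩) (m ∘ r)
    (hm.comp (hr.mono inter_subset_right) fun y hy => ⟨⟨hy.1.1.2, hy.1.2.2⟩, hrF hy.2⟩)
  have key : ∀ G : Set X, MapsTo i (G ∩ F) (F' ∩ r ⁻¹' G ∩ F') := fun G x hx =>
    ⟨⟨hiF hx.2, by rw [mem_preimage, hri x hx.2]; exact hx.1⟩, hiF hx.2⟩
  refine ⟨u ∘ i, v ∘ i, hu.comp (hi.mono inter_subset_right) (key _),
    hv.comp (hi.mono inter_subset_right) (key _), fun x hx => ?_⟩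
  have := huv (i x) ⟨⟨(key _ ⟨hx.1.1, hx.2⟩).1, (key _ ⟨hx.1.2, hx.2⟩).1⟩, hiF hx.2⟩
  rwa [Function.comp_apply, hri x hx.2] at this

end

end

end SphereMaps

namespace SphereMaps

open Set Topology Metric unitInterval

noncomputable section

theorem logOn_const {X : Type*} [TopologicalSpace X] (F : Set X) (c : Circle) :
    LogOn F fun _ => c :=
  ⟨fun _ => Complex.arg c, continuousOn_const, fun _ _ => (Circle.exp_arg c).symm⟩

theorem LogOn.of_dist_lt {X : Type*} [TopologicalSpace X] {F : Set X} {f g : X → Circle}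
    (hf : LogOn F f) (hg : ContinuousOn g F) (h : ∀ x ∈ F, dist (g x) (f x) < 1) : LogOn F g := by
  refine (hf.mul (logOn_of_dist_lt (m := fun x => g x / f x) (hg.div' hf.continuousOn) 1
    fun x hx => ?_)).congr fun x _ => (mul_div_cancel (f x) (g x)).symm
  refine lt_of_eq_of_lt ?_ (h x hx)
  change dist ((g x / f x : Circle) : ℂ) ((1 : Circle) : ℂ) = dist (g x : ℂ) (f x)
  rw [dist_eq_norm, dist_eq_norm, Circle.coe_div, Circle.coe_one,
    div_sub_one (f x).coe_ne_zero, norm_div, Circle.norm_coe, div_one]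

theorem hasLogs_of_convex {E : Type*} [NormedAddCommGroup E] [NormedSpace ℝ E] {C : Set E}
    (hC : IsCompact C) (hconv : Convex ℝ C) : HasLogs C := by
  intro m hm
  rcases C.eq_empty_or_nonempty with rfl | ⟨x₀, hx₀⟩
  · exact ⟨0, continuousOn_const, fun x hx => hx.elim⟩
  obtain ⟨δ, hδ, huc⟩ := Metric.uniformContinuousOn_iff.1
    (hC.uniformContinuousOn_of_continuous hm) 1 one_pos
  obtain ⟨R, hR⟩ := hC.isBounded.subset_closedBall x₀
  obtain ⟨n, hn⟩ := exists_nat_gt (R / δ)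
  have hR0 : 0 ≤ R := by
    have := hR hx₀
    rw [mem_closedBall, dist_self] at this; exact this
  have hn0 : (0 : ℝ) < n := lt_of_le_of_lt (by positivity) hn
  let H : ℕ → E → E := fun k x => AffineMap.lineMap x₀ x ((k : ℝ) / n)
  have hHc : ∀ k, Continuous (H k) := fun k => by
    simp only [H, AffineMap.lineMap_apply_module]; fun_prop
  have hHC : ∀ k ≤ n, MapsTo (H k) C C := fun k hk x hx =>
    hconv.lineMap_mem hx₀ hx ⟨by positivity, div_le_one_of_le₀ (by exact_mod_cast hk) hn0.le⟩
  have key : ∀ k ≤ n, LogOn C (m ∘ H k) := by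
    intro k
    induction k with
    | zero =>
      intro _
      refine (logOn_const C (m x₀)).congr fun x _ => ?_
      simp [H]
    | succ k ih =>
      intro hk
      refine (ih (by omega)).of_dist_lt (hm.comp (hHc _).continuousOn (hHC _ hk)) fun x hx =>
        huc _ (hHC _ hk hx) _ (hHC _ (by omega) hx) ?_
      simp only [H]
      rw [dist_lineMap_lineMap, Real.dist_eq, ← sub_div]
      push_cast
      rw [add_sub_cancel_left, abs_of_pos (by positivity), one_div, inv_mul_lt_iff₀ hn0,
        mul_comm, ← div_lt_iff₀' hδ]
      have := hR hx
      rw [mem_closedBall, dist_comm] at this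
      exact (div_le_div_of_nonneg_right this hδ.le).trans_lt (by linarith)
  refine (key n le_rfl).congr fun x _ => ?_
  simp [H, div_self hn0.ne']

theorem splitsOn_of_disjoint {X : Type*} [TopologicalSpace X] {m : X → Circle} {F₁ F₂ C : Set X}
    (h : F₁ ∩ F₂ ∩ C = ∅) : SplitsOn m F₁ F₂ C :=
  ⟨1, 1, continuousOn_const, continuousOn_const, fun x hx => (h ▸ hx : x ∈ (∅ : Set X)).elim⟩

/-- Splittings exist locally. -/
theorem exists_splitsOn_ball {X : Type*} [MetricSpace X] {m : X → Circle} {F₁ F₂ C : Set X}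
    (hF : IsClosed (F₁ ∩ F₂ ∩ C)) (hm : ContinuousOn m (F₁ ∩ F₂ ∩ C)) (x : X) :
    ∃ r > 0, SplitsOn m F₁ F₂ (C ∩ ball x r) := by
  by_cases hx : x ∈ F₁ ∩ F₂ ∩ C
  · obtain ⟨r, hr, h⟩ := Metric.continuousOn_iff.1 hm x hx 1 one_pos
    obtain ⟨θ, h1, h2⟩ := logOn_of_dist_lt (F := F₁ ∩ F₂ ∩ C ∩ closedBall x (r / 2))
      (hm.mono inter_subset_left) (m x) fun y hy => h y hy.1 (by
        have := hy.2; rw [mem_closedBall] at this; linarith)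
    obtain ⟨η, hη⟩ := exists_extension_real (hF.inter isClosed_closedBall) h1
    refine ⟨r / 2, half_pos hr, fun x => Circle.exp (η x), 1, by fun_prop, continuousOn_const,
      fun y hy => ?_⟩
    have hy' : y ∈ F₁ ∩ F₂ ∩ C ∩ closedBall x (r / 2) :=
      ⟨⟨hy.1, hy.2.1⟩, ball_subset_closedBall hy.2.2⟩
    simp only [hη y hy', ← h2 y hy', Pi.one_apply, mul_one]
  · obtain ⟨r, hr, h⟩ := Metric.isOpen_iff.1 hF.isOpen_compl x hx
    exact ⟨r, hr, splitsOn_of_disjoint (eq_empty_of_forall_notMem fun y hy =>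
      h hy.2.2 ⟨hy.1, hy.2.1⟩)⟩

theorem convex_slab (i : Fin 3) (a b : ℝ) : Convex ℝ {x : E3 | a ≤ x i ∧ x i ≤ b} := by
  have h := (convex_Icc a b).linear_preimage (EuclideanSpace.proj (𝕜 := ℝ) i : E3 →L[ℝ] ℝ).toLinearMap
  exact h

theorem isClosed_slab (i : Fin 3) (a b : ℝ) : IsClosed {x : E3 | a ≤ x i ∧ x i ≤ b} :=
  isClosed_Icc.preimage (EuclideanSpace.proj (𝕜 := ℝ) i : E3 →L[ℝ] ℝ).continuous

theorem splitsOn_of_slabs {m : E3 → Circle} {F₁ F₂ C : Set E3} (hF₁ : IsClosed F₁)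
    (hF₂ : IsClosed F₂) (hC : IsCompact C) (hconv : Convex ℝ C) (hcov : C ⊆ F₁ ∪ F₂) {η : ℝ}
    (hη : 0 < η) (i : Fin 3)
    (h : ∀ a : ℝ, SplitsOn m F₁ F₂ (C ∩ {x | a ≤ x i ∧ x i ≤ a + η})) : SplitsOn m F₁ F₂ C := by
  obtain ⟨R, hR⟩ := hC.isBounded.subset_closedBall 0
  have hcl := hC.isClosed
  have key : ∀ n : ℕ, SplitsOn m F₁ F₂ (C ∩ {x | -R ≤ x i ∧ x i ≤ -R + n * η}) := by
    intro n
    induction n with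
    | zero =>
      refine (h (-R)).mono (inter_subset_inter_right _ fun x hx => ⟨hx.1, hx.2.trans ?_⟩)
      simp [hη.le]
    | succ n ih =>
      refine (ih.union hF₁ hF₂ ?_ (hcl.inter (isClosed_slab _ _ _))
        (hcl.inter (isClosed_slab _ _ _)) (h (-R + n * η)) ?_).mono ?_
      · exact fun x hx => hcov hx.1.1
      · exact hasLogs_of_convex ((hC.inter_right (isClosed_slab _ _ _)).inter
          (hC.inter_right (isClosed_slab _ _ _)))
          ((hconv.inter (convex_slab _ _ _)).inter (hconv.inter (convex_slab _ _ _)))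
      · rintro x ⟨hx, h1, h2⟩
        rcases le_total (x i) (-R + n * η) with h3 | h3
        · exact Or.inl ⟨hx, h1, h3⟩
        · refine Or.inr ⟨hx, h3, h2.trans (le_of_eq ?_)⟩
          push_cast; ring
  obtain ⟨n, hn⟩ := exists_nat_gt (2 * R / η)
  rw [div_lt_iff₀ hη] at hn
  refine (key n).mono fun x hx => ⟨hx, ?_⟩
  have h1 := (PiLp.norm_apply_le x i).trans (mem_closedBall_zero_iff.1 (hR hx))
  rw [Real.norm_eq_abs, abs_le] at h1
  exact ⟨h1.1, by linarith⟩

theorem hasSplittings_of_convex {C : Set E3} (hC : IsCompact C) (hconv : Convex ℝ C) :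
    HasSplittings C := by
  intro F₁ F₂ hF₁ hF₂ hcov m hm
  have hF : IsClosed (F₁ ∩ F₂ ∩ C) := (hF₁.inter hF₂).inter hC.isClosed
  choose r hr hsp using exists_splitsOn_ball hF hm
  obtain ⟨δ, hδ, hleb⟩ := lebesgue_number_lemma_of_metric hC (c := fun x => ball x (r x))
    (fun _ => isOpen_ball) (fun x _ => mem_iUnion.2 ⟨x, mem_ball_self (hr x)⟩)
  have hη := half_pos hδ
  refine splitsOn_of_slabs hF₁ hF₂ hC hconv hcov hη 0 fun a => ?_
  refine splitsOn_of_slabs hF₁ hF₂ (hC.inter_right (isClosed_slab _ _ _))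
    (hconv.inter (convex_slab _ _ _)) (inter_subset_left.trans hcov) hη 1 fun b => ?_
  refine splitsOn_of_slabs hF₁ hF₂ ((hC.inter_right (isClosed_slab _ _ _)).inter_right
    (isClosed_slab _ _ _)) ((hconv.inter (convex_slab _ _ _)).inter (convex_slab _ _ _))
    ((inter_subset_left.trans inter_subset_left).trans hcov) hη 2 fun c => ?_
  rcases eq_empty_or_nonempty (C ∩ {x : E3 | a ≤ x 0 ∧ x 0 ≤ a + δ / 2} ∩
    {x | b ≤ x 1 ∧ x 1 ≤ b + δ / 2} ∩ {x | c ≤ x 2 ∧ x 2 ≤ c + δ / 2}) with he | ⟨x, hx⟩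
  · rw [he]; exact splitsOn_of_disjoint (inter_empty _)
  · obtain ⟨i, hi⟩ := hleb x hx.1.1.1
    refine (hsp i).mono fun y hy => ⟨hy.1.1.1, hi ?_⟩
    rw [mem_ball, EuclideanSpace.dist_eq, Fin.sum_univ_three, Real.sqrt_lt' hδ, Real.dist_eq,
      Real.dist_eq, Real.dist_eq, sq_abs, sq_abs, sq_abs]
    obtain ⟨⟨⟨-, h1, h2⟩, h3, h4⟩, h5, h6⟩ := hx
    obtain ⟨⟨⟨-, h1', h2'⟩, h3', h4'⟩, h5', h6'⟩ := hy
    have e0 : (y 0 - x 0) ^ 2 ≤ (δ / 2) ^ 2 := sq_le_sq' (by linarith) (by linarith)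
    have e1 : (y 1 - x 1) ^ 2 ≤ (δ / 2) ^ 2 := sq_le_sq' (by linarith) (by linarith)
    have e2 : (y 2 - x 2) ^ 2 ≤ (δ / 2) ^ 2 := sq_le_sq' (by linarith) (by linarith)
    nlinarith [sq_pos_of_pos hδ]

end

end SphereMaps

namespace SphereMaps

open Set Topology Metric unitInterval

noncomputable section

/-- If two sets with logarithms meet in two connected pieces, there is only one integral
obstruction to the existence of logarithms on the union. -/
theorem exists_obstruction_logOn_union {X : Type*} [TopologicalSpace X] {P Q T₁ T₂ : Set X}
    (hP : IsClosed P) (hQ : IsClosed Q) (hP' : HasLogs P) (hQ' : HasLogs Q)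
    (hT₁ : IsPreconnected T₁) (hT₂ : IsPreconnected T₂) (hTPQ : P ∩ Q = T₁ ∪ T₂) {n : ℕ}
    (m : Fin n → X → Circle) (hm : ∀ i, ContinuousOn (m i) (P ∪ Q)) :
    ∃ e : Fin n → ℤ, ∀ v : Fin n → ℤ, ∑ i, v i * e i = 0 →
      LogOn (P ∪ Q) fun x => ∏ i, m i x ^ v i := by
  choose θ h1 h2 using fun i => hP' (m i) ((hm i).mono subset_union_left)
  choose θ' h1' h2' using fun i => hQ' (m i) ((hm i).mono subset_union_right)
  have s1 : T₁ ⊆ P ∩ Q := hTPQ ▸ subset_union_left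
  have s2 : T₂ ⊆ P ∩ Q := hTPQ ▸ subset_union_right
  have key : ∀ T : Set X, IsPreconnected T → T ⊆ P ∩ Q → ∀ i, ∃ k : ℤ, ∀ x ∈ T,
      θ i x = θ' i x + k * (2 * Real.pi) := fun T hT hs i =>
    exists_int_eq_of_exp_eq hT ((h1 i).mono (hs.trans inter_subset_left))
      ((h1' i).mono (hs.trans inter_subset_right)) fun x hx => by
        rw [← h2 i x (hs hx).1, h2' i x (hs hx).2]
  choose k hk using key T₁ hT₁ s1
  choose l hl using key T₂ hT₂ s2
  refine ⟨fun i => k i - l i, fun v hv => ?_⟩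
  have hv' : ∑ i, (v i : ℝ) * l i = ∑ i, (v i : ℝ) * k i := by
    simp only [mul_sub, Finset.sum_sub_distrib, sub_eq_zero] at hv
    exact_mod_cast hv.symm
  have hsum : ∀ (x : X) (c : Fin n → ℤ), (∀ i, θ i x = θ' i x + c i * (2 * Real.pi)) →
      ∑ i, v i * θ i x = ∑ i, v i * θ' i x + (∑ i, (v i : ℝ) * c i) * (2 * Real.pi) := by
    intro x c h
    rw [Finset.sum_mul, ← Finset.sum_add_distrib]
    exact Finset.sum_congr rfl fun i _ => by rw [h i]; ring
  obtain ⟨f, hf, hf1, hf2⟩ := exists_glue hP hQ (f := fun x => ∑ i, v i * θ i x)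
    (g := fun x => ∑ i, v i * θ' i x + (∑ i, (v i : ℝ) * k i) * (2 * Real.pi))
    (continuousOn_finsetSum _ fun i _ => continuousOn_const.mul (h1 i))
    ((continuousOn_finsetSum _ fun i _ => continuousOn_const.mul (h1' i)).add continuousOn_const)
    (fun x hx => by
      rw [hTPQ] at hx
      rcases hx with hx | hx
      · exact hsum x k fun i => hk i x hx
      · rw [← hv']; exact hsum x l fun i => hl i x hx)
  have hexp : ∀ x, ∀ η : Fin n → ℝ, (∀ i, m i x = Circle.exp (η i)) →
      ∏ i, m i x ^ v i = Circle.exp (∑ i, v i * η i) := fun x η h => by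
    rw [exp_sum]
    exact Finset.prod_congr rfl fun i _ => by rw [exp_int_mul, h i]
  refine ⟨f, hf, fun x hx => ?_⟩
  rcases hx with hx | hx
  · rw [hf1 hx]; exact hexp x _ fun i => h2 i x hx
  · rw [hf2 hx]
    refine (hexp x _ fun i => h2' i x hx).trans
      (Circle.exp_eq_exp.2 ⟨-∑ i, v i * k i, by push_cast; ring⟩)

theorem norm_sq_E3 (x : E3) : ‖x‖ ^ 2 = x 0 ^ 2 + x 1 ^ 2 + x 2 ^ 2 := by
  rw [EuclideanSpace.real_norm_sq_eq, Fin.sum_univ_three]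

/-- The spherical shell. -/
def shell (s L : ℝ) : Set E3 := {x | s ≤ ‖x‖ ∧ ‖x‖ ≤ L}

theorem isClosed_shell (s L : ℝ) : IsClosed (shell s L) :=
  (isClosed_le continuous_const continuous_norm).inter (isClosed_le continuous_norm continuous_const)

/-- A half of the spherical shell. -/
def halfShell (ε s L : ℝ) : Set E3 := shell s L ∩ {x | 0 ≤ ε * x 0}

/-- A half of the equatorial annulus. -/
def halfAnnulus (ε s L : ℝ) : Set E3 := shell s L ∩ {x | x 0 = 0 ∧ 0 ≤ ε * x 1}

theorem continuous_coord (i : Fin 3) : Continuous fun x : E3 => x i :=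
  (EuclideanSpace.proj (𝕜 := ℝ) i : E3 →L[ℝ] ℝ).continuous

theorem convex_half (ε : ℝ) (i : Fin 3) : Convex ℝ {x : E3 | 0 ≤ ε * x i} :=
  (convex_Ici (0 : ℝ)).linear_preimage
    (ε • (EuclideanSpace.proj (𝕜 := ℝ) i : E3 →L[ℝ] ℝ)).toLinearMap

theorem isClosed_half (ε : ℝ) (i : Fin 3) : IsClosed {x : E3 | 0 ≤ ε * x i} :=
  isClosed_le continuous_const (continuous_const.mul (continuous_coord i))

theorem convex_equator (i : Fin 3) : Convex ℝ {x : E3 | x i = 0} :=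
  (convex_singleton (0 : ℝ)).linear_preimage
    (EuclideanSpace.proj (𝕜 := ℝ) i : E3 →L[ℝ] ℝ).toLinearMap

theorem isClosed_equator (i : Fin 3) : IsClosed {x : E3 | x i = 0} :=
  isClosed_eq (continuous_coord i) continuous_const

theorem le_max_sqrt {s a b : ℝ} : s ^ 2 ≤ max a (√(s ^ 2 - b)) ^ 2 + b := by
  rcases le_total (s ^ 2 - b) 0 with h | h
  · nlinarith [sq_nonneg (max a (√(s ^ 2 - b)))]
  · have h1 := Real.sq_sqrt h
    have h2 := le_max_right a (√(s ^ 2 - b))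
    nlinarith [Real.sqrt_nonneg (s ^ 2 - b)]

theorem max_sqrt_le {s L a b : ℝ} (hL : a ^ 2 + b ≤ L ^ 2) (hs : s ^ 2 ≤ L ^ 2) : max a (√(s ^ 2 - b)) ^ 2 + b ≤ L ^ 2 := by
  rcases le_total a (√(s ^ 2 - b)) with h | h
  · rw [max_eq_right h]
    rcases le_total (s ^ 2 - b) 0 with h' | h'
    · rw [Real.sqrt_eq_zero_of_nonpos h']; nlinarith [sq_nonneg a]
    · rw [Real.sq_sqrt h']; linarith
  · rwa [max_eq_left h]

theorem max_sqrt_eq {s a b : ℝ} (ha : 0 ≤ a) (h : s ^ 2 ≤ a ^ 2 + b) :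
    max a (√(s ^ 2 - b)) = a :=
  max_eq_left (Real.sqrt_le_iff.2 ⟨ha, by linarith⟩)

theorem mem_shell {s L : ℝ} (hs : 0 ≤ s) (hL : 0 ≤ L) {x : E3} :
    x ∈ shell s L ↔ s ^ 2 ≤ x 0 ^ 2 + x 1 ^ 2 + x 2 ^ 2 ∧ x 0 ^ 2 + x 1 ^ 2 + x 2 ^ 2 ≤ L ^ 2 := by
  rw [← norm_sq_E3, sq_le_sq₀ hs (norm_nonneg _), sq_le_sq₀ (norm_nonneg _) hL]
  rfl

section

variable {ε s L : ℝ} (hε : ε * ε = 1) (hs : 0 ≤ s) (hsL : s ≤ L)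
include hε hs hsL

theorem exists_retraction_halfShell : ∃ (C : Set E3) (r : E3 → E3), IsCompact C ∧ Convex ℝ C ∧
    Continuous r ∧ halfShell ε s L ⊆ C ∧ MapsTo r C (halfShell ε s L) ∧
    ∀ x ∈ halfShell ε s L, r x = x := by
  have hL := hs.trans hsL
  have hsL2 : s ^ 2 ≤ L ^ 2 := pow_le_pow_left₀ hs hsL 2
  have hc : ∀ x : ℝ, ε * (ε * x) = x := fun x => by rw [← mul_assoc, hε, one_mul]
  have hsq : ∀ x : ℝ, (ε * x) ^ 2 = x ^ 2 := fun x => by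
    rw [mul_pow, sq ε, hε, one_mul]
  refine ⟨closedBall 0 L ∩ {x | 0 ≤ ε * x 0},
    fun x => !₂[ε * max (ε * x 0) (√(s ^ 2 - (x 1 ^ 2 + x 2 ^ 2))), x 1, x 2],
    (isCompact_closedBall _ _).inter_right (isClosed_half _ _),
    (convex_closedBall _ _).inter (convex_half _ _), ?_, ?_, ?_, ?_⟩
  · refine (PiLp.continuous_toLp 2 _).comp (continuous_pi fun i => ?_)
    have h0 := continuous_coord 0
    have h1 := continuous_coord 1
    have h2 := continuous_coord 2
    fin_cases i <;> simp <;> fun_prop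
  · exact fun x hx => ⟨mem_closedBall_zero_iff.2 hx.1.2, hx.2⟩
  · intro x hx
    have hx1 : x 0 ^ 2 + x 1 ^ 2 + x 2 ^ 2 ≤ L ^ 2 := by
      rw [← norm_sq_E3]
      exact pow_le_pow_left₀ (norm_nonneg _) (mem_closedBall_zero_iff.1 hx.1) 2
    have hx0 : 0 ≤ ε * x 0 := hx.2
    refine ⟨(mem_shell hs hL).2 ?_, ?_⟩
    · simp only [Matrix.cons_val_zero, Matrix.cons_val_one, Matrix.cons_val, hsq, add_assoc]
      refine ⟨le_max_sqrt, max_sqrt_le ?_ hsL2⟩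
      rw [hsq]; linarith
    · simp only [mem_ofPred_eq, Matrix.cons_val_zero, hc]
      exact le_max_of_le_left hx0
  · intro x hx
    have h := ((mem_shell hs hL).1 hx.1).1
    have : max (ε * x 0) (√(s ^ 2 - (x 1 ^ 2 + x 2 ^ 2))) = ε * x 0 :=
      max_sqrt_eq hx.2 (by rw [hsq]; linarith)
    ext i
    simp only [this, hc]
    fin_cases i <;> rfl

theorem exists_retraction_halfAnnulus : ∃ (C : Set E3) (r : E3 → E3), IsCompact C ∧ Convex ℝ C ∧
    Continuous r ∧ halfAnnulus ε s L ⊆ C ∧ MapsTo r C (halfAnnulus ε s L) ∧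
    ∀ x ∈ halfAnnulus ε s L, r x = x := by
  have hL := hs.trans hsL
  have hsL2 : s ^ 2 ≤ L ^ 2 := pow_le_pow_left₀ hs hsL 2
  have hc : ∀ x : ℝ, ε * (ε * x) = x := fun x => by rw [← mul_assoc, hε, one_mul]
  have hsq : ∀ x : ℝ, (ε * x) ^ 2 = x ^ 2 := fun x => by
    rw [mul_pow, sq ε, hε, one_mul]
  refine ⟨closedBall 0 L ∩ {x | x 0 = 0} ∩ {x | 0 ≤ ε * x 1},
    fun x => !₂[0, ε * max (ε * x 1) (√(s ^ 2 - x 2 ^ 2)), x 2],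
    ((isCompact_closedBall _ _).inter_right (isClosed_equator _)).inter_right (isClosed_half _ _),
    ((convex_closedBall _ _).inter (convex_equator _)).inter (convex_half _ _), ?_, ?_, ?_, ?_⟩
  · refine (PiLp.continuous_toLp 2 _).comp (continuous_pi fun i => ?_)
    have h1 := continuous_coord 1
    have h2 := continuous_coord 2
    fin_cases i <;> simp <;> fun_prop
  · exact fun x hx => ⟨⟨mem_closedBall_zero_iff.2 hx.1.2, hx.2.1⟩, hx.2.2⟩
  · intro x hx
    have hx1 : x 0 ^ 2 + x 1 ^ 2 + x 2 ^ 2 ≤ L ^ 2 := by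
      rw [← norm_sq_E3]
      exact pow_le_pow_left₀ (norm_nonneg _) (mem_closedBall_zero_iff.1 hx.1.1) 2
    have hx0 : 0 ≤ ε * x 1 := hx.2
    refine ⟨(mem_shell hs hL).2 ?_, ?_⟩
    · simp only [Matrix.cons_val_zero, Matrix.cons_val_one, Matrix.cons_val, hsq,
        zero_pow two_ne_zero, zero_add]
      refine ⟨le_max_sqrt, max_sqrt_le ?_ hsL2⟩
      rw [hsq]; nlinarith [sq_nonneg (x 0)]
    · simp only [mem_ofPred_eq, Matrix.cons_val_zero, Matrix.cons_val_one, hc]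
      exact ⟨trivial, le_max_of_le_left hx0⟩
  · intro x hx
    have h := ((mem_shell hs hL).1 hx.1).1
    have h0 : x 0 = 0 := hx.2.1
    have : max (ε * x 1) (√(s ^ 2 - x 2 ^ 2)) = ε * x 1 :=
      max_sqrt_eq hx.2.2 (by rw [hsq]; nlinarith)
    ext i
    simp only [this, hc]
    fin_cases i
    · exact h0.symm
    · rfl
    · rfl

theorem hasLogs_halfShell : HasLogs (halfShell ε s L) := by
  obtain ⟨C, r, hC, hconv, hr, h1, h2, h3⟩ := exists_retraction_halfShell hε hs hsL
  exact (hasLogs_of_convex hC hconv).of_retract continuousOn_id h1 hr.continuousOn h2 h3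

theorem hasSplittings_halfShell : HasSplittings (halfShell ε s L) := by
  obtain ⟨C, r, hC, hconv, hr, h1, h2, h3⟩ := exists_retraction_halfShell hε hs hsL
  exact (hasSplittings_of_convex hC hconv).of_retract hC.isClosed continuousOn_id h1
    hr.continuousOn h2 h3

theorem hasLogs_halfAnnulus : HasLogs (halfAnnulus ε s L) := by
  obtain ⟨C, r, hC, hconv, hr, h1, h2, h3⟩ := exists_retraction_halfAnnulus hε hs hsL
  exact (hasLogs_of_convex hC hconv).of_retract continuousOn_id h1 hr.continuousOn h2 h3

theorem isPreconnected_halfAnnulus : IsPreconnected (halfAnnulus ε s L) := by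
  obtain ⟨C, r, hC, hconv, hr, h1, h2, h3⟩ := exists_retraction_halfAnnulus hε hs hsL
  have : halfAnnulus ε s L = r '' C :=
    subset_antisymm (fun x hx => ⟨x, h1 hx, h3 x hx⟩) h2.image_subset
  rw [this]
  exact hconv.isPreconnected.image _ hr.continuousOn

end

theorem isClosed_halfShell (ε s L : ℝ) : IsClosed (halfShell ε s L) :=
  (isClosed_shell s L).inter (isClosed_half _ _)

theorem isClosed_halfAnnulus (ε s L : ℝ) : IsClosed (halfAnnulus ε s L) :=
  (isClosed_shell s L).inter ((isClosed_equator 0).inter (isClosed_half _ _))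

theorem halfShell_union (s L : ℝ) : halfShell 1 s L ∪ halfShell (-1) s L = shell s L := by
  ext x
  simp only [halfShell, mem_union, mem_inter_iff, mem_ofPred_eq, one_mul, neg_one_mul,
    neg_nonneg, ← and_or_left, le_total, and_true]

theorem halfShell_inter (s L : ℝ) :
    halfShell 1 s L ∩ halfShell (-1) s L = halfAnnulus 1 s L ∪ halfAnnulus (-1) s L := by
  ext x
  simp only [halfShell, halfAnnulus, mem_union, mem_inter_iff, mem_ofPred_eq, one_mul,
    neg_one_mul, neg_nonneg, ← and_or_left, le_total, and_true]
  constructor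
  · rintro ⟨⟨h1, h2⟩, -, h3⟩; exact ⟨h1, le_antisymm h3 h2⟩
  · rintro ⟨h1, h2⟩; exact ⟨⟨h1, h2.ge⟩, h1, h2.le⟩

theorem halfAnnulus_inter {s L : ℝ} (hs : 0 ≤ s) (hL : 0 ≤ L) :
    halfAnnulus 1 s L ∩ halfAnnulus (-1) s L =
      {x | x 0 = 0} ∩ {x | x 1 = 0} ∩ {x | s ≤ x 2 ∧ x 2 ≤ L} ∪
      {x | x 0 = 0} ∩ {x | x 1 = 0} ∩ {x | -L ≤ x 2 ∧ x 2 ≤ -s} := by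
  have key : ∀ x : E3, x 0 = 0 → x 1 = 0 →
      (x ∈ shell s L ↔ (s ≤ x 2 ∧ x 2 ≤ L) ∨ (-L ≤ x 2 ∧ x 2 ≤ -s)) := by
    intro x h0 h1
    rw [mem_shell hs hL, h0, h1, zero_pow two_ne_zero, zero_add, zero_add, sq_le_sq, sq_le_sq,
      abs_of_nonneg hs, abs_of_nonneg hL, abs_le, le_abs']
    constructor
    · rintro ⟨h | h, h', h''⟩
      · exact Or.inr ⟨h', h⟩
      · exact Or.inl ⟨h, h''⟩
    · rintro (⟨h, h'⟩ | ⟨h, h'⟩)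
      · exact ⟨Or.inr h, by linarith, h'⟩
      · exact ⟨Or.inl h', h, by linarith⟩
  ext x
  simp only [halfAnnulus, mem_union, mem_inter_iff, mem_ofPred_eq, one_mul, neg_one_mul,
    neg_nonneg, ← and_or_left]
  constructor
  · rintro ⟨⟨h1, h2, h3⟩, -, -, h4⟩
    have h5 := le_antisymm h4 h3
    exact ⟨⟨h2, h5⟩, (key x h2 h5).1 h1⟩
  · rintro ⟨⟨h2, h5⟩, h⟩
    have := (key x h2 h5).2 h
    exact ⟨⟨this, h2, h5.ge⟩, this, h2, h5.le⟩

theorem hasLogs_shell {s L : ℝ} (hs : 0 ≤ s) (hsL : s ≤ L) : HasLogs (shell s L) := by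
  rw [← halfShell_union]
  refine hasLogs_union (isClosed_halfShell _ _ _) (isClosed_halfShell _ _ _)
    (hasLogs_halfShell (by simp) hs hsL) (hasLogs_halfShell (by simp) hs hsL) ?_
  rw [halfShell_inter]
  have hp : EuclideanSpace.single 2 s ∈ halfAnnulus 1 s L ∩ halfAnnulus (-1) s L := by
    rw [halfAnnulus_inter hs (hs.trans hsL)]
    exact Or.inl ⟨⟨by simp, by simp⟩, by simpa using hsL⟩
  exact (isPreconnected_halfAnnulus (by simp) hs hsL).union _ hp.1 hp.2
    (isPreconnected_halfAnnulus (by simp) hs hsL)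

/-- There is one integral obstruction to splittings on a shell. -/
theorem exists_obstruction_shell {s L : ℝ} (hs : 0 ≤ s) (hsL : s ≤ L) {F₁ F₂ : Set E3}
    (hF₁ : IsClosed F₁) (hF₂ : IsClosed F₂) (hcov : shell s L ⊆ F₁ ∪ F₂) {n : ℕ}
    (m : Fin n → E3 → Circle) (hm : ∀ i, ContinuousOn (m i) (F₁ ∩ F₂ ∩ shell s L)) :
    ∃ e : Fin n → ℤ, ∀ v : Fin n → ℤ, ∑ i, v i * e i = 0 →
      SplitsOn (fun x => ∏ i, m i x ^ v i) F₁ F₂ (shell s L) := by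
  rw [← halfShell_union] at hcov hm ⊢
  have hP := isClosed_halfShell 1 s L
  have hQ := isClosed_halfShell (-1) s L
  choose u v hu hv h using fun i => hasSplittings_halfShell (ε := 1) (by simp) hs hsL F₁ F₂ hF₁ hF₂
    (subset_union_left.trans hcov) (m i) ((hm i).mono (inter_subset_inter_right _ subset_union_left))
  choose u' v' hu' hv' h' using fun i => hasSplittings_halfShell (ε := -1) (by simp) hs hsL F₁ F₂
    hF₁ hF₂ (subset_union_right.trans hcov) (m i)
    ((hm i).mono (inter_subset_inter_right _ subset_union_right))
  have i1 : ∀ F : Set E3, F ∩ (halfShell 1 s L ∩ halfShell (-1) s L) ⊆ F ∩ halfShell 1 s L :=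
    fun F => inter_subset_inter_right _ inter_subset_left
  have i2 : ∀ F : Set E3, F ∩ (halfShell 1 s L ∩ halfShell (-1) s L) ⊆ F ∩ halfShell (-1) s L :=
    fun F => inter_subset_inter_right _ inter_subset_right
  choose w hw hw1 hw2 using fun i => exists_quotient (m := m i) hF₁ hF₂ (hP.inter hQ)
    ((inter_subset_left.trans subset_union_left).trans hcov) ((hu i).mono (i1 _))
    ((hv i).mono (i1 _)) (fun x hx => h i x (i1 _ hx)) ((hu' i).mono (i2 _)) ((hv' i).mono (i2 _))
    (fun x hx => h' i x (i2 _ hx))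
  obtain ⟨e, he⟩ := exists_obstruction_logOn_union (isClosed_halfAnnulus 1 s L)
    (isClosed_halfAnnulus (-1) s L) (hasLogs_halfAnnulus (by simp) hs hsL)
    (hasLogs_halfAnnulus (by simp) hs hsL)
    (((convex_equator 0).inter (convex_equator 1)).inter (convex_slab 2 s L)).isPreconnected
    (((convex_equator 0).inter (convex_equator 1)).inter (convex_slab 2 (-L) (-s))).isPreconnected
    (halfAnnulus_inter hs (hs.trans hsL)) w (by rw [← halfShell_inter]; exact hw)
  refine ⟨e, fun c hc => ?_⟩
  have hlog := he c hc
  rw [← halfShell_inter] at hlog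
  refine splitsOn_union_of_logOn hF₁ hF₂ hP hQ
    (continuousOn_prod_zpow Finset.univ c fun i _ => hu i)
    (continuousOn_prod_zpow Finset.univ c fun i _ => hv i) (fun x hx => ?_)
    (continuousOn_prod_zpow Finset.univ c fun i _ => hu' i)
    (continuousOn_prod_zpow Finset.univ c fun i _ => hv' i) (fun x hx => ?_)
    (fun x hx hx1 => ?_) (fun x hx hx2 => ?_) hlog
  · simp only [h _ x hx, mul_zpow, Finset.prod_mul_distrib]
  · simp only [h' _ x hx, mul_zpow, Finset.prod_mul_distrib]
  · simp only [hw1 _ x hx hx1, div_zpow, Finset.prod_div_distrib]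
  · simp only [hw2 _ x hx hx2, div_zpow, Finset.prod_div_distrib]

end

end SphereMaps

namespace SphereMaps

open Set Topology Metric unitInterval

noncomputable section

/-- Neighbourhoods adapted to a decomposition. -/
theorem exists_adapted_open {X : Type*} [TopologicalSpace X] [NormalSpace X]
    {A₁ A₂ O₁ O₂ D : Set X} (hA₁ : IsClosed A₁) (hA₂ : IsClosed A₂) (hO₁ : IsOpen O₁)
    (hO₂ : IsOpen O₂) (h₁ : A₁ ⊆ O₁) (h₂ : A₂ ⊆ O₂) (hD : IsClosed D)
    (hDA : Disjoint D (A₁ ∩ A₂)) (hDO : (O₁ ∩ O₂)ᶜ ⊆ D) :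
    ∃ F₁ F₂ : Set X, IsClosed F₁ ∧ IsClosed F₂ ∧ D ⊆ F₁ ∪ F₂ ∧ O₁ᶜ ⊆ F₁ ∩ D ∧ O₂ᶜ ⊆ F₂ ∩ D ∧
      Disjoint (A₁ ∪ A₂) (F₁ ∩ F₂) := by
  obtain ⟨U₁, U₂, hU₁, hU₂, h1, h2, hU⟩ := normal_separation
    (hA₁.inter hD) (hA₂.inter hD) (disjoint_left.2 fun x hx hx' =>
      disjoint_left.1 hDA hx.2 ⟨hx.1, hx'.1⟩)
  have key : ∀ A O U : Set X, A ⊆ O → A ∩ D ⊆ U → A ⊆ O ∩ (U ∪ Dᶜ) := fun A O U h h' x hx =>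
    ⟨h hx, (em (x ∈ D)).imp (fun hxD => h' ⟨hx, hxD⟩) id⟩
  refine ⟨(O₁ ∩ (U₁ ∪ Dᶜ))ᶜ, (O₂ ∩ (U₂ ∪ Dᶜ))ᶜ,
    (hO₁.inter (hU₁.union hD.isOpen_compl)).isClosed_compl,
    (hO₂.inter (hU₂.union hD.isOpen_compl)).isClosed_compl, fun x hx => ?_, fun x hx => ?_,
    fun x hx => ?_, disjoint_left.2 ?_⟩
  · by_contra hx'
    simp only [mem_union, mem_compl_iff, not_or, not_not] at hx'
    exact disjoint_left.1 hU (hx'.1.2.resolve_right fun h => h hx)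
      (hx'.2.2.resolve_right fun h => h hx)
  · exact ⟨fun h => hx h.1, hDO fun h => hx h.1⟩
  · exact ⟨fun h => hx h.1, hDO fun h => hx h.2⟩
  · rintro x (hx | hx) hx'
    · exact hx'.1 (key _ _ _ h₁ h1 hx)
    · exact hx'.2 (key _ _ _ h₂ h2 hx)

/-- The functions defined near the complement of `A` have logarithms on `Y`, up to
obstructions indexed by `ι`. -/
def Defect (ι : Type) {X : Type*} [TopologicalSpace X] (Y A : Set X) : Prop :=
  ∃ O : Set X, IsOpen O ∧ A ⊆ O ∧ Disjoint O Y ∧ ∀ (n : ℕ) (m : Fin n → X → Circle),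
    (∀ i, ContinuousOn (m i) Oᶜ) → ∃ e : ι → Fin n → ℤ, ∀ v : Fin n → ℤ,
      (∀ j, ∑ i, v i * e j i = 0) → LogOn Y fun x => ∏ i, m i x ^ v i

section

variable {X : Type*} [TopologicalSpace X] {Y A A₁ A₂ : Set X} {ι κ : Type}

theorem Defect.mono (h : Defect ι Y A₂) (hA : A₁ ⊆ A₂) : Defect ι Y A₁ :=
  let ⟨O, hO, hAO, hY, h⟩ := h
  ⟨O, hO, hA.trans hAO, hY, h⟩

theorem Defect.of_isEmpty [IsEmpty ι] (h : Defect ι Y A) : Defect κ Y A := by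
  obtain ⟨O, hO, hA, hY, h⟩ := h
  refine ⟨O, hO, hA, hY, fun n m hm => ⟨0, fun v _ => ?_⟩⟩
  obtain ⟨e, he⟩ := h n m hm
  exact he v isEmptyElim

theorem Defect.logOn [IsEmpty ι] {O : Set X} (h : ∀ (n : ℕ) (m : Fin n → X → Circle),
    (∀ i, ContinuousOn (m i) Oᶜ) → ∃ e : ι → Fin n → ℤ, ∀ v : Fin n → ℤ,
      (∀ j, ∑ i, v i * e j i = 0) → LogOn Y fun x => ∏ i, m i x ^ v i) {m : X → Circle}
    (hm : ContinuousOn m Oᶜ) : LogOn Y m := by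
  obtain ⟨e, he⟩ := h 1 (fun _ => m) fun _ => hm
  simpa using he (fun _ => 1) isEmptyElim

theorem Defect.of_hasSplittings [NormalSpace X] (hA₁ : IsClosed A₁) (hA₂ : IsClosed A₂)
    (hreg : ∀ O : Set X, IsOpen O → A₁ ∩ A₂ ⊆ O → ∃ D : Set X, IsClosed D ∧ Disjoint D (A₁ ∩ A₂) ∧
      Oᶜ ⊆ D ∧ HasSplittings D)
    (h₁ : Defect ι Y A₁) (h₂ : Defect κ Y A₂) : Defect (ι ⊕ κ) Y (A₁ ∪ A₂) := by
  obtain ⟨O₁, hO₁, hAO₁, hY₁, h₁⟩ := h₁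
  obtain ⟨O₂, hO₂, hAO₂, hY₂, h₂⟩ := h₂
  obtain ⟨D, hD, hDA, hDO, hsp⟩ := hreg (O₁ ∩ O₂) (hO₁.inter hO₂) (inter_subset_inter hAO₁ hAO₂)
  obtain ⟨F₁, F₂, hF₁, hF₂, hcov, hi₁, hi₂, hdis⟩ :=
    exists_adapted_open hA₁ hA₂ hO₁ hO₂ hAO₁ hAO₂ hD hDA hDO
  have hYO : ∀ x ∈ Y, x ∈ F₁ ∩ F₂ ∩ D := fun x hx =>
    have a := hi₁ (show x ∈ O₁ᶜ from disjoint_right.1 hY₁ hx)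
    ⟨⟨a.1, (hi₂ (show x ∈ O₂ᶜ from disjoint_right.1 hY₂ hx)).1⟩, a.2⟩
  refine ⟨(F₁ ∩ F₂)ᶜ, (hF₁.inter hF₂).isOpen_compl, subset_compl_iff_disjoint_right.2 hdis,
    disjoint_left.2 fun x hx hxY => hx (hYO x hxY).1, fun n m hm => ?_⟩
  simp only [compl_compl] at hm
  choose u w hu hw huw using fun i =>
    hsp F₁ F₂ hF₁ hF₂ hcov (m i) ((hm i).mono inter_subset_left)
  obtain ⟨e, he⟩ := h₁ n u fun i => (hu i).mono hi₁
  obtain ⟨e', he'⟩ := h₂ n w fun i => (hw i).mono hi₂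
  refine ⟨Sum.elim e e', fun v hv => ?_⟩
  refine ((he v fun j => hv (.inl j)).mul (he' v fun j => hv (.inr j))).congr fun x hx => ?_
  simp only [huw _ x (hYO x hx), mul_zpow, Finset.prod_mul_distrib]

theorem Defect.of_obstruction [NormalSpace X] (hA₁ : IsClosed A₁) (hA₂ : IsClosed A₂)
    (hreg : ∀ O : Set X, IsOpen O → A₁ ∩ A₂ ⊆ O → ∃ D : Set X, IsClosed D ∧ Disjoint D (A₁ ∩ A₂) ∧
      Oᶜ ⊆ D ∧ ∀ F₁ F₂, IsClosed F₁ → IsClosed F₂ → D ⊆ F₁ ∪ F₂ →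
      ∀ (n : ℕ) (m : Fin n → X → Circle), (∀ i, ContinuousOn (m i) (F₁ ∩ F₂ ∩ D)) →
      ∃ e : Fin n → ℤ, ∀ v : Fin n → ℤ, ∑ i, v i * e i = 0 →
        SplitsOn (fun x => ∏ i, m i x ^ v i) F₁ F₂ D)
    (h₁ : Defect Empty Y A₁) (h₂ : Defect Empty Y A₂) : Defect Unit Y (A₁ ∪ A₂) := by
  obtain ⟨O₁, hO₁, hAO₁, hY₁, h₁⟩ := h₁
  obtain ⟨O₂, hO₂, hAO₂, hY₂, h₂⟩ := h₂
  obtain ⟨D, hD, hDA, hDO, hsp⟩ := hreg (O₁ ∩ O₂) (hO₁.inter hO₂) (inter_subset_inter hAO₁ hAO₂)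
  obtain ⟨F₁, F₂, hF₁, hF₂, hcov, hi₁, hi₂, hdis⟩ :=
    exists_adapted_open hA₁ hA₂ hO₁ hO₂ hAO₁ hAO₂ hD hDA hDO
  have hYO : ∀ x ∈ Y, x ∈ F₁ ∩ F₂ ∩ D := fun x hx =>
    have a := hi₁ (show x ∈ O₁ᶜ from disjoint_right.1 hY₁ hx)
    ⟨⟨a.1, (hi₂ (show x ∈ O₂ᶜ from disjoint_right.1 hY₂ hx)).1⟩, a.2⟩
  refine ⟨(F₁ ∩ F₂)ᶜ, (hF₁.inter hF₂).isOpen_compl, subset_compl_iff_disjoint_right.2 hdis,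
    disjoint_left.2 fun x hx hxY => hx (hYO x hxY).1, fun n m hm => ?_⟩
  simp only [compl_compl] at hm
  obtain ⟨e, he⟩ := hsp F₁ F₂ hF₁ hF₂ hcov n m fun i => (hm i).mono inter_subset_left
  refine ⟨fun _ => e, fun v hv => ?_⟩
  obtain ⟨u, w, hu, hw, huw⟩ := he v (hv ())
  exact ((Defect.logOn h₁ (hu.mono hi₁)).mul (Defect.logOn h₂ (hw.mono hi₂))).congr fun x hx =>
    huw x (hYO x hx)

end

/-- The preimage of a compact set under a translated stereographic projection. -/
theorem exists_retract_st (b : ↥Sph3) (p : E3) {C : Set E3} (hC : IsCompact C) :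
    ∃ (D : Set ↥Sph3) (i : ↥Sph3 → E3) (r : E3 → ↥Sph3), IsClosed D ∧ ContinuousOn i D ∧
      MapsTo i D C ∧ ContinuousOn r C ∧ MapsTo r C D ∧ (∀ x ∈ D, r (i x) = x) ∧
      ∀ x, x ∈ D ↔ x ≠ b ∧ st b x - p ∈ C := by
  have hr : Continuous fun y => (st b).symm (y + p) :=
    (continuous_st_symm b).comp (continuous_id.add continuous_const)
  refine ⟨(fun y => (st b).symm (y + p)) '' C, fun x => st b x - p, fun y => (st b).symm (y + p),
    (hC.image hr).isClosed, ?_, ?_, hr.continuousOn, mapsTo_image _ _, ?_, fun x => ?_⟩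
  · refine ((continuousOn_st b).sub continuousOn_const).mono ?_
    rintro _ ⟨y, -, rfl⟩
    exact st_symm_ne _ _
  · rintro _ ⟨y, hy, rfl⟩
    simpa [st_right_inv] using hy
  · rintro _ ⟨y, -, rfl⟩
    simp [st_right_inv]
  · constructor
    · rintro ⟨y, hy, rfl⟩
      exact ⟨st_symm_ne _ _, by simpa [st_right_inv] using hy⟩
    · rintro ⟨h, h'⟩
      exact ⟨_, h', by simp [st_left_inv h]⟩

theorem exists_st_bound {c : ↥Sph3} {O : Set ↥Sph3} (hO : IsOpen O) (hc : c ∈ O) (p : E3) :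
    ∃ L : ℝ, ∀ x ∉ O, ‖st c x - p‖ ≤ L := by
  obtain ⟨L, hL⟩ := (isCompact_st_image hO.isClosed_compl.isCompact
    (not_not.2 hc : c ∉ Oᶜ)).isBounded.subset_closedBall p
  exact ⟨L, fun x hx => mem_closedBall_iff_norm.1 (hL (mem_image_of_mem _ hx))⟩

theorem hasSplittings_univ : HasSplittings (univ : Set ↥Sph3) := by
  intro F₁ F₂ hF₁ hF₂ hcov m hm
  by_cases h : F₁ = univ
  · refine ⟨1, m, continuousOn_const, hm.mono fun x hx => ⟨⟨h ▸ trivial, hx.1⟩, hx.2⟩, fun x _ => ?_⟩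
    simp
  obtain ⟨c, hc⟩ := (ne_univ_iff_exists_notMem _).1 h
  obtain ⟨L', hL'⟩ := exists_st_bound hF₁.isOpen_compl hc 0
  let L := max (L' + 1) 0
  have hL : ∀ x ∈ F₁, ‖st c x - 0‖ < L := fun x hx =>
    (hL' x (not_not.2 hx)).trans_lt ((lt_add_one _).trans_le (le_max_left _ _))
  obtain ⟨D, i, r, hD, hi, hiD, hr, hrD, hri, hmem⟩ := exists_retract_st c 0
    (isCompact_closedBall (0 : E3) L)
  obtain ⟨D', i', r', hD', hi', hiD', hr', hrD', hri', hmem'⟩ := exists_retract_st c 0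
    ((isCompact_closedBall (0 : E3) L).of_isClosed_subset (isClosed_shell L L)
      fun x hx => mem_closedBall_zero_iff.2 hx.2)
  have hQ : IsClosed ((st c).source ∩ st c ⁻¹' ball 0 L)ᶜ :=
    ((st c).isOpen_inter_preimage isOpen_ball).isClosed_compl
  rw [st_source] at hQ
  have hDQ : D ∪ ({c}ᶜ ∩ st c ⁻¹' ball 0 L)ᶜ = univ := by
    refine eq_univ_of_forall fun x => (em (x ∈ ({c}ᶜ ∩ st c ⁻¹' ball 0 L))).imp (fun hx => ?_) id
    rw [hmem, sub_zero]
    exact ⟨hx.1, ball_subset_closedBall hx.2⟩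
  have hsplit := (hasSplittings_of_convex (isCompact_closedBall _ _)
    (convex_closedBall _ _)).of_retract isClosed_closedBall hi hiD hr hrD hri
    F₁ F₂ hF₁ hF₂ (fun x _ => hcov trivial) m (hm.mono (inter_subset_inter_right _ (subset_univ _)))
  rw [← hDQ]
  refine hsplit.union hF₁ hF₂ (fun x _ => hcov trivial) hD hQ (splitsOn_of_disjoint ?_) ?_
  · refine eq_empty_of_forall_notMem fun x hx => hx.2 ⟨fun h => hc ((show x = c from h) ▸ hx.1.1), ?_⟩
    have := hL x hx.1.1
    rwa [sub_zero, ← mem_ball_zero_iff] at this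
  · have : D ∩ ({c}ᶜ ∩ st c ⁻¹' ball 0 L)ᶜ = D' := by
      ext x
      simp only [mem_inter_iff, mem_compl_iff, mem_singleton_iff, mem_preimage, hmem, hmem', shell,
        mem_ofPred_eq, mem_closedBall_zero_iff, mem_ball_zero_iff, sub_zero, not_and, not_lt]
      tauto
    rw [this]
    exact (hasLogs_shell (le_max_right _ _) le_rfl).of_retract hi' hiD' hr' hrD' hri'

theorem exists_region_point {O : Set ↥Sph3} (hO : IsOpen O) {c : ↥Sph3} (hc : c ∈ O) :
    ∃ D : Set ↥Sph3, IsClosed D ∧ c ∉ D ∧ Oᶜ ⊆ D ∧ HasLogs D ∧ HasSplittings D := by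
  obtain ⟨L, hL⟩ := exists_st_bound hO hc 0
  obtain ⟨D, i, r, hD, hi, hiD, hr, hrD, hri, hmem⟩ := exists_retract_st c 0
    (isCompact_closedBall (0 : E3) L)
  refine ⟨D, hD, fun h => ((hmem c).1 h).1 rfl, fun x hx => (hmem x).2
    ⟨fun h => hx ((show x = c from h) ▸ hc), mem_closedBall_zero_iff.2 (hL x hx)⟩, ?_, ?_⟩
  · exact (hasLogs_of_convex (isCompact_closedBall _ _)
      (convex_closedBall _ _)).of_retract hi hiD hr hrD hri
  · exact (hasSplittings_of_convex (isCompact_closedBall _ _)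
      (convex_closedBall _ _)).of_retract isClosed_closedBall hi hiD hr hrD hri

theorem exists_region_pair {O : Set ↥Sph3} (hO : IsOpen O) {a b : ↥Sph3} (hab : a ≠ b)
    (ha : a ∈ O) (hb : b ∈ O) :
    ∃ D : Set ↥Sph3, IsClosed D ∧ a ∉ D ∧ b ∉ D ∧ Oᶜ ⊆ D ∧
      ∀ F₁ F₂, IsClosed F₁ → IsClosed F₂ → D ⊆ F₁ ∪ F₂ →
      ∀ (n : ℕ) (m : Fin n → ↥Sph3 → Circle), (∀ i, ContinuousOn (m i) (F₁ ∩ F₂ ∩ D)) →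
      ∃ e : Fin n → ℤ, ∀ v : Fin n → ℤ, ∑ i, v i * e i = 0 →
        SplitsOn (fun x => ∏ i, m i x ^ v i) F₁ F₂ D := by
  obtain ⟨L', hL'⟩ := exists_st_bound hO hb (st b a)
  obtain ⟨s, hs, hsO⟩ := Metric.isOpen_iff.1 (hO.preimage (continuous_st_symm b)) (st b a)
    (by rwa [mem_preimage, st_left_inv hab])
  let L := max L' s
  obtain ⟨D, i, r, hD, hi, hiD, hr, hrD, hri, hmem⟩ := exists_retract_st b (st b a)
    ((isCompact_closedBall (0 : E3) L).of_isClosed_subset (isClosed_shell s L)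
      fun x hx => mem_closedBall_zero_iff.2 hx.2)
  refine ⟨D, hD, fun h => ?_, fun h => ((hmem b).1 h).1 rfl, fun x hx => (hmem x).2
    ⟨fun h => hx ((show x = b from h) ▸ hb), ?_, (hL' x hx).trans (le_max_left _ _)⟩, ?_⟩
  · have := ((hmem a).1 h).2.1
    rw [sub_self, norm_zero] at this
    exact this.not_gt hs
  · by_contra hlt
    have h1 := hsO (mem_ball_iff_norm.2 (not_le.1 hlt))
    rw [mem_preimage, st_left_inv fun h => hx ((show x = b from h) ▸ hb)] at h1
    exact hx h1
  · intro F₁ F₂ hF₁ hF₂ hcov n m hm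
    have hsh := isClosed_shell s L
    obtain ⟨e, he⟩ := exists_obstruction_shell hs.le (le_max_right _ _)
      (hr.preimage_isClosed_of_isClosed hsh hF₁) (hr.preimage_isClosed_of_isClosed hsh hF₂)
      (fun y hy => (hcov (hrD hy)).imp (fun h => ⟨hy, h⟩) fun h => ⟨hy, h⟩) (fun i => m i ∘ r)
      (fun i => (hm i).comp (hr.mono inter_subset_right) fun y hy =>
        ⟨⟨hy.1.1.2, hy.1.2.2⟩, hrD hy.2⟩)
    refine ⟨e, fun v hv => ?_⟩
    obtain ⟨u, w, hu, hw, huw⟩ := he v hv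
    have key : ∀ G : Set ↥Sph3, MapsTo i (G ∩ D) (shell s L ∩ r ⁻¹' G ∩ shell s L) :=
      fun G x hx => ⟨⟨hiD hx.2, by rw [mem_preimage, hri x hx.2]; exact hx.1⟩, hiD hx.2⟩
    refine ⟨u ∘ i, w ∘ i, hu.comp (hi.mono inter_subset_right) (key _),
      hw.comp (hi.mono inter_subset_right) (key _), fun x hx => ?_⟩
    have := huw (i x) ⟨⟨(key _ ⟨hx.1.1, hx.2⟩).1, (key _ ⟨hx.1.2, hx.2⟩).1⟩, hiD hx.2⟩
    simpa only [Function.comp_apply, hri x hx.2] using this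

section

variable {Y A₁ A₂ : Set ↥Sph3}

theorem defect_singleton (hY : IsClosed Y) {c : ↥Sph3} (hc : c ∉ Y) : Defect Empty Y {c} := by
  obtain ⟨D, hD, hcD, hYD, hlog, -⟩ := exists_region_point hY.isOpen_compl hc
  rw [compl_compl] at hYD
  refine ⟨Dᶜ, hD.isOpen_compl, singleton_subset_iff.2 hcD,
    disjoint_left.2 fun x hx hxY => hx (hYD hxY), fun n m hm => ⟨0, fun v _ => ?_⟩⟩
  rw [compl_compl] at hm
  exact LogOn.prod _ v fun i _ => (hlog (m i) (hm i)).mono hYD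

theorem Defect.union {ι κ : Type} (hA₁ : IsClosed A₁) (hA₂ : IsClosed A₂)
    (h : (A₁ ∩ A₂).Subsingleton) (h₁ : Defect ι Y A₁) (h₂ : Defect κ Y A₂) :
    Defect (ι ⊕ κ) Y (A₁ ∪ A₂) := by
  refine h₁.of_hasSplittings hA₁ hA₂ (fun O hO hAO => ?_) h₂
  rcases h.eq_empty_or_singleton with h | ⟨c, h⟩ <;> rw [h] at hAO ⊢
  · exact ⟨univ, isClosed_univ, disjoint_empty _, subset_univ _, hasSplittings_univ⟩
  · obtain ⟨D, hD, hcD, hYD, -, hsp⟩ := exists_region_point hO (singleton_subset_iff.1 hAO)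
    exact ⟨D, hD, disjoint_singleton_right.2 hcD, hYD, hsp⟩

theorem Defect.union_pair (hA₁ : IsClosed A₁) (hA₂ : IsClosed A₂) {a b : ↥Sph3}
    (h : A₁ ∩ A₂ ⊆ {a, b}) (h₁ : Defect Empty Y A₁) (h₂ : Defect Empty Y A₂) :
    Defect Unit Y (A₁ ∪ A₂) := by
  by_cases hs : (A₁ ∩ A₂).Subsingleton
  · exact (h₁.union hA₁ hA₂ hs h₂).of_isEmpty
  refine h₁.of_obstruction hA₁ hA₂ (fun O hO hAO => ?_) h₂
  obtain ⟨x, hx, y, hy, hxy⟩ := not_subsingleton_iff.1 hs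
  obtain ⟨D, hD, haD, hbD, hDO, hsp⟩ := exists_region_pair hO hxy (hAO hx) (hAO hy)
  refine ⟨D, hD, disjoint_right.2 fun z hz => ?_, hDO, hsp⟩
  have hz' := h hz
  have hx' := h hx
  have hy' := h hy
  simp only [mem_insert_iff, mem_singleton_iff] at hx' hy' hz'
  rcases hx' with rfl | rfl <;> rcases hy' with rfl | rfl <;> rcases hz' with rfl | rfl <;>
    first | exact absurd rfl hxy | assumption

end

end

end SphereMaps

namespace SphereMaps

open Set Topology Metric unitInterval

noncomputable section

theorem eq_or_eq_neg_of_norm_eq {x y : EuclideanSpace ℝ (Fin 1)} (h : ‖x‖ = ‖y‖) :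
    x = y ∨ x = -y := by
  rw [EuclideanSpace.norm_eq, EuclideanSpace.norm_eq, Fin.sum_univ_one, Fin.sum_univ_one,
    Real.sqrt_sq (norm_nonneg _), Real.sqrt_sq (norm_nonneg _), Real.norm_eq_abs,
    Real.norm_eq_abs, abs_eq_abs] at h
  refine h.imp (fun h => ?_) fun h => ?_ <;> ext i <;> fin_cases i <;> exact h

section

variable {T : Type*} [MetricSpace T] [CompactSpace T] [ChartedSpace (EuclideanSpace ℝ (Fin 1)) T]
  {Y : Set ↥Sph3} {K : Set T}

/-- A proper closed subset of a component of a one-manifold does not obstruct logarithms. -/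
theorem defect_of_proper (hY : IsClosed Y) (φ : C(T, ↥Sph3)) (hφ : Function.Injective φ)
    (hφY : ∀ x, φ x ∉ Y) (hK : IsClopen K) (hKc : IsPreconnected K) {A₀ : Set T}
    (hA₀ : IsClosed A₀) (hA₀K : A₀ ⊆ K) (hne : A₀ ≠ K) : Defect Empty Y (φ '' A₀) := by
  by_contra hbad₀
  obtain ⟨A, hAA, hA, hbad, hmin⟩ := exists_minimal_bad (fun A => Defect Empty Y (φ '' A))
    (fun A hA h => by
      obtain ⟨O, hO, hAO, hOY, h⟩ := h
      exact ⟨φ ⁻¹' O, hO.preimage φ.continuous, image_subset_iff.1 hAO,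
        fun B _ hB => ⟨O, hO, image_subset_iff.2 hB, hOY, h⟩⟩) hA₀ hbad₀
  have hAK := hAA.trans hA₀K
  obtain ⟨t, htK, htA⟩ : ∃ t ∈ K, t ∉ A :=
    not_subset.1 fun h => hne (hA₀K.antisymm (h.trans hAA))
  obtain ⟨x, hx, hxc⟩ : ∃ x ∈ A, x ∈ closure (K \ A) := by
    by_contra! hcon
    have hAo : IsOpen A := by
      have : A = K ∩ (closure (K \ A))ᶜ := by
        ext y
        exact ⟨fun h => ⟨hAK h, hcon y h⟩, fun h => by_contra fun hyA => h.2 (subset_closure ⟨h.1, hyA⟩)⟩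
      rw [this]
      exact hK.isOpen.inter isClosed_closure.isOpen_compl
    rcases A.eq_empty_or_nonempty with rfl | ⟨y, hy⟩
    · exact hbad ((defect_singleton hY (hφY t)).mono (by simp))
    · exact htA (hKc.subset_isClopen ⟨hA, hAo⟩ ⟨y, hAK hy, hy⟩ htK)
  let e := chartAt (EuclideanSpace ℝ (Fin 1)) x
  have hxs : x ∈ e.source := mem_chart_source _ x
  obtain ⟨O, hO, hxO, hOY, hlog⟩ := defect_singleton hY (hφY x)
  obtain ⟨r, hr, hball⟩ := nhds_basis_closedBall.mem_iff.1
    ((e.isOpen_inter_preimage_symm (hO.preimage φ.continuous)).mem_nhds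
      ⟨e.map_source hxs, show φ (e.symm (e x)) ∈ O by
        rw [e.left_inv hxs]; exact hxO rfl⟩)
  obtain ⟨z, ⟨hzs, hzb⟩, hzK, hzA⟩ := mem_closure_iff.1 hxc _ (isOpen_chart_disc e (e x) r)
    ⟨hxs, mem_ball_self hr⟩
  let d := dist (e z) (e x)
  have hd : 0 < d := dist_pos.2 fun h => hzA (e.injOn hzs hxs h ▸ hx)
  have hball' : closedBall (e x) d ⊆ e.target ∩ e.symm ⁻¹' (φ ⁻¹' O) :=
    (closedBall_subset_closedBall (le_of_lt hzb)).trans hball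
  have hJ := isClosed_chart_disc e (hball'.trans inter_subset_left)
  have hJo : IsOpen (e.source ∩ e ⁻¹' ball (e x) d) := isOpen_chart_disc e _ _
  have h1 : Defect Empty Y (φ '' (A ∩ e.symm '' closedBall (e x) d)) := by
    refine ⟨O, hO, ?_, hOY, hlog⟩
    rintro _ ⟨_, ⟨-, w, hw, rfl⟩, rfl⟩
    exact (hball' hw).2
  have h2 : Defect Empty Y (φ '' (A \ (e.source ∩ e ⁻¹' ball (e x) d))) :=
    hmin _ (hA.sdiff hJo) sdiff_subset fun h => (h.symm ▸ hx :
      x ∈ A \ (e.source ∩ e ⁻¹' ball (e x) d)).2 ⟨hxs, mem_ball_self hd⟩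
  have hcl : ∀ B : Set T, IsClosed B → IsClosed (φ '' B) := fun B hB =>
    (hB.isCompact.image φ.continuous).isClosed
  have hu := h1.union (hcl _ (hA.inter hJ)) (hcl _ (hA.sdiff hJo)) (by
    rw [← image_inter hφ]
    refine Subsingleton.image (s := _) (fun y hy w hw => ?_) _
    have key : ∀ y ∈ A ∩ e.symm '' closedBall (e x) d ∩ (A \ (e.source ∩ e ⁻¹' ball (e x) d)),
        y ∈ e.source ∧ e y - e x = -(e z - e x) := by
      rintro _ ⟨⟨-, w, hw, rfl⟩, hyA, hyJ⟩
      have hs : e.symm w ∈ e.source := e.map_target (hball' hw).1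
      have hew : e (e.symm w) = w := e.right_inv (hball' hw).1
      refine ⟨hs, (eq_or_eq_neg_of_norm_eq ?_).resolve_left fun h => hzA ?_⟩
      · rw [← dist_eq_norm, ← dist_eq_norm]
        refine le_antisymm (by rw [hew]; exact hw) (not_lt.1 fun h => hyJ ⟨hs, h⟩)
      · rw [← e.injOn hs hzs (sub_left_injective h)]
        exact hyA
    exact e.injOn (key y hy).1 (key w hw).1
      (sub_left_injective ((key y hy).2.trans (key w hw).2.symm))) h2
  refine hbad (hu.of_isEmpty.mono (A₁ := φ '' A) ?_)
  rw [← image_union]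
  refine image_mono fun y hy => ?_
  by_cases hyJ : y ∈ e.source ∩ e ⁻¹' ball (e x) d
  · exact Or.inl ⟨hy, e y, ball_subset_closedBall hyJ.2, e.left_inv hyJ.1⟩
  · exact Or.inr ⟨hy, hyJ⟩

/-- A component of a one-manifold gives a single obstruction to logarithms. -/
theorem defect_component (hY : IsClosed Y) (φ : C(T, ↥Sph3)) (hφ : Function.Injective φ)
    (hφY : ∀ x, φ x ∉ Y) (hK : IsClopen K) (hKc : IsConnected K) : Defect Unit Y (φ '' K) := by
  obtain ⟨x, hx⟩ := hKc.nonempty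
  let e := chartAt (EuclideanSpace ℝ (Fin 1)) x
  have hxs : x ∈ e.source := mem_chart_source _ x
  obtain ⟨O, hO, hxO, hOY, hlog⟩ := defect_singleton hY (hφY x)
  obtain ⟨r, hr, hball⟩ := nhds_basis_closedBall.mem_iff.1
    ((e.isOpen_inter_preimage_symm (hO.preimage φ.continuous)).mem_nhds
      ⟨e.map_source hxs, show φ (e.symm (e x)) ∈ O by
        rw [e.left_inv hxs]; exact hxO rfl⟩)
  have hJ := isClosed_chart_disc e (hball.trans inter_subset_left)
  have hJo : IsOpen (e.source ∩ e ⁻¹' ball (e x) r) := isOpen_chart_disc e _ _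
  have h1 : Defect Empty Y (φ '' (K ∩ e.symm '' closedBall (e x) r)) := by
    refine ⟨O, hO, ?_, hOY, hlog⟩
    rintro _ ⟨_, ⟨-, w, hw, rfl⟩, rfl⟩
    exact (hball hw).2
  have h2 : Defect Empty Y (φ '' (K \ (e.source ∩ e ⁻¹' ball (e x) r))) :=
    defect_of_proper hY φ hφ hφY hK hKc.isPreconnected (hK.isClosed.sdiff hJo) sdiff_subset
      fun h => (h.symm ▸ hx : x ∈ K \ (e.source ∩ e ⁻¹' ball (e x) r)).2 ⟨hxs, mem_ball_self hr⟩
  have hcl : ∀ B : Set T, IsClosed B → IsClosed (φ '' B) := fun B hB =>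
    (hB.isCompact.image φ.continuous).isClosed
  let u : EuclideanSpace ℝ (Fin 1) := EuclideanSpace.single 0 r
  refine (h1.union_pair (hcl _ (hK.isClosed.inter hJ)) (hcl _ (hK.isClosed.sdiff hJo))
    (a := φ (e.symm (u + e x))) (b := φ (e.symm (-u + e x))) ?_ h2).mono ?_
  · rw [← image_inter hφ]
    rintro _ ⟨_, ⟨⟨-, w, hw, rfl⟩, hyA, hyJ⟩, rfl⟩
    have hs : e.symm w ∈ e.source := e.map_target (hball hw).1
    have hew : e (e.symm w) = w := e.right_inv (hball hw).1
    have : ‖w - e x‖ = ‖u‖ := by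
      rw [← dist_eq_norm, PiLp.norm_single, Real.norm_of_nonneg hr.le]
      exact le_antisymm hw (not_lt.1 fun h => hyJ ⟨hs, by rw [mem_preimage, hew]; exact h⟩)
    rcases eq_or_eq_neg_of_norm_eq this with h | h <;> rw [← h, sub_add_cancel]
    · exact Or.inl rfl
    · exact Or.inr rfl
  · rw [← image_union]
    refine image_mono fun y hy => ?_
    by_cases hyJ : y ∈ e.source ∩ e ⁻¹' ball (e x) r
    · exact Or.inl ⟨hy, e y, ball_subset_closedBall hyJ.2, e.left_inv hyJ.1⟩
    · exact Or.inr ⟨hy, hyJ⟩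

end

end

end SphereMaps

namespace SphereMaps

open Set Topology Metric unitInterval

noncomputable section

theorem continuousOn_indicator {X : Type*} [TopologicalSpace X] {U s : Set X} {f : X → ℝ}
    (hf : ContinuousOn f s) (h : ∀ x ∈ s ∩ frontier U, f x = 0) :
    ContinuousOn (U.indicator f) s := by
  classical
  rw [← piecewise_eq_indicator]
  exact ContinuousOn.piecewise h (hf.mono inter_subset_left) continuousOn_const

theorem exists_ne_zero_pairing_eq_zero {ι : Type*} [Fintype ι] {n : ℕ} (hn : Fintype.card ι < n)
    (e : ι → Fin n → ℤ) : ∃ v : Fin n → ℤ, v ≠ 0 ∧ ∀ j, ∑ i, v i * e j i = 0 := by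
  let L : (Fin n → ℤ) →ₗ[ℤ] (ι → ℤ) := (Matrix.of e).mulVecLin
  have hL : ¬ Function.Injective L := fun h =>
    (card_le_of_injective ℤ L h).not_gt (by rwa [Fintype.card_fin])
  rw [injective_iff_map_eq_zero] at hL
  push Not at hL
  obtain ⟨v, hv, hv0⟩ := hL
  refine ⟨v, hv0, fun j => (Finset.sum_congr rfl fun i _ => mul_comm _ _).trans (congrFun hv j)⟩

/-- Two closed sets with connected complement whose intersection only gives one obstruction to
logarithms separate the sphere in at most two pieces. -/
theorem false_of_three_sides {A D : Set ↥Sph3} (hA : IsClosed A) (hD : IsClosed D)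
    (hAne : A.Nonempty) (hDne : D.Nonempty) (hW : IsPreconnected Aᶜ) (hV : IsPreconnected Dᶜ)
    (hdef : ∀ Y, IsClosed Y → Disjoint (A ∩ D) Y → Defect Unit Y (A ∩ D)) {p₁ : ↥Sph3}
    {p : Fin 2 → ↥Sph3} {U : Fin 2 → Set ↥Sph3} (hU : ∀ i, frontier (U i) ⊆ A ∪ D)
    (hp : ∀ i j, p j ∈ U i ↔ i = j) (hp₁ : ∀ i, p₁ ∉ U i) (hpN : ∀ i, p i ∉ A ∪ D)
    (hp₁N : p₁ ∉ A ∪ D) : False := by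
  have hloc : LocallyPathConnectedSpace ↥Sph3 :=
    ChartedSpace.locallyPathConnectedSpace (EuclideanSpace ℝ (Fin 3)) _
  let f : ↥Sph3 → ℝ := fun x => infDist x D / (infDist x A + infDist x D)
  have hf : ContinuousOn f (A ∩ D)ᶜ := by
    refine (continuous_infDist_pt D).continuousOn.div
      ((continuous_infDist_pt A).add (continuous_infDist_pt D)).continuousOn fun x hx h0 => hx ?_
    have h1 := infDist_nonneg (x := x) (s := A)
    have h2 := infDist_nonneg (x := x) (s := D)
    exact ⟨(hA.mem_iff_infDist_zero hAne).2 (by linarith),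
      (hD.mem_iff_infDist_zero hDne).2 (by linarith)⟩
  have hfD : ∀ x ∈ D, f x = 0 := fun x hx => by simp only [f, infDist_zero_of_mem hx, zero_div]
  have hfA : ∀ x ∈ A, x ∉ D → f x = 1 := fun x hx hxD => by
    have : infDist x D ≠ 0 := fun h => hxD ((hD.mem_iff_infDist_zero hDne).2 h)
    simp only [f, infDist_zero_of_mem hx, zero_add, div_self this]
  let G : Fin 2 → ↥Sph3 → ℝ := fun i => (U i).indicator f
  let H : Fin 2 → ↥Sph3 → ℝ := fun i => (U i).indicator fun x => f x - 1
  have hG : ∀ i, ContinuousOn (G i) Aᶜ := fun i =>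
    continuousOn_indicator (hf.mono (compl_subset_compl.2 inter_subset_left)) fun x hx =>
      hfD x ((hU i hx.2).resolve_left hx.1)
  have hH : ∀ i, ContinuousOn (H i) Dᶜ := fun i =>
    continuousOn_indicator ((hf.mono (compl_subset_compl.2 inter_subset_right)).sub
      continuousOn_const) fun x hx => by
        rw [hfA x ((hU i hx.2).resolve_right hx.1) hx.1, sub_self]
  have hGH : ∀ i x, Circle.exp (2 * Real.pi * G i x) = Circle.exp (2 * Real.pi * H i x) := by
    intro i x
    by_cases hx : x ∈ U i
    · simp only [G, H, indicator_of_mem hx]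
      exact Circle.exp_eq_exp.2 ⟨1, by push_cast; ring⟩
    · simp only [G, H, indicator_of_notMem hx]
  let m : Fin 2 → ↥Sph3 → Circle := fun i x => Circle.exp (2 * Real.pi * G i x)
  have hm : ∀ i, ContinuousOn (m i) (A ∩ D)ᶜ := by
    intro i
    rw [compl_inter]
    refine ContinuousOn.union_of_isOpen ?_ ?_ hA.isOpen_compl hD.isOpen_compl
    · exact Circle.exp.continuous.comp_continuousOn (continuousOn_const.mul (hG i))
    · exact (Circle.exp.continuous.comp_continuousOn (continuousOn_const.mul (hH i))).congr
        fun x _ => hGH i x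
  have hjoin : ∀ B : Set ↥Sph3, IsClosed B → B ⊆ A ∪ D → IsPreconnected Bᶜ → ∀ j,
      JoinedIn Bᶜ p₁ (p j) := fun B hB hBN hc j =>
    (hB.isOpen_compl.isConnected_iff_isPathConnected.1
      ⟨⟨p₁, fun h => hp₁N (hBN h)⟩, hc⟩).joinedIn _ (fun h => hp₁N (hBN h)) _
      fun h => hpN j (hBN h)
  choose γ hγ using hjoin A hA subset_union_left hW
  choose δ hδ using hjoin D hD subset_union_right hV
  let Y : Set ↥Sph3 := ⋃ j, (range (γ j) ∪ range (δ j))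
  have hY : IsClosed Y := isClosed_iUnion_of_finite fun j =>
    (isCompact_range (γ j).continuous).isClosed.union (isCompact_range (δ j).continuous).isClosed
  have hYγ : ∀ j, range (γ j) ⊆ Y := fun j =>
    subset_union_left.trans (subset_iUnion (fun j => range (γ j) ∪ range (δ j)) j)
  have hYδ : ∀ j, range (δ j) ⊆ Y := fun j =>
    subset_union_right.trans (subset_iUnion (fun j => range (γ j) ∪ range (δ j)) j)
  obtain ⟨O, hO, hAO, hOY, hdef⟩ := hdef Y hY (disjoint_right.2 fun x hx hxAD => by
    obtain ⟨j, ⟨t, rfl⟩ | ⟨t, rfl⟩⟩ := mem_iUnion.1 hx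
    · exact hγ j t hxAD.1
    · exact hδ j t hxAD.2)
  obtain ⟨e, he⟩ := hdef 2 m fun i => (hm i).mono (compl_subset_compl.2 hAO)
  obtain ⟨v, hv, hve⟩ := exists_ne_zero_pairing_eq_zero (by simp) e
  obtain ⟨lam, hlam, hexp⟩ := he v hve
  have hexp' : ∀ x ∈ Y, ∀ g : Fin 2 → ↥Sph3 → ℝ, (∀ i, m i x = Circle.exp (2 * Real.pi * g i x)) →
      Circle.exp (lam x) = Circle.exp (∑ i, v i * (2 * Real.pi * g i x)) := by
    intro x hx g hg
    rw [← hexp x hx, exp_sum]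
    exact Finset.prod_congr rfl fun i _ => by rw [exp_int_mul, hg]
  have hcont : ∀ (g : Fin 2 → ↥Sph3 → ℝ) (s : Set ↥Sph3), (∀ i, ContinuousOn (g i) s) →
      ContinuousOn (fun x => ∑ i, v i * (2 * Real.pi * g i x)) s := fun g s h =>
    continuousOn_finsetSum _ fun i _ => continuousOn_const.mul (continuousOn_const.mul (h i))
  refine hv (funext fun j => ?_)
  obtain ⟨k, hk⟩ := exists_int_eq_of_exp_eq (isPreconnected_range (γ j).continuous)
    (hlam.mono (hYγ j)) (hcont G _ fun i => (hG i).mono (range_subset_iff.2 (hγ j)))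
    fun x hx => hexp' x (hYγ j hx) G fun i => rfl
  obtain ⟨l, hl⟩ := exists_int_eq_of_exp_eq (isPreconnected_range (δ j).continuous)
    (hlam.mono (hYδ j)) (hcont H _ fun i => (hH i).mono (range_subset_iff.2 (hδ j)))
    fun x hx => hexp' x (hYδ j hx) H fun i => hGH i x
  have hk0 := hk p₁ ⟨0, (γ j).source⟩
  have hk1 := hk (p j) ⟨1, (γ j).target⟩
  have hl0 := hl p₁ ⟨0, (δ j).source⟩
  have hl1 := hl (p j) ⟨1, (δ j).target⟩
  simp only [G, H, indicator_of_notMem (hp₁ _), mul_zero, Finset.sum_const_zero, zero_add] at hk0 hl0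
  have hkl : (k : ℝ) * (2 * Real.pi) = l * (2 * Real.pi) := hk0.symm.trans hl0
  have hmem : p j ∈ U j := (hp j j).2 rfl
  have hnot : ∀ i ∈ Finset.univ, i ≠ j → p j ∉ U i := fun i _ hij h => hij ((hp i j).1 h)
  rw [Finset.sum_eq_single j (fun i hi hij => by
    simp only [G, indicator_of_notMem (hnot i hi hij), mul_zero]) (fun h => absurd (Finset.mem_univ j) h)] at hk1
  rw [Finset.sum_eq_single j (fun i hi hij => by
    simp only [H, indicator_of_notMem (hnot i hi hij), mul_zero]) (fun h => absurd (Finset.mem_univ j) h)] at hl1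
  simp only [G, H, indicator_of_mem hmem] at hk1 hl1
  have h0 : (v j : ℝ) * (2 * Real.pi) = 0 := by linear_combination hl1 - hk1 - hkl
  have hpi : (2 * Real.pi) ≠ 0 := by positivity
  exact_mod_cast (mul_eq_zero.1 h0).resolve_right hpi

/-- A small disc in a surface in the sphere, and the complement of the open disc. -/
theorem exists_circle_cut {N : Set ↥Sph3} [ChartedSpace (EuclideanSpace ℝ (Fin 2)) ↥N]
    [CompactSpace ↥N] [Nonempty ↥N] :
    ∃ (A D : Set N) (φ : C(↥(sphere (0 : EuclideanSpace ℝ (Fin 2)) 1), ↥Sph3)),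
      IsClosed A ∧ IsClosed D ∧ A ∪ D = univ ∧ A.Nonempty ∧ D.Nonempty ∧ Aᶜ.Nonempty ∧
      Dᶜ.Nonempty ∧ Function.Injective φ ∧
      (Subtype.val '' A ∩ Subtype.val '' D : Set ↥Sph3) = range φ := by
  obtain ⟨x⟩ : Nonempty ↥N := inferInstance
  let e := chartAt (EuclideanSpace ℝ (Fin 2)) x
  have hxs : x ∈ e.source := mem_chart_source _ x
  obtain ⟨r', hr', hball'⟩ := nhds_basis_closedBall.mem_iff.1
    (e.open_target.mem_nhds (e.map_source hxs))
  obtain ⟨r, hr0⟩ : ∃ r, r = r' / 2 := ⟨_, rfl⟩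
  have hr : 0 < r := hr0 ▸ half_pos hr'
  have hrr : r < r' := hr0 ▸ half_lt_self hr'
  have hball : closedBall (e x) r ⊆ e.target :=
    (closedBall_subset_closedBall hrr.le).trans hball'
  let D' : Set N := e.symm '' closedBall (e x) r
  let A' : Set N := (e.source ∩ e ⁻¹' ball (e x) r)ᶜ
  have hD' : IsClosed D' := isClosed_chart_disc e hball
  have hA' : IsClosed A' := (isOpen_chart_disc e _ _).isClosed_compl
  have hAD' : A' ∪ D' = univ := eq_univ_of_forall fun y => by
    by_cases hy : y ∈ e.source ∩ e ⁻¹' ball (e x) r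
    · exact Or.inr ⟨e y, ball_subset_closedBall hy.2, e.left_inv hy.1⟩
    · exact Or.inl hy
  obtain ⟨u, hu⟩ : ∃ u : EuclideanSpace ℝ (Fin 2), ‖u‖ = r' :=
    ⟨EuclideanSpace.single 0 r', by rw [PiLp.norm_single, Real.norm_of_nonneg hr'.le]⟩
  have hut : u + e x ∈ e.target := hball' (by rw [mem_closedBall_iff_norm, add_sub_cancel_right, hu])
  have hxA : x ∉ A' := fun h => h (mem_inter hxs (mem_preimage.2 (mem_ball_self hr)))
  have hzD : e.symm (u + e x) ∉ D' := by
    rintro ⟨w, hw, h⟩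
    rw [e.symm.injOn (hball hw) hut h, mem_closedBall_iff_norm, add_sub_cancel_right, hu] at hw
    exact hrr.not_ge hw
  let g : ↥(sphere (0 : EuclideanSpace ℝ (Fin 2)) 1) → EuclideanSpace ℝ (Fin 2) :=
    fun t => r • (t : EuclideanSpace ℝ (Fin 2)) + e x
  have hg : ∀ t, g t ∈ closedBall (e x) r := fun t => by
    rw [mem_closedBall_iff_norm, add_sub_cancel_right, norm_smul, mem_sphere_zero_iff_norm.1 t.2,
      mul_one, Real.norm_of_nonneg hr.le]
  let φ : C(↥(sphere (0 : EuclideanSpace ℝ (Fin 2)) 1), ↥Sph3) :=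
    ⟨fun t => e.symm (g t), continuous_subtype_val.comp
      (e.continuousOn_symm.comp_continuous (by fun_prop) fun t => hball (hg t))⟩
  have hφ : Function.Injective φ := fun s t h => by
    have h1 := add_right_cancel (e.symm.injOn (hball (hg s)) (hball (hg t)) (Subtype.ext h))
    exact Subtype.ext (smul_right_injective _ hr.ne' h1)
  have hrange : (Subtype.val '' A' ∩ Subtype.val '' D' : Set ↥Sph3) = range φ := by
    rw [← image_inter Subtype.val_injective]
    ext z
    constructor
    · rintro ⟨_, ⟨hyA, w, hw, rfl⟩, rfl⟩
      have hd : ‖w - e x‖ = r := by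
        refine le_antisymm (mem_closedBall_iff_norm.1 hw) (not_lt.1 fun h => hyA ?_)
        refine ⟨e.map_target (hball hw), ?_⟩
        rw [mem_preimage, e.right_inv (hball hw)]
        exact mem_ball_iff_norm.2 h
      refine ⟨⟨r⁻¹ • (w - e x), ?_⟩, ?_⟩
      · rw [mem_sphere_zero_iff_norm, norm_smul, hd, Real.norm_of_nonneg (inv_nonneg.2 hr.le),
          inv_mul_cancel₀ hr.ne']
      · simp only [φ, g, ContinuousMap.coe_mk, smul_inv_smul₀ hr.ne', sub_add_cancel]
    · rintro ⟨t, rfl⟩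
      refine ⟨_, ⟨fun h => ?_, mem_image_of_mem _ (hg t)⟩, rfl⟩
      have h1 := h.2
      rw [mem_preimage, e.right_inv (hball (hg t)), mem_ball_iff_norm, add_sub_cancel_right,
        norm_smul, mem_sphere_zero_iff_norm.1 t.2, mul_one, Real.norm_of_nonneg hr.le] at h1
      exact lt_irrefl _ h1
  exact ⟨A', D', φ, hA', hD', hAD', ⟨_, fun h => hzD
      ⟨_, ball_subset_closedBall h.2, e.left_inv h.1⟩⟩,
    ⟨x, e x, mem_closedBall_self hr.le, e.left_inv hxs⟩, ⟨x, fun h => hxA h⟩, ⟨_, hzD⟩, hφ, hrange⟩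

theorem defect_circle {Y : Set ↥Sph3} (hY : IsClosed Y)
    (φ : C(↥(sphere (0 : EuclideanSpace ℝ (Fin 2)) 1), ↥Sph3)) (hφ : Function.Injective φ)
    (hφY : Disjoint (range φ) Y) : Defect Unit Y (range φ) := by
  let _ : Fact (Module.finrank ℝ (EuclideanSpace ℝ (Fin 2)) = 1 + 1) := ⟨by simp⟩
  have hcirc : IsConnected (sphere (0 : EuclideanSpace ℝ (Fin 2)) 1) := by
    refine isConnected_sphere ?_ _ zero_le_one
    rw [← Module.finrank_eq_rank]; simp
  have hcs : ConnectedSpace ↥(sphere (0 : EuclideanSpace ℝ (Fin 2)) 1) :=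
    isConnected_iff_connectedSpace.1 hcirc
  rw [← image_univ]
  exact defect_component hY φ hφ (fun t => disjoint_left.1 hφY (mem_range_self t))
    isClopen_univ isConnected_univ

/-- The complement of a connected closed surface has at most two components. -/
theorem exists_connected_pair {N : Set ↥Sph3} [ChartedSpace (EuclideanSpace ℝ (Fin 2)) ↥N]
    [CompactSpace ↥N] [ConnectedSpace ↥N] {q : ↥Sph3} (hq : q ∉ N) (p : Fin 3 → ↥Sph3)
    (hp : ∀ i, p i ∉ N) : ∃ i j, i ≠ j ∧ p j ∈ connectedComponentIn Nᶜ (p i) := by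
  by_contra! hcon
  have hN : IsCompact N := isCompact_iff_compactSpace.2 inferInstance
  have hloc : LocallyConnectedSpace ↥Sph3 :=
    ChartedSpace.locallyConnectedSpace (EuclideanSpace ℝ (Fin 3)) _
  have hcl : ∀ B : Set N, IsClosed B → IsClosed (Subtype.val '' B : Set ↥Sph3) := fun B hB =>
    (hB.isCompact.image continuous_subtype_val).isClosed
  obtain ⟨A, D, φ, hA, hD, hAD, hAne, hDne, hAc, hDc, hφ, hrange⟩ := exists_circle_cut (N := N)
  have hsub : ∀ B : Set N, (Subtype.val '' B : Set ↥Sph3) ⊆ N := fun B => by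
    rintro _ ⟨y, -, rfl⟩; exact y.2
  have hconn : ∀ B : Set N, IsClosed B → (∃ y, y ∉ B) →
      IsPreconnected (Subtype.val '' B : Set ↥Sph3)ᶜ := fun B hB ⟨y, hy⟩ =>
    isPreconnected_compl_of_st (hcl B hB) (fun h => hq (hsub B h))
      (isPreconnected_compl_proper_surface hq (hcl B hB) (hsub B) fun h => hy <| by
        obtain ⟨z, hz, hzy⟩ := h.ge y.2
        rwa [← Subtype.ext hzy])
  have hunion : (Subtype.val '' A ∪ Subtype.val '' D : Set ↥Sph3) = N := by
    rw [← image_union, hAD, image_univ, Subtype.range_coe]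
  refine false_of_three_sides (hcl A hA) (hcl D hD) (hAne.image _) (hDne.image _)
    (hconn A hA hAc) (hconn D hD hDc) (fun Y hY hdis => ?_) (p₁ := p 0)
    (p := fun j => p j.succ) (U := fun j => connectedComponentIn Nᶜ (p j.succ))
    (fun j => hunion.symm ▸ frontier_connectedComponentIn_subset hN.isClosed _) (fun i j => ?_)
    (fun i => hcon _ _ (Fin.succ_ne_zero i)) (fun i => hunion.symm ▸ hp _) (hunion.symm ▸ hp _)
  · rw [hrange] at hdis ⊢
    exact defect_circle hY φ hφ hdis
  · constructor
    · intro h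
      by_contra hij
      exact hcon _ _ (fun h => hij (Fin.succ_injective _ h)) h
    · rintro rfl
      exact mem_connectedComponentIn (hp _)

end

end SphereMaps

namespace SphereMaps

open Set Topology Metric unitInterval

noncomputable section

theorem exists_notMem_surface (N : Set ↥Sph3) [ChartedSpace (EuclideanSpace ℝ (Fin 2)) ↥N] :
    ∃ q, q ∉ N := by
  by_contra! h
  have h1 := interior_surface N
  rw [eq_univ_of_forall h, interior_univ] at h1
  exact univ_nonempty.ne_empty h1

theorem defect_of_components {S Y : Set ↥Sph3} [ChartedSpace (EuclideanSpace ℝ (Fin 1)) ↥S]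
    [CompactSpace ↥S] (hY : IsClosed Y) (hSY : Disjoint S Y) {c : ↥Sph3} (hc : c ∉ Y)
    (h : ∀ p : Fin 3 → ↥S, ∃ i j, i ≠ j ∧ p j ∈ connectedComponent (p i)) :
    Defect (Unit ⊕ Unit) Y S := by
  have hloc : LocallyConnectedSpace ↥S :=
    ChartedSpace.locallyConnectedSpace (EuclideanSpace ℝ (Fin 1)) _
  have h0 : Defect Unit Y ∅ := ((defect_singleton hY hc).mono (empty_subset _)).of_isEmpty
  have hcl : ∀ B : Set S, IsClosed B → IsClosed (Subtype.val '' B : Set ↥Sph3) := fun B hB =>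
    (hB.isCompact.image continuous_subtype_val).isClosed
  have h1 : ∀ p : ↥S, Defect Unit Y (Subtype.val '' connectedComponent p : Set ↥Sph3) := fun p =>
    defect_component hY ⟨Subtype.val, continuous_subtype_val⟩ Subtype.val_injective
      (fun x => disjoint_left.1 hSY x.2) isClopen_connectedComponent isConnected_connectedComponent
  rcases isEmpty_or_nonempty ↥S with hS | ⟨⟨p⟩⟩
  · rw [isEmpty_coe_sort.1 hS, ← union_empty ∅]
    exact h0.union isClosed_empty isClosed_empty (by simp) h0
  · by_cases hp : ∃ q, q ∉ connectedComponent p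
    · obtain ⟨q, hq⟩ := hp
      have hd : Disjoint (connectedComponent p) (connectedComponent q) :=
        connectedComponent_disjoint fun h => hq (h ▸ mem_connectedComponent)
      have hu : S = Subtype.val '' connectedComponent p ∪ Subtype.val '' connectedComponent q := by
        suffices h' : connectedComponent p ∪ connectedComponent q = univ by
          rw [← image_union, h', image_univ, Subtype.range_coe]
        refine eq_univ_of_forall fun r => ?_
        by_contra hr
        rw [mem_union, not_or] at hr
        have key : ∀ x y : ↥S, y ∈ connectedComponent x → x ∈ connectedComponent y := fun x y hxy =>
          connectedComponent_eq hxy ▸ mem_connectedComponent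
        obtain ⟨i, k, hik, hmem⟩ := h ![p, q, r]
        fin_cases i <;> fin_cases k <;> first
          | exact hik rfl | exact hq hmem | exact hr.1 hmem | exact hr.2 hmem
          | exact hq (key _ _ hmem) | exact hr.1 (key _ _ hmem) | exact hr.2 (key _ _ hmem)
      have := (h1 p).union (hcl _ isClosed_connectedComponent) (hcl _ isClosed_connectedComponent)
        (by rw [← image_inter Subtype.val_injective, hd.inter_eq, image_empty]
            exact subsingleton_empty) (h1 q)
      rwa [← hu] at this
    · push Not at hp
      have := (h1 p).union (hcl _ isClosed_connectedComponent) isClosed_empty (by simp) h0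
      rwa [union_empty, eq_univ_of_forall hp, image_univ, Subtype.range_coe] at this

theorem connectedSpace_of_retract {S N : Set ↥Sph3} [ChartedSpace (EuclideanSpace ℝ (Fin 1)) ↥S]
    [CompactSpace ↥S] [Nonempty ↥N] (hdisj : Disjoint N S) (P : C(↥(Sᶜ), ↥N))
    (j : C(↥N, ↥(Sᶜ))) (hPj : ∀ y, P (j y) = y) : ConnectedSpace ↥N := by
  obtain ⟨x⟩ : Nonempty ↥N := inferInstance
  have hSc : ConnectedSpace ↥(Sᶜ) := isConnected_iff_connectedSpace.1
    ⟨⟨x, disjoint_left.1 hdisj x.2⟩,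
      isPreconnected_compl_one_manifold (disjoint_left.1 hdisj x.2)⟩
  exact (show Function.Surjective P from fun y => ⟨j y, hPj y⟩).connectedSpace P.continuous

/-- If the complement of `S` retracts up to homotopy onto `N`, there are at most two obstructions
to logarithms on `N`. -/
theorem defect_of_retract {S N : Set ↥Sph3} [ChartedSpace (EuclideanSpace ℝ (Fin 1)) ↥S]
    [CompactSpace ↥S] [ChartedSpace (EuclideanSpace ℝ (Fin 2)) ↥N] [CompactSpace ↥N]
    [Nonempty ↥N] (hdisj : Disjoint N S) (P : C(↥(Sᶜ), ↥N)) (j : C(↥N, ↥(Sᶜ)))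
    (hj : ∀ y : ↥N, ((j y : ↥(Sᶜ)) : ↥Sph3) = (y : ↥Sph3)) (hPj : ∀ y, P (j y) = y)
    (hom : (j.comp P).Homotopic (ContinuousMap.id ↥(Sᶜ))) : Defect (Unit ⊕ Unit) N S := by
  obtain ⟨q, hq⟩ := exists_notMem_surface N
  have hN : IsClosed N := (isCompact_iff_compactSpace.2 inferInstance : IsCompact N).isClosed
  have hloc : LocallyConnectedSpace ↥S :=
    ChartedSpace.locallyConnectedSpace (EuclideanSpace ℝ (Fin 1)) _
  have hNc : ConnectedSpace ↥N := connectedSpace_of_retract hdisj P j hPj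
  have hcl : ∀ B : Set S, IsClosed B → IsClosed (Subtype.val '' B : Set ↥Sph3) := fun B hB =>
    (hB.isCompact.image continuous_subtype_val).isClosed
  refine defect_of_components hN hdisj.symm hq fun p => ?_
  obtain ⟨i, k, hik, hmem⟩ := exists_connected_pair hq (fun i => (p i : ↥Sph3))
    fun i => disjoint_right.1 hdisj (p i).2
  refine ⟨i, k, hik, by_contra fun hk => ?_⟩
  have hclopen : IsClopen (connectedComponent (p i)) := isClopen_connectedComponent
  refine not_connected_of_separated P j hj hom (hcl _ hclopen.1)
    (image_subset_iff.2 fun y _ => y.2) ?_ (mem_image_of_mem _ mem_connectedComponent)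
    (q := p k) ⟨(p k).2, ?_⟩ isPreconnected_connectedComponentIn
    (connectedComponentIn_subset Nᶜ (p i : ↥Sph3))
    (mem_connectedComponentIn (disjoint_right.1 hdisj (p i).2)) hmem
  · have := hcl _ hclopen.2.isClosed_compl
    rwa [image_compl_eq_range_sdiff_image Subtype.val_injective, Subtype.range_coe] at this
  · rintro ⟨y, hy, hyk⟩
    exact hk (Subtype.ext hyk ▸ hy)

end

end SphereMaps

namespace SphereMaps

open Set Topology Metric unitInterval

noncomputable section

/-- An additive function of homotopy classes of paths. -/
structure PathCocycle (X : Type*) [TopologicalSpace X] where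
  /-- The value of the cocycle on a path. -/
  toFun : ∀ y z : X, Path y z → ℤ
  homotopic : ∀ {y z : X} {p q : Path y z}, p.Homotopic q → toFun y z p = toFun y z q
  trans : ∀ {x y z : X} (p : Path x y) (q : Path y z),
    toFun x z (p.trans q) = toFun x y p + toFun y z q

theorem PathCocycle.cast {X : Type*} [TopologicalSpace X] (α : PathCocycle X) {y z y' z' : X}
    (p : Path y z) (hy : y' = y) (hz : z' = z) :
    α.toFun y' z' (p.cast hy hz) = α.toFun y z p := by
  subst hy hz; rfl

/-- A homomorphism from the fundamental group to the integers extends to a cocycle. -/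
theorem exists_pathCocycle {X : Type*} [TopologicalSpace X] [PathConnectedSpace X] {x₀ : X}
    (χ : FundamentalGroup X x₀ →* Multiplicative ℤ) : ∃ α : PathCocycle X, ∀ γ : Path x₀ x₀,
      α.toFun x₀ x₀ γ = Multiplicative.toAdd (χ (FundamentalGroup.fromPath ⟦γ⟧)) := by
  open CategoryTheory in
  let c : ∀ y : X, FundamentalGroupoid.mk x₀ ⟶ FundamentalGroupoid.mk y := fun y =>
    FundamentalGroupoid.fromPath ⟦PathConnectedSpace.somePath x₀ y⟧
  let f : ∀ {y z : X}, (FundamentalGroupoid.mk y ⟶ FundamentalGroupoid.mk z) → ℤ := fun {y z} p =>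
    Multiplicative.toAdd (χ (c y ≫ p ≫ inv (c z)))
  have hmul : ∀ p q : FundamentalGroup X x₀, Multiplicative.toAdd (χ (p ≫ q)) =
      Multiplicative.toAdd (χ p) + Multiplicative.toAdd (χ q) := fun p q => by
    rw [add_comm, ← toAdd_mul, ← map_mul]; rfl
  have hf : ∀ {x y z : X} (p : FundamentalGroupoid.mk x ⟶ FundamentalGroupoid.mk y)
      (q : FundamentalGroupoid.mk y ⟶ FundamentalGroupoid.mk z), f (p ≫ q) = f p + f q := by
    intro x y z p q
    refine Eq.trans ?_ (hmul _ _)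
    simp [f]
  refine ⟨⟨fun y z p => f (FundamentalGroupoid.fromPath ⟦p⟧), fun h => ?_, fun p q =>
    hf (FundamentalGroupoid.fromPath ⟦p⟧) (FundamentalGroupoid.fromPath ⟦q⟧)⟩,
    fun γ => ?_⟩
  · exact congrArg f (Quotient.sound h)
  · have h1 := hmul (c x₀) (FundamentalGroupoid.fromPath ⟦γ⟧ ≫ inv (c x₀))
    have h2 := hmul (FundamentalGroupoid.fromPath ⟦γ⟧) (inv (c x₀))
    have h3 := hmul (c x₀) (inv (c x₀))
    have h4 : Multiplicative.toAdd (χ (c x₀ ≫ inv (c x₀))) = 0 := by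
      rw [IsIso.hom_inv_id]
      exact congrArg Multiplicative.toAdd (map_one χ)
    change Multiplicative.toAdd (χ (c x₀ ≫ FundamentalGroupoid.fromPath ⟦γ⟧ ≫ inv (c x₀))) = _
    change _ = Multiplicative.toAdd (χ (FundamentalGroupoid.fromPath ⟦γ⟧))
    linarith

/-- Cocycles have primitives along maps from simply connected spaces. -/
theorem PathCocycle.exists_primitive {X Z : Type*} [TopologicalSpace X] [TopologicalSpace Z]
    [SimplyConnectedSpace Z] (α : PathCocycle X) (F : C(Z, X)) :
    ∃ β : Z → ℤ, ∀ {a b : Z} (p : Path a b), α.toFun _ _ (p.map F.continuous) = β b - β a := by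
  obtain ⟨z₀⟩ : Nonempty Z := inferInstance
  refine ⟨fun a => α.toFun _ _ ((PathConnectedSpace.somePath z₀ a).map F.continuous),
    fun {a b} p => ?_⟩
  rw [eq_sub_iff_add_eq', ← α.trans, ← Path.map_trans]
  exact α.homotopic ((SimplyConnectedSpace.paths_homotopic _ _).map F)

theorem exists_simplyConnected_nhds {M E : Type*} [TopologicalSpace M] [NormedAddCommGroup E]
    [NormedSpace ℝ E] [ChartedSpace E M] (x : M) :
    ∃ U : Set M, IsOpen U ∧ x ∈ U ∧ SimplyConnectedSpace ↥U := by
  let e := chartAt E x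
  have hx := mem_chart_source E x
  obtain ⟨r, hr, hball⟩ := Metric.mem_nhds_iff.1 (e.open_target.mem_nhds (e.map_source hx))
  have _ : ContractibleSpace ↥(ball (e x) r) := contractibleSpace_ball hr
  refine ⟨e.source ∩ e ⁻¹' ball (e x) r, e.isOpen_inter_preimage isOpen_ball,
    mem_inter hx (mem_preimage.2 (mem_ball_self hr)), ?_⟩
  have h := e.homeomorphOfImageSubsetSource (s := e.source ∩ e ⁻¹' ball (e x) r) (t := ball (e x) r)
    inter_subset_left (by
      ext y
      constructor
      · rintro ⟨z, hz, rfl⟩; exact hz.2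
      · exact fun hy => ⟨e.symm y, mem_inter (e.map_target (hball hy))
          (mem_preimage.2 ((e.right_inv (hball hy)).symm ▸ hy)), e.right_inv (hball hy)⟩)
  exact h.toHomotopyEquiv.simplyConnectedSpace

/-- The average of local primitives differs continuously from every primitive. -/
theorem continuous_average_sub_primitive {M Z ι : Type*} [TopologicalSpace M] [TopologicalSpace Z]
    [LocallyPathConnectedSpace Z] [Fintype ι] (α : PathCocycle M) {U : ι → Set M}
    (hU : ∀ i, IsOpen (U i)) {ρ : PartitionOfUnity ι M} (hρ : ρ.IsSubordinate U)
    {a : ∀ i, U i → ℤ} (ha : ∀ i {y z : U i} (p : Path y z),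
      α.toFun _ _ (p.map continuous_subtype_val) = a i z - a i y) {A : ι → M → ℝ}
    (hA : ∀ i y (h : y ∈ U i), A i y = a i ⟨y, h⟩) (F : C(Z, M)) {β : Z → ℤ}
    (hβ : ∀ {s t : Z} (p : Path s t), α.toFun _ _ (p.map F.continuous) = β t - β s) :
    Continuous fun z => ∑ i, ρ i (F z) * A i (F z) - β z := by
  have hsum : ∀ y, ∑ i, ρ i y = 1 := fun y => by
    rw [← finsum_eq_sum_of_fintype]; exact ρ.sum_eq_one (mem_univ y)
  have : (fun z => ∑ i, ρ i (F z) * A i (F z) - β z) = fun z => ∑ i, ρ i (F z) * (A i (F z) - β z) := by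
    ext z
    simp only [mul_sub, Finset.sum_sub_distrib, ← Finset.sum_mul, hsum, one_mul]
  rw [this]
  refine continuous_finsetSum _ fun i _ => continuous_iff_continuousAt.2 fun z => ?_
  by_cases hz : F z ∈ tsupport (ρ i)
  · have hzU := hρ i hz
    have hopen : IsOpen (F ⁻¹' U i) := (hU i).preimage F.continuous
    refine ((ρ i).continuous.comp F.continuous).continuousAt.mul
      ((continuousAt_const (y := A i (F z) - β z)).congr ?_)
    filter_upwards [pathComponentIn_mem_nhds (hopen.mem_nhds hzU)] with z' hz'
    obtain ⟨p, hp⟩ := hz'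
    have h1 := hβ p
    have hzU' : F z' ∈ U i := p.target ▸ hp 1
    have h2 := ha i (y := ⟨F z, hzU⟩) (z := ⟨F z', hzU'⟩)
      ⟨⟨fun t => ⟨F (p t), hp t⟩, (F.continuous.comp p.continuous).subtype_mk _⟩, by simp, by simp⟩
    rw [hA i _ hzU, hA i _ hzU']
    have h3 := h2.symm.trans h1
    rw [sub_eq_sub_iff_add_eq_add] at h3 ⊢
    rw [add_comm] at h3
    exact_mod_cast (show _ = _ by linarith)
  · have : ∀ᶠ z' in 𝓝 z, ρ i (F z') * (A i (F z') - β z') = 0 := by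
      filter_upwards [F.continuous.continuousAt ((isClosed_tsupport _).isOpen_compl.mem_nhds hz)]
        with z' hz'
      rw [image_eq_zero_of_notMem_tsupport hz', zero_mul]
    exact continuousAt_const.congr (this.mono fun _ h => h.symm)

/-- Every homomorphism from the fundamental group to the integers is induced by a map to the
circle. -/
theorem exists_circle_map {M E : Type*} [TopologicalSpace M] [CompactSpace M] [T2Space M]
    [NormedAddCommGroup E] [NormedSpace ℝ E] [ChartedSpace E M] [PathConnectedSpace M] {x₀ : M}
    (χ : FundamentalGroup M x₀ →* Multiplicative ℤ) : ∃ m : C(M, Circle), ∀ γ : Path x₀ x₀,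
      ∃ h : C(I, ℝ), (∀ t, m (γ t) = Circle.exp (h t)) ∧ h 0 - h 1 =
        Multiplicative.toAdd (χ (FundamentalGroup.fromPath ⟦γ⟧)) * (2 * Real.pi) := by
  obtain ⟨α, hα⟩ := exists_pathCocycle χ
  have hloc : LocallyPathConnectedSpace M := ChartedSpace.locallyPathConnectedSpace E M
  choose U hU hxU hUs using exists_simplyConnected_nhds (M := M) (E := E)
  obtain ⟨T, hT⟩ := isCompact_univ.elim_finite_subcover U hU fun x _ => mem_iUnion.2 ⟨x, hxU x⟩
  choose a ha using fun i : T => α.exists_primitive (⟨Subtype.val, continuous_subtype_val⟩ : C(U i, M))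
  obtain ⟨ρ, hρ⟩ := PartitionOfUnity.exists_isSubordinate isClosed_univ (fun i : T => U i)
    (fun i => hU i) (hT.trans (iUnion₂_subset fun i hi => subset_iUnion (fun i : T => U i) ⟨i, hi⟩))
  classical
  let A : T → M → ℝ := fun i y => if h : y ∈ U i then a i ⟨y, h⟩ else 0
  have hA : ∀ (i : T) y (h : y ∈ U i), A i y = a i ⟨y, h⟩ := fun i y h => dif_pos h
  let u : M → ℝ := fun y => ∑ i, ρ i y * A i y
  have hexp : ∀ (x : ℝ) (k : ℤ), Circle.exp (2 * Real.pi * x) = Circle.exp (2 * Real.pi * (x - k)) :=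
    fun x k => Circle.exp_eq_exp.2 ⟨k, by ring⟩
  refine ⟨⟨fun y => Circle.exp (2 * Real.pi * u y), continuous_iff_continuousAt.2 fun y => ?_⟩,
    fun γ => ?_⟩
  · have _ : LocallyPathConnectedSpace ↥(U y) := (hU y).locallyPathConnectedSpace
    obtain ⟨b, hb⟩ := α.exists_primitive (⟨Subtype.val, continuous_subtype_val⟩ : C(U y, M))
    have h1 := Circle.exp.continuous.comp ((continuous_average_sub_primitive α (fun i : T => hU i) hρ ha hA
      (⟨Subtype.val, continuous_subtype_val⟩ : C(U y, M)) hb).const_mul (2 * Real.pi))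
    refine ContinuousOn.continuousAt (s := U y) ?_ ((hU y).mem_nhds (hxU y))
    rw [continuousOn_iff_continuous_domRestrict]
    exact h1.congr fun z => (hexp _ _).symm
  · obtain ⟨β, hβ⟩ := α.exists_primitive γ.extend
    have hcont := continuous_average_sub_primitive α (fun i : T => hU i) hρ ha hA γ.extend hβ
    refine ⟨⟨fun t => 2 * Real.pi * (u (γ t) - β t), ?_⟩, fun t => hexp _ _, ?_⟩
    · refine ((hcont.comp continuous_subtype_val).const_mul (2 * Real.pi)).congr fun t => ?_
      simp only [Function.comp_apply, Path.extend_extends', u]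
    · have h1 := hβ (⟨⟨Subtype.val, continuous_subtype_val⟩, rfl, rfl⟩ : Path (0 : ℝ) 1)
      rw [← α.cast _ γ.extend_zero.symm γ.extend_one.symm] at h1
      have h2 : α.toFun x₀ x₀ γ = β 1 - β 0 := by
        rw [← h1]
        congr 1
        ext t
        exact (γ.extend_extends' t).symm
      rw [← hα, h2]
      simp only [ContinuousMap.coe_mk, γ.source, γ.target, Icc.coe_zero, Icc.coe_one]
      push_cast
      ring

end

end SphereMaps

namespace SphereMaps

open Set Topology Metric unitInterval

noncomputable section

/-- The coordinate homomorphisms from the surface group to the integers. -/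
theorem exists_surfaceGroup_coord {ℓ : ℕ} (i : Fin ℓ ⊕ Fin ℓ) :
    ∃ χ : surfaceGroup ℓ →* Multiplicative ℤ, ∀ k,
      Multiplicative.toAdd (χ (PresentedGroup.of k)) = if k = i then 1 else 0 := by
  refine ⟨PresentedGroup.toGroup (f := fun k => Multiplicative.ofAdd (if k = i then 1 else 0)) ?_,
    fun k => by rw [PresentedGroup.toGroup.of, toAdd_ofAdd]⟩
  rintro r rfl
  rw [map_list_prod, List.prod_eq_one]
  simp only [List.map_ofFn, List.mem_ofFn, Function.comp_apply]
  rintro _ ⟨k, rfl⟩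
  simp only [map_mul, map_inv]
  rw [mul_inv_cancel_comm, mul_inv_cancel]

/-- Maps to the circle with a common logarithm on a surface satisfy the same relation on the
fundamental group. -/
theorem sum_eq_zero_of_logOn {X : Type*} [TopologicalSpace X] {N : Set X} {n : ℕ}
    {m : Fin n → X → Circle} {v : Fin n → ℤ} (hlog : LogOn N fun x => ∏ i, m i x ^ v i)
    {x : ↥N} (γ : Path x x) {h : Fin n → C(I, ℝ)} (hh : ∀ i t, m i (γ t) = Circle.exp (h i t)) :
    ∑ i, v i * (h i 0 - h i 1) = 0 := by
  obtain ⟨θ, hθ, hexp⟩ := hlog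
  obtain ⟨k, hk⟩ := exists_int_eq_of_exp_eq (isPreconnected_univ (α := I))
    (θ := fun t => θ (γ t)) (θ' := fun t => ∑ i, v i * h i t)
    (hθ.comp_continuous (continuous_subtype_val.comp γ.continuous) fun t => (γ t).2).continuousOn
    (Continuous.continuousOn (by fun_prop)) fun t _ => by
      rw [← hexp _ (γ t).2, exp_sum]
      exact Finset.prod_congr rfl fun i _ => by rw [exp_int_mul, hh]
  have h0 := hk 0 trivial
  have h1 := hk 1 trivial
  simp only [γ.source, γ.target] at h0 h1
  simp only [mul_sub, Finset.sum_sub_distrib]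
  linarith

end

end SphereMaps

theorem no_homotopy_retract_onto_genus_ge_two_surface
    (ℓ : ℕ) (hℓ : 2 ≤ ℓ) (S N : Set ↥Sph3)
    [ChartedSpace (EuclideanSpace ℝ (Fin 1)) ↥S] [CompactSpace ↥S]
    [ChartedSpace (EuclideanSpace ℝ (Fin 2)) ↥N] [CompactSpace ↥N]
    (hdisj : Disjoint N S)
    (hgenus : ∃ x : ↥N, Nonempty (FundamentalGroup ↥N x ≃* surfaceGroup ℓ)) :
    ¬ ∃ (P : C(↥(Sᶜ), ↥N)) (j : C(↥N, ↥(Sᶜ))),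
        (∀ y : ↥N, ((j y : ↥(Sᶜ)) : ↥Sph3) = (y : ↥Sph3)) ∧ (∀ y : ↥N, P (j y) = y) ∧
        (j.comp P).Homotopic (ContinuousMap.id ↥(Sᶜ)) := by
  classical
  rintro ⟨P, j, hj, hPj, hom⟩
  obtain ⟨x, ⟨Φ⟩⟩ := hgenus
  have _ : Nonempty ↥N := ⟨x⟩
  have _ : ConnectedSpace ↥N := SphereMaps.connectedSpace_of_retract hdisj P j hPj
  have _ : LocallyPathConnectedSpace ↥N :=
    ChartedSpace.locallyPathConnectedSpace (EuclideanSpace ℝ (Fin 2)) _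
  have _ : PathConnectedSpace ↥N := pathConnectedSpace_iff_connectedSpace.2 inferInstance
  obtain ⟨s⟩ : Nonempty (Fin 3 ↪ Fin ℓ ⊕ Fin ℓ) :=
    Function.Embedding.nonempty_of_card_le (by simp; omega)
  choose χ hχ using fun i => SphereMaps.exists_surfaceGroup_coord (s i)
  choose m hm using fun i => SphereMaps.exists_circle_map (E := EuclideanSpace ℝ (Fin 2))
    ((χ i).comp Φ.toMonoidHom)
  obtain ⟨O, -, hSO, -, hdef⟩ := SphereMaps.defect_of_retract hdisj P j hj hPj hom
  let M : Fin 3 → ↥Sph3 → Circle := fun i y => if h : y ∈ Sᶜ then m i (P ⟨y, h⟩) else 1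
  have hM : ∀ i, ContinuousOn (M i) Oᶜ := fun i => by
    refine ContinuousOn.mono (s := Sᶜ) ?_ (Set.compl_subset_compl.2 hSO)
    rw [continuousOn_iff_continuous_domRestrict]
    refine ((m i).continuous.comp P.continuous).congr fun y => ?_
    simp only [Set.domRestrict_apply, M, dif_pos y.2, Function.comp_apply]
  have hMN : ∀ i (y : ↥N), M i y = m i y := fun i y => by
    have hy : (y : ↥Sph3) ∈ Sᶜ := Set.disjoint_left.1 hdisj y.2
    have : (⟨y, hy⟩ : ↥(Sᶜ)) = j y := Subtype.ext (hj y).symm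
    simp only [M, dif_pos hy, this, hPj]
  obtain ⟨e, he⟩ := hdef 3 M hM
  obtain ⟨v, hv, hve⟩ := SphereMaps.exists_ne_zero_pairing_eq_zero (by simp) e
  refine hv (funext fun k => ?_)
  obtain ⟨γ, hγ⟩ := Quotient.exists_rep (s := Path.Homotopic.setoid x x)
    (FundamentalGroup.toPath (Φ.symm (PresentedGroup.of (s k))))
  choose h hh hdiff using fun i => hm i γ
  have h0 := SphereMaps.sum_eq_zero_of_logOn (he v hve) γ fun i t => (hMN i _).trans (hh i t)
  have h1 : ∀ i, h i 0 - h i 1 = (if i = k then 1 else 0) * (2 * Real.pi) := fun i => by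
    have h2 : ((χ i).comp Φ.toMonoidHom) (FundamentalGroup.fromPath ⟦γ⟧) =
        χ i (PresentedGroup.of (s k)) := by
      rw [hγ]
      exact congrArg (χ i) (Φ.apply_symm_apply _)
    rw [hdiff, h2, hχ]
    simp only [s.injective.eq_iff, eq_comm (a := k)]
    push_cast
    rfl
  simp only [h1, ite_mul, one_mul, zero_mul, mul_ite, mul_zero, Finset.sum_ite_eq',
    Finset.mem_univ, if_true] at h0
  have hpi : (2 * Real.pi) ≠ 0 := by positivity
  exact_mod_cast (mul_eq_zero.1 h0).resolve_right hpi
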